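/- Let K be a non-angular convex body in ℝ^d, where d is an odd prime power. Then there exists a regular crosspolytope all of whose 2d vertices lie on ∂K. -/

import Mathlib

set_option linter.all false
namespace Crs
open ExteriorAlgebra

section EA
variable {F : Type} [Field F] {X Y : Type}

variable (F) in
abbrev EA (X : Type) := ExteriorAlgebra F (X →₀ F)

variable (F) in
noncomputable def g (x : X) : EA F X := ι F (Finsupp.single x 1)

theorem g_sq (x : X) : g F x * g F x = 0 := by
  unfold g; exact ι_sq_zero _

theorem g_anti (x y : X) : g F x * g F y = -(g F y * g F x) := by
  unfold g; exact eq_neg_of_add_eq_zero_left (ι_add_mul_swap _ _)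

variable (F) in
noncomputable def mon (l : List X) : EA F X := (l.map (g F)).prod

theorem mon_nil : mon F ([] : List X) = 1 := rfl
theorem mon_cons (x : X) (l : List X) : mon F (x :: l) = g F x * mon F l := by simp [mon]
theorem mon_append (l l' : List X) : mon F (l ++ l') = mon F l * mon F l' := by simp [mon]

theorem g_mul_mon (x : X) (l : List X) : g F x * mon F l = (-1 : ℤ) ^ l.length • (mon F l * g F x) := by
  induction l with
  | nil => simp [mon_nil]
  | cons y l ih =>
    rw [mon_cons, ← mul_assoc, g_anti x y, neg_mul, mul_assoc, ih]
    simp only [List.length_cons, pow_succ, mul_smul_comm, mul_assoc, mul_neg, mul_one, neg_smul]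

theorem g_mul_mon_mem (x : X) (l : List X) (h : x ∈ l) : g F x * mon F l = 0 := by
  induction l with
  | nil => simp at h
  | cons y l ih =>
    rw [mon_cons, ← mul_assoc]
    rcases List.mem_cons.1 h with rfl | h
    · rw [g_sq, zero_mul]
    · rw [g_anti, neg_mul, mul_assoc, ih h]; simp

theorem mon_eq_zero (l : List X) (h : ¬ l.Nodup) : mon F l = 0 := by
  induction l with
  | nil => simp at h
  | cons y l ih =>
    rw [mon_cons]
    by_cases hy : y ∈ l
    · exact g_mul_mon_mem y l hy
    · rw [ih (fun h' => h (List.nodup_cons.2 ⟨hy, h'⟩)), mul_zero]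

theorem mon_perm {l l' : List X} (h : l.Perm l') : mon F l = mon F l' ∨ mon F l = - mon F l' := by
  induction h with
  | nil => simp
  | cons x _ ih =>
    rw [mon_cons, mon_cons]; rcases ih with h | h <;> simp [h]
  | swap x y l =>
    right; rw [mon_cons, mon_cons, mon_cons, mon_cons, ← mul_assoc, g_anti, neg_mul, mul_assoc]
  | trans _ _ h1 h2 =>
    rcases h1 with h | h <;> rcases h2 with h' | h' <;> simp [h, h']

/-- contraction -/
noncomputable def cont (φ : X → F) : EA F X →ₗ[F] EA F X :=
  CliffordAlgebra.contractLeft (Q := (0 : QuadraticForm F (X →₀ F))) (Finsupp.linearCombination F φ)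

theorem cont_g_mul (φ : X → F) (x : X) (a : EA F X) :
    cont φ (g F x * a) = φ x • a - g F x * cont φ a := by
  unfold cont g
  have := CliffordAlgebra.contractLeft_ι_mul (Q := (0 : QuadraticForm F (X →₀ F)))
    (d := Finsupp.linearCombination F φ) (a := Finsupp.single x 1) (b := a)
  simpa using this

theorem cont_one (φ : X → F) : cont φ (1 : EA F X) = 0 := by
  unfold cont
  exact CliffordAlgebra.contractLeft_one (Q := (0 : QuadraticForm F (X →₀ F))) (Finsupp.linearCombination F φ)

theorem cont_g (φ : X → F) (x : X) : cont φ (g F x) = algebraMap F _ (φ x) := by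
  have := cont_g_mul φ x 1
  rw [mul_one, cont_one, mul_zero, sub_zero] at this
  rw [this, Algebra.algebraMap_eq_smul_one]

theorem cont_mon_notMem [DecidableEq X] (x : X) (l : List X) (h : x ∉ l) :
    cont (fun y => if y = x then (1 : F) else 0) (mon F l) = 0 := by
  induction l with
  | nil => rw [mon_nil, cont_one]
  | cons y l ih =>
    simp only [List.mem_cons, not_or] at h
    rw [mon_cons, cont_g_mul, ih h.2, if_neg (fun h' => h.1 h'.symm)]; simp

theorem mon_ne_zero (l : List X) (h : l.Nodup) : mon F l ≠ 0 := by
  classical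
  induction l with
  | nil => rw [mon_nil]; exact one_ne_zero
  | cons y l ih =>
    rw [List.nodup_cons] at h
    intro h0
    have := congrArg (cont (F := F) (fun z => if z = y then (1 : F) else 0)) h0
    rw [mon_cons, cont_g_mul, cont_mon_notMem y l h.1, map_zero] at this
    simp at this
    exact ih h.2 this

variable (F) in
noncomputable def Gr (s : Set X) (k : ℕ) : Submodule F (EA F X) :=
  Submodule.span F {a | ∃ l : List X, l.length = k ∧ (∀ x ∈ l, x ∈ s) ∧ a = mon F l}

theorem mon_mem_Gr {s : Set X} {k : ℕ} {l : List X} (h : l.length = k) (hs : ∀ x ∈ l, x ∈ s) :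
    mon F l ∈ Gr F s k := Submodule.subset_span ⟨l, h, hs, rfl⟩

theorem one_mem_Gr (s : Set X) : (1 : EA F X) ∈ Gr F s 0 := mon_mem_Gr (l := []) rfl (by simp)

theorem g_mem_Gr {s : Set X} {x : X} (h : x ∈ s) : g F x ∈ Gr F s 1 := by
  have := mon_mem_Gr (F := F) (s := s) (l := [x]) rfl (by simpa using h)
  simpa [mon] using this

theorem Gr_induction {s : Set X} {k : ℕ} (P : Submodule F (EA F X))
    (h : ∀ l : List X, l.length = k → (∀ x ∈ l, x ∈ s) → mon F l ∈ P) : Gr F s k ≤ P := by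
  unfold Gr
  rw [Submodule.span_le]
  rintro _ ⟨l, h1, h2, rfl⟩
  exact h l h1 h2

theorem mul_mem_Gr {s : Set X} {k m : ℕ} {a b : EA F X} (ha : a ∈ Gr F s k) (hb : b ∈ Gr F s m) :
    a * b ∈ Gr F s (k + m) := by
  have h1 : Gr F s k ≤ (Gr F s (k + m)).comap (LinearMap.mulRight F b) := by
    apply Gr_induction
    intro l hl hls
    have h2 : Gr F s m ≤ (Gr F s (k + m)).comap (LinearMap.mulLeft F (mon F l)) := by
      apply Gr_induction
      intro l' hl' hls'
      simp only [Submodule.mem_comap, LinearMap.mulLeft_apply]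
      rw [← mon_append]
      apply mon_mem_Gr
      · simp [hl, hl']
      · intro x hx
        rcases List.mem_append.1 hx with h | h
        exacts [hls x h, hls' x h]
    exact h2 hb
  exact h1 ha

theorem g_mul_mem_Gr {s : Set X} {k : ℕ} {x : X} {b : EA F X} (h : x ∈ s) (hb : b ∈ Gr F s k) :
    g F x * b ∈ Gr F s (k + 1) := by
  rw [add_comm]; exact mul_mem_Gr (g_mem_Gr h) hb

theorem cont_mem_Gr (φ : X → F) {s : Set X} {k : ℕ} {a : EA F X} (ha : a ∈ Gr F s (k + 1)) :
    cont φ a ∈ Gr F s k := by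
  revert a
  change Gr F s (k + 1) ≤ (Gr F s k).comap (cont φ)
  have h1 : Gr F s (k + 1) ≤ (Gr F s k).comap (cont φ) := by
    apply Gr_induction
    intro l
    induction l generalizing k with
    | nil => simp
    | cons x l ih =>
      intro hl hs
      simp only [Submodule.mem_comap]
      rw [mon_cons, cont_g_mul]
      have hl' : l.length = k := by simpa using hl
      refine Submodule.sub_mem _ (Submodule.smul_mem _ _ (mon_mem_Gr hl' ?_)) ?_
      · intro y hy; exact hs y (List.mem_cons_of_mem _ hy)
      · rcases k with _ | k
        · rw [List.length_eq_zero_iff.1 hl', mon_nil, cont_one, mul_zero]; exact zero_mem _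
        · exact g_mul_mem_Gr (hs x (by simp))
            (ih hl' (fun y hy => hs y (List.mem_cons_of_mem _ hy)))
  exact h1

theorem Gr_mono {s s' : Set X} (h : s ⊆ s') (k : ℕ) : Gr F s k ≤ Gr F s' k :=
  Gr_induction _ fun _ h1 h2 => mon_mem_Gr h1 fun x hx => h (h2 x hx)

theorem eq_zero_of_mem_Gr {s : Set X} (hs : s.Finite) {k : ℕ} (hk : s.ncard < k) {a : EA F X}
    (ha : a ∈ Gr F s k) : a = 0 := by
  have : Gr F s k ≤ ⊥ := by
    apply Gr_induction
    intro l hl hls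
    rw [Submodule.mem_bot]
    apply mon_eq_zero
    intro hn
    classical
    have h1 : l.toFinset.card = k := by rw [List.toFinset_card_of_nodup hn, hl]
    have h2 : (l.toFinset : Set X).ncard ≤ s.ncard :=
      Set.ncard_le_ncard (by intro x hx; exact hls x (by simpa using hx)) hs
    rw [Set.ncard_coe_finset] at h2
    omega
  simpa using this ha

theorem eq_smul_of_mem_Gr [Fintype X] {k : ℕ} (hk : Fintype.card X = k) {l : List X}
    (hl : l.Nodup) (hl' : ∀ x, x ∈ l) {a : EA F X} {s : Set X}
    (ha : a ∈ Gr F s k) : ∃ c : F, a = c • mon F l := by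
  have : Gr F s k ≤ Submodule.span F {mon F l} := by
    apply Gr_induction
    intro l' hl2 hls
    by_cases hn : l'.Nodup
    · have hp : l'.Perm l := by
        have hsub : l'.Subperm l := hn.subperm (fun x _ => hl' x)
        refine hsub.perm_of_length_le ?_
        rw [hl2, ← hk]
        classical
        rw [← List.toFinset_card_of_nodup hl]; exact Finset.card_le_univ _
      rcases mon_perm (F := F) hp with h | h <;> rw [h]
      · exact Submodule.mem_span_singleton_self _
      · exact Submodule.neg_mem _ (Submodule.mem_span_singleton_self _)
    · rw [mon_eq_zero _ hn]; exact zero_mem _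
  obtain ⟨c, hc⟩ := Submodule.mem_span_singleton.1 (this ha)
  exact ⟨c, hc.symm⟩

/-- functoriality -/
noncomputable def mapE (f : X → Y) : EA F X →ₐ[F] EA F Y :=
  ExteriorAlgebra.map (Finsupp.lmapDomain F F f)

@[simp] theorem mapE_g (f : X → Y) (x : X) : mapE f (g F x) = g F (f x) := by
  unfold mapE g; rw [map_apply_ι]; simp

theorem mapE_mon (f : X → Y) (l : List X) : mapE f (mon F l) = mon F (l.map f) := by
  unfold mon; rw [map_list_prod]; simp [Function.comp_def]

theorem mapE_mem_Gr (f : X → Y) {s : Set X} {k : ℕ} {a : EA F X} (ha : a ∈ Gr F s k) :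
    mapE f a ∈ Gr F (f '' s) k := by
  have : Gr F s k ≤ (Gr F (f '' s) k).comap (mapE f).toLinearMap := by
    apply Gr_induction
    intro l hl hls
    simp only [Submodule.mem_comap, AlgHom.toLinearMap_apply]
    rw [mapE_mon]
    apply mon_mem_Gr (by simpa using hl)
    intro y hy
    obtain ⟨x, hx, rfl⟩ := List.mem_map.1 hy
    exact ⟨x, hls x hx, rfl⟩
  exact this ha

theorem EA_hom_ext {B : Type} [Semiring B] [Algebra F B] {f f' : EA F X →ₐ[F] B}
    (h : ∀ x, f (g F x) = f' (g F x)) : f = f' := by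
  apply ExteriorAlgebra.hom_ext
  apply Finsupp.lhom_ext
  intro x c
  have := h x
  unfold g at this
  have h2 : (Finsupp.single x c : X →₀ F) = c • Finsupp.single x 1 := by simp
  rw [h2]; simp only [map_smul]
  exact congrArg (c • ·) this

theorem mapE_mapE {Z : Type} (f : X → Y) (f' : Y → Z) (a : EA F X) :
    mapE f' (mapE f a) = mapE (f' ∘ f) a := by
  have : (mapE f').comp (mapE f) = mapE (F := F) (f' ∘ f) := EA_hom_ext (by simp)
  exact DFunLike.congr_fun this a

theorem mapE_id (a : EA F X) : mapE id a = a := by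
  have : mapE (F := F) (id : X → X) = AlgHom.id F _ := EA_hom_ext (by simp)
  exact DFunLike.congr_fun this a

theorem mapE_perm_mon [Fintype X] [DecidableEq X] (σ : Equiv.Perm X) {l : List X} (hl : l.Nodup)
    (hl' : ∀ x, x ∈ l) : mapE σ (mon F l) = ((Equiv.Perm.sign σ : ℤˣ) : ℤ) • mon F l := by
  have key : ∀ l' : List X, mon F l' = ιMulti F l'.length (fun i => Finsupp.single (l'.get i) (1 : F)) := by
    intro l'
    rw [ιMulti_apply]
    unfold mon g
    congr 1
    apply List.ext_getElem <;> simp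
  let e : Fin l.length ≃ X := hl.getEquivOfForallMemList l hl'
  rw [key l]
  unfold mapE
  rw [map_apply_ιMulti]
  have h1 : (⇑(Finsupp.lmapDomain F F ⇑σ) ∘ fun i => Finsupp.single (l.get i) (1 : F)) =
      (fun i => Finsupp.single (l.get i) (1 : F)) ∘ ((e.symm.permCongr σ : Equiv.Perm _)) := by
    funext i
    have : l.get (e.symm (σ (e i))) = σ (l.get i) := by
      change e (e.symm (σ (e i))) = σ (e i)
      simp
    simp only [Function.comp_apply, Finsupp.lmapDomain_apply, Finsupp.mapDomain_single, Equiv.permCongr_apply, Equiv.symm_symm]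
    rw [this]
  rw [h1, AlternatingMap.map_perm, Equiv.Perm.sign_permCongr]
  rfl

theorem exists_list (X : Type) [Fintype X] : ∃ l : List X, l.Nodup ∧ ∀ x, x ∈ l :=
  ⟨Finset.univ.toList, Finset.nodup_toList _, by simp⟩

theorem mapE_perm [Fintype X] [DecidableEq X] (σ : Equiv.Perm X) {k : ℕ} (hk : Fintype.card X = k)
    {s : Set X} {a : EA F X} (ha : a ∈ Gr F s k) :
    mapE σ a = ((Equiv.Perm.sign σ : ℤˣ) : ℤ) • a := by
  obtain ⟨l, h1, h2⟩ := exists_list X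
  obtain ⟨c, rfl⟩ := eq_smul_of_mem_Gr hk h1 h2 ha
  rw [map_smul, mapE_perm_mon σ h1 h2, smul_comm]

/-- (graded) commutation -/
theorem mul_comm_Gr {s t : Set X} {k m : ℕ} {a b : EA F X} (ha : a ∈ Gr F s k) (hb : b ∈ Gr F t m) :
    a * b = (-1 : ℤ) ^ (k * m) • (b * a) := by
  have h1 : Gr F s k ≤ LinearMap.eqLocus (LinearMap.mulRight F b)
      ((-1 : F) ^ (k * m) • LinearMap.mulLeft F b) := by
    apply Gr_induction
    intro l hl hls
    have h2 : Gr F t m ≤ LinearMap.eqLocus (LinearMap.mulLeft F (mon F l))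
      ((-1 : F) ^ (k * m) • LinearMap.mulRight F (mon F l)) := by
      apply Gr_induction
      intro l' hl' hls'
      simp only [LinearMap.mem_eqLocus, LinearMap.mulLeft_apply, LinearMap.smul_apply, LinearMap.mulRight_apply]
      subst hl hl'
      clear hls hls' ha hb
      induction l with
      | nil => simp [mon_nil]
      | cons x l ih =>
        rw [mon_cons, mul_assoc, ih, mul_smul_comm, ← mul_assoc, g_mul_mon]
        simp only [List.length_cons, smul_mul_assoc, mul_assoc, add_mul, pow_add, one_mul]
        rw [mul_smul]
        congr 1
        rcases Nat.even_or_odd l'.length with h | h <;> simp [h]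
    exact h2 hb
  have := h1 ha
  simp only [LinearMap.mem_eqLocus, LinearMap.mulLeft_apply, LinearMap.smul_apply, LinearMap.mulRight_apply] at this
  rw [this]
  rcases Nat.even_or_odd (k * m) with h | h <;> simp [h]

/-- universal property -/
theorem exists_lift {B : Type} [Ring B] [Algebra F B] (w : X → B) (h1 : ∀ x, w x * w x = 0)
    (h2 : ∀ x y, w x * w y = -(w y * w x)) : ∃ Φ : EA F X →ₐ[F] B, ∀ x, Φ (g F x) = w x := by
  let L : (X →₀ F) →ₗ[F] B := Finsupp.linearCombination F w
  have hL : ∀ m, L m * L m = 0 := by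
    intro m
    have hanti : ∀ (m : X →₀ F) (y : X), L m * w y = -(w y * L m) := by
      intro m y
      induction m using Finsupp.induction_linear with
      | zero => simp
      | add f g hf hg => rw [map_add, add_mul, hf, hg, mul_add, neg_add]
      | single x c => simp [L, h2 x y]
    induction m using Finsupp.induction with
    | zero => simp
    | single_add x c f _ _ ih =>
      have hx : L (Finsupp.single x c) = c • w x := by simp [L]
      rw [map_add, add_mul, mul_add, mul_add, ih, hx]
      simp [h1, hanti]
  exact ⟨ExteriorAlgebra.lift F ⟨L, hL⟩, fun x => by unfold g; rw [lift_ι_apply]; simp [L]⟩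

end EA
end Crs

set_option linter.all false
namespace Crs

section Kuhn
variable {D : Type} [DecidableEq D] {R : Type} [Ring R] {W : Type}

def face {α : Type} (s : D) (b : Bool) (E : (D → Bool) → α) : (D → Bool) → α :=
  fun t => E (Function.update t s b)

def base : D → Bool := fun _ => false

def dl (θ : D → R) (f : Finset D → ((D → Bool) → W) → R) (S : Finset D) (E : (D → Bool) → W) : R :=
  ∑ s ∈ S, θ s * (f (S.erase s) (face s true E) - f (S.erase s) (face s false E))

theorem face_comm {α : Type} {s r : D} (h : s ≠ r) (b b' : Bool) (E : (D → Bool) → α) :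
    face s b (face r b' E) = face r b' (face s b E) := by
  funext t; unfold face; rw [Function.update_comm h]

theorem face_false_base {α : Type} (s : D) (E : (D → Bool) → α) :
    face s false E base = E base := by
  unfold face base; congr 1; exact Function.update_eq_self s _

theorem dl_congr {θ : D → R} {f f' : Finset D → ((D → Bool) → W) → R} {S : Finset D}
    {E : (D → Bool) → W}
    (h : ∀ s ∈ S, ∀ b, f (S.erase s) (face s b E) = f' (S.erase s) (face s b E)) :
    dl θ f S E = dl θ f' S E := by
  unfold dl
  refine Finset.sum_congr rfl fun s hs => ?_
  rw [h s hs, h s hs]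

theorem dl_dl {θ : D → R} (hθ : ∀ s r, θ s * θ r = -(θ r * θ s))
    (f : Finset D → ((D → Bool) → W) → R) (S : Finset D) (E : (D → Bool) → W) :
    dl θ (dl θ f) S E = 0 := by
  unfold dl
  simp only [← Finset.sum_sub_distrib, Finset.mul_sum]
  rw [Finset.sum_sigma' S (fun s => S.erase s)]
  refine Finset.sum_involution (fun x _ => ⟨x.2, x.1⟩) ?_ ?_ ?_ ?_
  · rintro ⟨s, r⟩ h
    simp only [Finset.mem_sigma, Finset.mem_erase] at h
    have hne : s ≠ r := fun h' => h.2.1 h'.symm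
    simp only
    rw [Finset.erase_right_comm (a := r) (b := s), face_comm hne, face_comm hne, face_comm hne, face_comm hne]
    simp only [← mul_sub, ← mul_assoc]
    rw [hθ r s, neg_mul, ← sub_eq_add_neg, ← mul_sub]
    convert mul_zero _
    abel
  · rintro ⟨s, r⟩ h _ h'
    simp only [Finset.mem_sigma, Finset.mem_erase] at h
    simp only [Sigma.mk.injEq] at h'
    exact h.2.1 h'.1
  · rintro ⟨s, r⟩ h
    simp only [Finset.mem_sigma, Finset.mem_erase] at h ⊢
    exact ⟨h.2.2, fun h' => h.2.1 h'.symm, h.1⟩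
  · rintro ⟨s, r⟩ h
    rfl

def Ku (θ : D → R) : ℕ → Finset D → ((D → Bool) → R) → R
  | 0, _, E => E base
  | n + 1, S, E => E base * dl θ (Ku θ n) S E

def fst' {α β : Type} (E : (D → Bool) → α × β) : (D → Bool) → α := fun t => (E t).1
def snd' {α β : Type} (E : (D → Bool) → α × β) : (D → Bool) → β := fun t => (E t).2

def Hm (θ : D → R) : ℕ → Finset D → ((D → Bool) → R × R) → R
  | 0, S, E => (E base).1 * (Ku θ 0 S (snd' E) - Ku θ 0 S (fst' E))
  | n + 1, S, E => (E base).1 * (Ku θ (n + 1) S (snd' E) - Ku θ (n + 1) S (fst' E) + dl θ (Hm θ n) S E)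

section contr
variable (C : R →+ R) {θ : D → R}

theorem C_dl (hC : ∀ s x, C (θ s * x) = -(θ s * C x))
    (f : Finset D → ((D → Bool) → W) → R) (S : Finset D) (E : (D → Bool) → W) :
    C (dl θ f S E) = - dl θ (fun S E => C (f S E)) S E := by
  unfold dl
  rw [map_sum, ← Finset.sum_neg_distrib]
  refine Finset.sum_congr rfl fun s _ => ?_
  rw [hC, map_sub]

def CG (C : R →+ R) (e : R) : Prop := C e = 1 ∧ ∀ x, C (e * x) = x - e * C x

theorem C_Ku (hC : ∀ s x, C (θ s * x) = -(θ s * C x)) (hθ : ∀ s r, θ s * θ r = -(θ r * θ s))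
    (n : ℕ) (S : Finset D) (E : (D → Bool) → R) (hE : ∀ v, CG C (E v)) :
    C (Ku θ (n + 1) S E) = dl θ (Ku θ n) S E := by
  induction n generalizing S E with
  | zero =>
    rw [Ku, (hE _).2, C_dl C hC]
    have : dl θ (fun S E => C (Ku θ 0 S E)) S E = 0 := by
      unfold dl
      refine Finset.sum_eq_zero fun s _ => ?_
      simp only [Ku, face]; rw [(hE _).1, (hE _).1]; simp
    rw [this]; simp
  | succ n ih =>
    rw [Ku, (hE _).2, C_dl C hC]
    have : dl θ (fun S E => C (Ku θ (n + 1) S E)) S E = 0 := by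
      rw [dl_congr (f' := dl θ (Ku θ n))]
      · exact dl_dl hθ _ _ _
      · intro s _ b
        exact ih _ _ (fun v => hE _)
    rw [this]; simp

theorem dl_add (f f' : Finset D → ((D → Bool) → W) → R) (S : Finset D) (E : (D → Bool) → W) :
    dl θ (fun S E => f S E + f' S E) S E = dl θ f S E + dl θ f' S E := by
  unfold dl
  rw [← Finset.sum_add_distrib]
  refine Finset.sum_congr rfl fun s _ => ?_
  simp only [mul_add, mul_sub]; abel

theorem dl_sub (f f' : Finset D → ((D → Bool) → W) → R) (S : Finset D) (E : (D → Bool) → W) :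
    dl θ (fun S E => f S E - f' S E) S E = dl θ f S E - dl θ f' S E := by
  unfold dl
  rw [← Finset.sum_sub_distrib]
  refine Finset.sum_congr rfl fun s _ => ?_
  simp only [mul_sub]; abel

theorem C_Hm_zero (S : Finset D) (E : (D → Bool) → R × R)
    (hE : ∀ v, CG C (E v).1) (hE' : ∀ v, CG C (E v).2) :
    C (Hm θ 0 S E) = Ku θ 0 S (snd' E) - Ku θ 0 S (fst' E) := by
  rw [Hm, (hE _).2, map_sub]
  simp only [Ku, snd', fst']
  rw [(hE _).1, (hE' _).1]; simp

theorem C_Hm (hC : ∀ s x, C (θ s * x) = -(θ s * C x)) (hθ : ∀ s r, θ s * θ r = -(θ r * θ s))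
    (n : ℕ) (S : Finset D) (E : (D → Bool) → R × R)
    (hE : ∀ v, CG C (E v).1) (hE' : ∀ v, CG C (E v).2) :
    C (Hm θ (n + 1) S E) =
      Ku θ (n + 1) S (snd' E) - Ku θ (n + 1) S (fst' E) + dl θ (Hm θ n) S E := by
  induction n generalizing S E with
  | zero =>
    rw [Hm, (hE _).2, map_add, map_sub, C_Ku C hC hθ _ _ (snd' E) (fun v => hE' v),
      C_Ku C hC hθ _ _ (fst' E) (fun v => hE v), C_dl C hC]
    have : dl θ (fun S E => C (Hm θ 0 S E)) S E =
        dl θ (fun S E => Ku θ 0 S (snd' E) - Ku θ 0 S (fst' E)) S E :=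
      dl_congr fun s _ b => C_Hm_zero C _ _ (fun v => hE _) (fun v => hE' _)
    rw [this, dl_sub]
    have e1 : dl θ (fun S E => Ku θ 0 S (snd' E)) S E = dl θ (Ku θ 0) S (snd' E) := rfl
    have e2 : dl θ (fun S E => Ku θ 0 S (fst' E)) S E = dl θ (Ku θ 0) S (fst' E) := rfl
    rw [e1, e2]; simp
  | succ n ih =>
    rw [Hm, (hE _).2, map_add, map_sub, C_Ku C hC hθ _ _ (snd' E) (fun v => hE' v),
      C_Ku C hC hθ _ _ (fst' E) (fun v => hE v), C_dl C hC]
    have : dl θ (fun S E => C (Hm θ (n + 1) S E)) S E =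
        dl θ (fun S E => (Ku θ (n + 1) S (snd' E) - Ku θ (n + 1) S (fst' E)) + dl θ (Hm θ n) S E) S E :=
      dl_congr fun s _ b => ih _ _ (fun v => hE _) (fun v => hE' _)
    rw [this, dl_add, dl_sub, dl_dl hθ]
    have e1 : dl θ (fun S E => Ku θ (n + 1) S (snd' E)) S E = dl θ (Ku θ (n + 1)) S (snd' E) := rfl
    have e2 : dl θ (fun S E => Ku θ (n + 1) S (fst' E)) S E = dl θ (Ku θ (n + 1)) S (fst' E) := rfl
    rw [e1, e2]; simp

end contr

/-- path form -/
def Kp (θ : D → R) (E : (D → Bool) → R) : ℕ → Finset D → (D → Bool) → R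
  | 0, _, v => E v
  | n + 1, S, v => E v * ∑ s ∈ S, θ s * Kp θ E n (S.erase s) (Function.update v s true)

theorem Ku_eq_Kp' {θ : D → R} {E : (D → Bool) → R} (h1 : ∀ v, E v * E v = 0)
    (h2 : ∀ v s, E v * θ s = -(θ s * E v)) (n : ℕ) (S : Finset D) (v : D → Bool) :
    Ku θ n S (fun t => E (fun x => t x || v x)) = Kp θ E n S v := by
  induction n generalizing S v with
  | zero => simp [Ku, Kp, base]
  | succ n ih =>
    rw [Ku, Kp]
    have hb : E (fun x => base x || v x) = E v := by simp [base]
    rw [hb]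
    unfold dl
    rw [Finset.mul_sum, Finset.mul_sum]
    refine Finset.sum_congr rfl fun s hs => ?_
    have e1 : face s true (fun t : D → Bool => E (fun x => t x || v x)) =
        fun t => E (fun x => t x || (Function.update v s true) x) := by
      funext t; unfold face; beta_reduce; congr 1; funext x
      by_cases hx : x = s
      · subst hx; simp
      · simp [hx]
    rw [e1, ih, mul_sub, mul_sub, sub_eq_self, ← mul_assoc, h2, neg_mul, mul_assoc]
    have e2 : face s false (fun t : D → Bool => E (fun x => t x || v x)) base = E v := by
      rw [face_false_base]; exact hb
    have : E v * Ku θ n (S.erase s) (face s false fun t => E fun x => t x || v x) = 0 := by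
      cases n with
      | zero => rw [Ku, e2, h1]
      | succ n => rw [Ku, e2, ← mul_assoc, h1, zero_mul]
    rw [this]; simp

theorem Ku_eq_Kp {θ : D → R} {E : (D → Bool) → R} (h1 : ∀ v, E v * E v = 0)
    (h2 : ∀ v s, E v * θ s = -(θ s * E v)) (n : ℕ) (S : Finset D) :
    Ku θ n S E = Kp θ E n S base := by
  rw [← Ku_eq_Kp' h1 h2]; simp [base]

/-- naturality -/
theorem map_dl {R' : Type} [Ring R'] (φ : R →+* R') {W' : Type} (θ : D → R) (u : W → W')
    (f : Finset D → ((D → Bool) → W) → R) (f' : Finset D → ((D → Bool) → W') → R')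
    (h : ∀ S E, φ (f S E) = f' S (fun t => u (E t))) (S : Finset D) (E : (D → Bool) → W) :
    φ (dl θ f S E) = dl (fun s => φ (θ s)) f' S (fun t => u (E t)) := by
  unfold dl
  rw [map_sum]
  refine Finset.sum_congr rfl fun s _ => ?_
  rw [map_mul, map_sub, h, h]; rfl

theorem map_Ku {R' : Type} [Ring R'] (φ : R →+* R') (θ : D → R) (n : ℕ) (S : Finset D)
    (E : (D → Bool) → R) :
    φ (Ku θ n S E) = Ku (fun s => φ (θ s)) n S (fun t => φ (E t)) := by
  induction n generalizing S E with
  | zero => rfl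
  | succ n ih =>
    rw [Ku, Ku, map_mul, map_dl φ θ φ _ _ ih]

theorem map_Hm {R' : Type} [Ring R'] (φ : R →+* R') (θ : D → R) (n : ℕ) (S : Finset D)
    (E : (D → Bool) → R × R) :
    φ (Hm θ n S E) = Hm (fun s => φ (θ s)) n S (fun t => (φ (E t).1, φ (E t).2)) := by
  induction n generalizing S E with
  | zero => rw [Hm, Hm, map_mul, map_sub, map_Ku, map_Ku]; rfl
  | succ n ih =>
    rw [Hm, Hm, map_mul, map_add, map_sub, map_Ku, map_Ku,
      map_dl φ θ (fun z : R × R => (φ z.1, φ z.2)) _ _ ih]; rfl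

theorem re_dl {D' : Type} [DecidableEq D'] (i : D' ↪ D) (θ : D → R)
    (f : Finset D → ((D → Bool) → W) → R) (f' : Finset D' → ((D' → Bool) → W) → R)
    (h : ∀ S E, f (S.map i) (fun t => E (t ∘ i)) = f' S E) (S : Finset D') (E : (D' → Bool) → W) :
    dl θ f (S.map i) (fun t => E (t ∘ i)) = dl (fun s => θ (i s)) f' S E := by
  unfold dl
  rw [Finset.sum_map]
  refine Finset.sum_congr rfl fun s _ => ?_
  have hf : ∀ b, face (i s) b (fun t => E (t ∘ i)) = fun t => face s b E (t ∘ i) := by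
    intro b; funext t; unfold face
    beta_reduce
    rw [Function.update_comp_eq_of_injective _ i.injective]
  rw [← Finset.map_erase, hf, hf, h, h]

theorem re_Ku {D' : Type} [DecidableEq D'] (i : D' ↪ D) (θ : D → R) (n : ℕ) (S : Finset D')
    (E : (D' → Bool) → R) :
    Ku θ n (S.map i) (fun t => E (t ∘ i)) = Ku (fun s => θ (i s)) n S E := by
  induction n generalizing S E with
  | zero => rfl
  | succ n ih => rw [Ku, Ku, re_dl i θ _ _ ih]; rfl

theorem re_Hm {D' : Type} [DecidableEq D'] (i : D' ↪ D) (θ : D → R) (n : ℕ) (S : Finset D')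
    (E : (D' → Bool) → R × R) :
    Hm θ n (S.map i) (fun t => E (t ∘ i)) = Hm (fun s => θ (i s)) n S E := by
  induction n generalizing S E with
  | zero => rw [Hm, Hm, ← re_Ku i, ← re_Ku i]; rfl
  | succ n ih => rw [Hm, Hm, re_dl i θ _ _ ih, ← re_Ku i, ← re_Ku i]; rfl

end Kuhn

section mem
variable {D : Type} [DecidableEq D] {F : Type} [Field F] {X : Type}

theorem dl_mem {θ : D → EA F X} {T : Set X} (hθ : ∀ s, θ s ∈ Gr F T 1) {W : Type} {k : ℕ}
    (f : Finset D → ((D → Bool) → W) → EA F X) (P : W → Prop)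
    (h : ∀ S E, (∀ t, P (E t)) → f S E ∈ Gr F T k) (S : Finset D) (E : (D → Bool) → W)
    (hE : ∀ t, P (E t)) : dl θ f S E ∈ Gr F T (k + 1) := by
  unfold dl
  refine Submodule.sum_mem _ fun s _ => ?_
  rw [add_comm]
  exact mul_mem_Gr (hθ s) (Submodule.sub_mem _ (h _ _ fun t => hE _) (h _ _ fun t => hE _))

theorem Ku_mem {θ : D → EA F X} {T : Set X} (hθ : ∀ s, θ s ∈ Gr F T 1) (n : ℕ) (S : Finset D)
    (E : (D → Bool) → EA F X) (hE : ∀ v, E v ∈ Gr F T 1) : Ku θ n S E ∈ Gr F T (2 * n + 1) := by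
  induction n generalizing S E with
  | zero => exact hE _
  | succ n ih =>
    rw [Ku]
    have := mul_mem_Gr (hE base) (dl_mem hθ (Ku θ n) (fun x => x ∈ Gr F T 1) ih S E hE)
    have e : 2 * (n + 1) + 1 = 1 + (2 * n + 1 + 1) := by ring
    rw [e]; exact this

theorem Hm_mem {θ : D → EA F X} {T : Set X} (hθ : ∀ s, θ s ∈ Gr F T 1) (n : ℕ) (S : Finset D)
    (E : (D → Bool) → EA F X × EA F X) (hE : ∀ v, (E v).1 ∈ Gr F T 1 ∧ (E v).2 ∈ Gr F T 1) :
    Hm θ n S E ∈ Gr F T (2 * n + 2) := by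
  induction n generalizing S E with
  | zero =>
    rw [Hm]
    exact mul_mem_Gr (k := 1) (m := 1) (hE _).1
      (Submodule.sub_mem _ (Ku_mem hθ 0 S (snd' E) fun v => (hE v).2)
      (Ku_mem hθ 0 S (fst' E) fun v => (hE v).1))
  | succ n ih =>
    rw [Hm]
    have h1 := Submodule.sub_mem (Gr F T (2 * n + 2 + 1)) (Ku_mem hθ (n + 1) S (snd' E) fun v => (hE v).2)
      (Ku_mem hθ (n + 1) S (fst' E) fun v => (hE v).1)
    have h2 := dl_mem hθ (Hm θ n) (fun x => x.1 ∈ Gr F T 1 ∧ x.2 ∈ Gr F T 1) ih S E hE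
    have := mul_mem_Gr (hE base).1 (Submodule.add_mem _ h1 h2)
    have e : 2 * (n + 1) + 2 = 1 + (2 * n + 2 + 1) := by ring
    rw [e]; exact this

end mem
end Crs

set_option linter.all false
namespace Crs
open Finset

structure Chain (F D V : Type) where
  N : Type
  fin : Fintype N
  y : N → (D → Bool) → V
  c : N → F

attribute [instance] Chain.fin

section hom
variable {F : Type} [Field F] {D V Λ : Type} [Fintype D] [DecidableEq D]

def Good (𝒢 : Set (V → V)) (𝔉 : Set (Set V)) (X : Chain F D V) : Prop :=
  ∀ ψ : D → ((D → Bool) → V) → F,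
  (∀ f ∈ 𝒢, ∀ s y, ψ s (fun t => f (y t)) = ψ s y) →
  (∀ (π : Equiv.Perm D) s y, ψ (π s) (fun t => y (t ∘ π)) = ((Equiv.Perm.sign π : ℤˣ) : ℤ) • ψ s y) →
  (∀ B ∈ 𝔉, ∀ s y, (∀ t, y t ∈ B) → ψ s y = 0) →
  ∑ n, X.c n * ∑ s, (ψ s (face s true (X.y n)) - ψ s (face s false (X.y n))) = 0

variable (F) in
noncomputable def kc (ℓ : (D → Bool) → Λ) : EA F (D ⊕ Λ) :=
  Ku (fun s => g F (Sum.inl s)) (Fintype.card D) univ (fun t => g F (Sum.inr (ℓ t)))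

noncomputable def ev (X : Chain F D V) (ℓ : V → Λ) : EA F (D ⊕ Λ) :=
  ∑ n, X.c n • kc F (fun t => ℓ (X.y n t))

variable (F) in
noncomputable def pr (ℓ ℓ' : V → Λ) (y : (D → Bool) → V) : (D → Bool) → EA F (D ⊕ Λ) × EA F (D ⊕ Λ) :=
  fun t => (g F (Sum.inr (ℓ (y t))), g F (Sum.inr (ℓ' (y t))))

variable (F) in
noncomputable def hh (n : ℕ) (ℓ ℓ' : V → Λ) (s : D) (y : (D → Bool) → V) : EA F (D ⊕ Λ) :=
  g F (Sum.inl s) * Hm (fun s => g F (Sum.inl s)) n (univ.erase s) (pr F ℓ ℓ' y)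

theorem hh_mem (n : ℕ) (ℓ ℓ' : V → Λ) (s : D) (y : (D → Bool) → V) (T : Set (D ⊕ Λ))
    (h1 : ∀ s, Sum.inl s ∈ T) (h2 : ∀ t, Sum.inr (ℓ (y t)) ∈ T) (h3 : ∀ t, Sum.inr (ℓ' (y t)) ∈ T) :
    hh F n ℓ ℓ' s y ∈ Gr F T (2 * n + 3) := by
  unfold hh
  exact g_mul_mem_Gr (h1 s) (Hm_mem (fun s => g_mem_Gr (h1 s)) n _ _
    (fun v => ⟨g_mem_Gr (h2 v), g_mem_Gr (h3 v)⟩))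

theorem CG_inr (x : Λ) : CG (cont (F := F) (Sum.elim (fun _ : D => 0) (fun _ : Λ => 1))).toAddMonoidHom
    (g F (Sum.inr x)) := by
  constructor
  · simp [cont_g]
  · intro a; simp [cont_g_mul]

theorem kc_mem (ℓ : (D → Bool) → Λ) (T : Set (D ⊕ Λ))
    (h1 : ∀ s, Sum.inl s ∈ T) (h2 : ∀ t, Sum.inr (ℓ t) ∈ T) :
    kc F ℓ ∈ Gr F T (2 * Fintype.card D + 1) := by
  unfold kc
  exact Ku_mem (fun s => g_mem_Gr (h1 s)) _ _ _ (fun v => g_mem_Gr (h2 v))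

theorem kc_homotopy [Fintype Λ] (hc : Fintype.card Λ = Fintype.card D + 1) {n : ℕ}
    (hn : Fintype.card D = n + 1) (ℓ ℓ' : V → Λ) (y : (D → Bool) → V) :
    kc F (fun t => ℓ (y t)) - kc F (fun t => ℓ' (y t)) =
      ∑ s, (hh F n ℓ ℓ' s (face s true y) - hh F n ℓ ℓ' s (face s false y)) := by
  classical
  have h0 : Hm (fun s => g F (Sum.inl s)) (n + 1) univ (pr F ℓ ℓ' y) = 0 := by
    have := Hm_mem (F := F) (X := D ⊕ Λ) (T := Set.univ) (D := D) (θ := fun s => g F (Sum.inl s))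
      (fun s => g_mem_Gr trivial) (n + 1) univ (pr F ℓ ℓ' y)
      (fun v => ⟨g_mem_Gr trivial, g_mem_Gr trivial⟩)
    refine eq_zero_of_mem_Gr (Set.toFinite _) ?_ this
    rw [Set.ncard_univ, Nat.card_eq_fintype_card, Fintype.card_sum]; omega
  have h1 := C_Hm (D := D) (cont (F := F) (Sum.elim (fun _ : D => 0) (fun _ : Λ => 1))).toAddMonoidHom
    (θ := fun s => g F (Sum.inl s)) (fun s x => by simp [cont_g_mul]) (fun s r => g_anti _ _) n univ
    (pr F ℓ ℓ' y) (fun v => CG_inr _) (fun v => CG_inr _)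
  rw [h0, map_zero] at h1
  have h2 : dl (fun s => g F (Sum.inl s)) (Hm (fun s => g F (Sum.inl s)) n) univ (pr F ℓ ℓ' y) =
     ∑ s, (hh F n ℓ ℓ' s (face s true y) - hh F n ℓ ℓ' s (face s false y)) := by
    unfold dl
    refine Finset.sum_congr rfl fun s _ => ?_
    rw [mul_sub]; rfl
  rw [h2] at h1
  unfold kc
  rw [hn]
  have h3 := eq_neg_of_add_eq_zero_right h1.symm
  rw [h3, neg_sub]
  rfl

theorem kc_eq_of_card_zero [Fintype Λ] (hc : Fintype.card Λ = Fintype.card D + 1)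
    (hn : Fintype.card D = 0) (ℓ ℓ' : (D → Bool) → Λ) : kc F ℓ = kc F ℓ' := by
  have : ℓ = ℓ' := by
    have : Subsingleton Λ := Fintype.card_le_one_iff_subsingleton.1 (by omega)
    exact Subsingleton.elim _ _
  rw [this]

theorem ev_eq_of_good [Fintype Λ] (hc : Fintype.card Λ = Fintype.card D + 1)
    {𝒢 : Set (V → V)} {𝔉 : Set (Set V)} {X : Chain F D V} (hX : Good 𝒢 𝔉 X) (ℓ ℓ' : V → Λ)
    [DecidableEq Λ]
    (h𝒢 : ∀ f ∈ 𝒢, ∃ σ : Equiv.Perm Λ, Equiv.Perm.sign σ = 1 ∧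
      ∀ v, ℓ (f v) = σ (ℓ v) ∧ ℓ' (f v) = σ (ℓ' v))
    (h𝔉 : ∀ B ∈ 𝔉, ∃ μ, ∀ v ∈ B, ℓ v ≠ μ ∧ ℓ' v ≠ μ) : ev X ℓ = ev X ℓ' := by
  rcases hD : Fintype.card D with _ | n
  · unfold ev
    refine Finset.sum_congr rfl fun i _ => ?_
    rw [kc_eq_of_card_zero hc hD]
  rw [← sub_eq_zero, ← Module.forall_dual_apply_eq_zero_iff F]
  intro φ
  have key := hX (fun s y => φ (hh F n ℓ ℓ' s y)) ?_ ?_ ?_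
  · rw [← key]
    unfold ev
    rw [← Finset.sum_sub_distrib, map_sum]
    refine Finset.sum_congr rfl fun i _ => ?_
    rw [← smul_sub, map_smul, smul_eq_mul, kc_homotopy hc hD, map_sum]
    simp only [map_sub]
  · intro f hf s y
    obtain ⟨σ, hσ, hl⟩ := h𝒢 f hf
    have e : hh F n ℓ ℓ' s (fun t => f (y t)) = mapE (Equiv.sumCongr 1 σ) (hh F n ℓ ℓ' s y) := by
      unfold hh
      rw [map_mul]
      erw [map_Hm (mapE (F := F) (Equiv.sumCongr (1 : Equiv.Perm D) σ)).toRingHom]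
      have e5 : (pr F ℓ ℓ' fun t => f (y t)) = fun t => (g F (X := D ⊕ Λ) (Sum.inr (σ (ℓ (y t)))), g F (X := D ⊕ Λ) (Sum.inr (σ (ℓ' (y t))))) := by
        funext t; simp [pr, hl]
      rw [e5]
      simp [pr]
    have hm : hh F n ℓ ℓ' s y ∈ Gr F Set.univ (2 * n + 3) :=
      hh_mem n ℓ ℓ' s y _ (fun _ => trivial) (fun _ => trivial) (fun _ => trivial)
    beta_reduce
    rw [e, mapE_perm _ (by rw [Fintype.card_sum]; omega) hm]
    erw [Equiv.Perm.sign_sumCongr]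
    simp [hσ]
  · intro π s y
    have e : hh F n ℓ ℓ' (π s) (fun t => y (t ∘ π)) =
        mapE (Equiv.sumCongr π 1) (hh F n ℓ ℓ' s y) := by
      unfold hh
      rw [map_mul]
      erw [map_Hm (mapE (F := F) (Equiv.sumCongr π (1 : Equiv.Perm Λ))).toRingHom]
      have h3 := re_Hm (D := D) π.toEmbedding (fun s => g F (X := D ⊕ Λ) (Sum.inl s)) n (univ.erase s) (pr F ℓ ℓ' y)
      rw [Finset.map_erase, Finset.map_univ_equiv] at h3
      have h4 : (fun t => pr F ℓ ℓ' y (t ∘ ⇑π.toEmbedding)) = pr F ℓ ℓ' (fun t => y (t ∘ π)) := rfl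
      rw [h4] at h3
      erw [h3]
      simp [pr]
      rfl
    have hm : hh F n ℓ ℓ' s y ∈ Gr F Set.univ (2 * n + 3) :=
      hh_mem n ℓ ℓ' s y _ (fun _ => trivial) (fun _ => trivial) (fun _ => trivial)
    beta_reduce
    rw [e, mapE_perm _ (by rw [Fintype.card_sum]; omega) hm]
    erw [Equiv.Perm.sign_sumCongr]
    rw [Equiv.Perm.sign_one, mul_one, map_zsmul]
  · intro B hB s y hy
    obtain ⟨μ, hμ⟩ := h𝔉 B hB
    have hm : hh F n ℓ ℓ' s y ∈ Gr F ({Sum.inr μ}ᶜ) (2 * n + 3) :=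
      hh_mem n ℓ ℓ' s y _ (by simp) (fun t => by simpa using (hμ _ (hy t)).1)
        (fun t => by simpa using (hμ _ (hy t)).2)
    have : hh F n ℓ ℓ' s y = 0 := by
      refine eq_zero_of_mem_Gr (Set.toFinite _) ?_ hm
      have h1 := Set.ncard_add_ncard_compl ({Sum.inr μ} : Set (D ⊕ Λ))
      rw [Nat.card_eq_fintype_card, Fintype.card_sum, Set.ncard_singleton] at h1
      omega
    beta_reduce
    rw [this, map_zero]

/-- nonvanishing implies a rainbow cube -/
theorem exists_rainbow [Fintype Λ] (hc : Fintype.card Λ = Fintype.card D + 1)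
    (X : Chain F D V) (ℓ : V → Λ) (h : ev X ℓ ≠ 0) : ∃ n : X.N, ∀ μ, ∃ t, ℓ (X.y n t) = μ := by
  by_contra hcon
  push Not at hcon
  apply h
  unfold ev
  refine Finset.sum_eq_zero fun n _ => ?_
  obtain ⟨μ, hμ⟩ := hcon n
  have hm : kc F (fun t => ℓ (X.y n t)) ∈ Gr F ({Sum.inr μ}ᶜ) (2 * Fintype.card D + 1) :=
    kc_mem _ _ (by simp) (fun t => by simpa using hμ t)
  rw [eq_zero_of_mem_Gr (Set.toFinite _) ?_ hm, smul_zero]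
  have h1 := Set.ncard_add_ncard_compl ({Sum.inr μ} : Set (D ⊕ Λ))
  rw [Nat.card_eq_fintype_card, Fintype.card_sum, Set.ncard_singleton] at h1
  omega

end hom
end Crs

set_option linter.all false
namespace Crs
open Finset

section KcSec
variable {D : Type} [DecidableEq D] {R : Type} [Ring R]

def Kc (θ : D → R) (E : (D → Bool) → R) (S : Finset D) (v : D → Bool) : R := Kp θ E S.card S v

theorem Kc_empty (θ : D → R) (E : (D → Bool) → R) (v : D → Bool) : Kc θ E ∅ v = E v := rfl

theorem Kc_eq (θ : D → R) (E : (D → Bool) → R) {S : Finset D} (hS : S ≠ ∅) (v : D → Bool) :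
    Kc θ E S v = E v * ∑ s ∈ S, θ s * Kc θ E (S.erase s) (Function.update v s true) := by
  unfold Kc
  obtain ⟨n, hn⟩ : ∃ n, S.card = n + 1 :=
    Nat.exists_eq_succ_of_ne_zero (by rwa [ne_eq, Finset.card_eq_zero])
  rw [hn, Kp]
  congr 1
  refine Finset.sum_congr rfl fun s hs => ?_
  rw [Finset.card_erase_of_mem hs, hn, Nat.add_sub_cancel]

theorem Kc_eq_mul (θ : D → R) (E : (D → Bool) → R) (S : Finset D) (v : D → Bool) :
    ∃ r, Kc θ E S v = E v * r := by
  by_cases hS : S = ∅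
  · exact ⟨1, by rw [hS, Kc_empty, mul_one]⟩
  · exact ⟨_, Kc_eq θ E hS v⟩

end KcSec

section comp
variable {I Da Db Λb : Type} [Fintype I] [DecidableEq I] [Fintype Da] [DecidableEq Da] [Fintype Db]
  [DecidableEq Db] {R : Type} [Ring R]

/-- coordinates of the composed cube -/
abbrev DD (I Da Db : Type) := (I × Db) ⊕ Da

def va (v : DD I Da Db → Bool) : Da → Bool := fun s => v (Sum.inr s)
def vb (v : DD I Da Db → Bool) (i : I) : Db → Bool := fun s => v (Sum.inl (i, s))

def lab (β : I → (Db → Bool) → Λb) (α : (Da → Bool) → I) (v : DD I Da Db → Bool) : I × Λb :=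
  (α (va v), β (α (va v)) (vb v (α (va v))))

theorem va_inl (v : DD I Da Db → Bool) (x : I × Db) (b : Bool) :
    va (Function.update v (Sum.inl x) b) = va v := by
  funext s; simp [va]
theorem va_inr (v : DD I Da Db → Bool) (x : Da) (b : Bool) :
    va (Function.update v (Sum.inr x) b) = Function.update (va v) x b := by
  funext s
  by_cases h : s = x
  · subst h; simp [va]
  · simp [va, h]
theorem vb_inr (v : DD I Da Db → Bool) (x : Da) (b : Bool) (i : I) :
    vb (Function.update v (Sum.inr x) b) i = vb v i := by
  funext s; simp [vb]
theorem vb_inl_ne (v : DD I Da Db → Bool) (x : I × Db) (b : Bool) (i : I) (h : x.1 ≠ i) :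
    vb (Function.update v (Sum.inl x) b) i = vb v i := by
  funext s
  have : (i, s) ≠ x := by rintro rfl; exact h rfl
  simp [vb, this]
theorem vb_inl (v : DD I Da Db → Bool) (x : Db) (b : Bool) (i : I) :
    vb (Function.update v (Sum.inl (i, x)) b) i = Function.update (vb v i) x b := by
  funext s
  by_cases h : s = x
  · subst h; simp [vb]
  · simp [vb, h]

variable (θ : DD I Da Db → R) (e : I × Λb → R) (β : I → (Db → Bool) → Λb) (α : (Da → Bool) → I)

def Kq (L : Finset (I × Db)) (S : Finset Da) (v : DD I Da Db → Bool) : R :=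
  Kc θ (fun v => e (lab β α v)) (L.disjSum S) v

theorem Kq_empty (v : DD I Da Db → Bool) : Kq θ e β α ∅ ∅ v = e (lab β α v) := rfl

theorem Kq_eq (L : Finset (I × Db)) (S : Finset Da) (h : ¬ (L = ∅ ∧ S = ∅)) (v : DD I Da Db → Bool) :
    Kq θ e β α L S v = e (lab β α v) *
      (∑ x ∈ L, θ (Sum.inl x) * Kq θ e β α (L.erase x) S (Function.update v (Sum.inl x) true) +
       ∑ s ∈ S, θ (Sum.inr s) * Kq θ e β α L (S.erase s) (Function.update v (Sum.inr s) true)) := by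
  unfold Kq
  rw [Kc_eq]
  · rw [Finset.sum_disjSum]
    congr 2
    · refine Finset.sum_congr rfl fun x _ => ?_
      congr 2; ext y; rcases y with y | y <;> simp
    · refine Finset.sum_congr rfl fun x _ => ?_
      congr 2; ext y; rcases y with y | y <;> simp
  · intro h'
    apply h
    rw [← Finset.card_eq_zero, Finset.card_disjSum] at h'
    constructor <;> rw [← Finset.card_eq_zero] <;> omega

theorem Kq_eq_mul (L : Finset (I × Db)) (S : Finset Da) (v : DD I Da Db → Bool) :
    ∃ r, Kq θ e β α L S v = e (lab β α v) * r := Kc_eq_mul _ _ _ _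

variable {θ e β α} (he : ∀ x, e x * e x = 0) (hee : ∀ x y, e x * e y = -(e y * e x))
  (heθ : ∀ x s, e x * θ s = -(θ s * e x))
include he hee heθ

theorem e_mul_Kq (L : Finset (I × Db)) (S : Finset Da) (v : DD I Da Db → Bool) :
    e (lab β α v) * Kq θ e β α L S v = 0 := by
  obtain ⟨r, hr⟩ := Kq_eq_mul θ e β α L S v
  rw [hr, ← mul_assoc, he, zero_mul]

theorem inl_term (L : Finset (I × Db)) (S : Finset Da) (v : DD I Da Db → Bool) (x : I × Db)
    (hx : x.1 ≠ α (va v)) :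
    e (lab β α v) * (θ (Sum.inl x) * Kq θ e β α L S (Function.update v (Sum.inl x) true)) = 0 := by
  have hl : lab β α (Function.update v (Sum.inl x) true) = lab β α v := by
    unfold lab; rw [va_inl, vb_inl_ne _ _ _ _ hx]
  rw [← mul_assoc, heθ, neg_mul, mul_assoc, ← hl, e_mul_Kq he hee heθ]; simp

theorem C1 (n : ℕ) (L : Finset (I × Db)) (S : Finset Da) (hn : L.card + S.card = n)
    (v : DD I Da Db → Bool) (i : I)
    (h : ∃ s, (i, s) ∈ L) : e (i, β i (vb v i)) * Kq θ e β α L S v = 0 := by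
  induction n generalizing L S v with
  | zero =>
    obtain ⟨s, hs⟩ := h
    have : L = ∅ := by rw [← Finset.card_eq_zero]; omega
    rw [this] at hs; simp at hs
  | succ n ih =>
    obtain ⟨s0, hs0⟩ := h
    by_cases hi : α (va v) = i
    · have : (i, β i (vb v i)) = lab β α v := by unfold lab; rw [hi]
      rw [this, e_mul_Kq he hee heθ]
    rw [Kq_eq]
    swap
    · rintro ⟨rfl, -⟩; simp at hs0
    have move : ∀ (s : DD I Da Db) (K : R), e (i, β i (vb v i)) * K = 0 →
        e (i, β i (vb v i)) * (e (lab β α v) * (θ s * K)) = 0 := by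
      intro s K hK
      rw [← mul_assoc, hee, neg_mul, mul_assoc, ← mul_assoc _ (θ s), heθ, neg_mul, mul_assoc, hK]
      simp
    rw [mul_add, mul_add, Finset.mul_sum, Finset.mul_sum, Finset.mul_sum, Finset.mul_sum]
    rw [Finset.sum_eq_zero, Finset.sum_eq_zero, add_zero]
    · intro s hs
      apply move
      have := ih L (S.erase s) (by rw [Finset.card_erase_of_mem hs]; have := Finset.card_pos.2 ⟨s, hs⟩; omega)
        (Function.update v (Sum.inr s) true) ⟨s0, hs0⟩
      rwa [vb_inr] at this
    · intro x hx
      by_cases hxi : x.1 = α (va v)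
      · apply move
        have hne : x.1 ≠ i := by rw [hxi]; exact hi
        have := ih (L.erase x) S (by rw [Finset.card_erase_of_mem hx]; have := Finset.card_pos.2 ⟨x, hx⟩; omega)
          (Function.update v (Sum.inl x) true) ⟨s0, Finset.mem_erase.2 ⟨by rintro rfl; exact hne rfl, hs0⟩⟩
        rwa [vb_inl_ne _ _ _ _ hne] at this
      · rw [inl_term he hee heθ _ S v x hxi, mul_zero]

/-- block part -/
def blk (L : Finset (I × Db)) (i : I) : Finset Db := univ.filter (fun s => (i, s) ∈ L)
def rst (L : Finset (I × Db)) (i : I) : Finset (I × Db) := L.filter (fun x => x.1 ≠ i)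
def raise (v : DD I Da Db → Bool) (i : I) (T : Finset Db) : DD I Da Db → Bool :=
  Sum.elim (fun x => v (Sum.inl x) || decide (x.1 = i ∧ x.2 ∈ T)) (fun s => v (Sum.inr s))

omit he hee heθ in
theorem raise_empty (v : DD I Da Db → Bool) (i : I) : raise v i ∅ = v := by
  funext x; rcases x with x | x <;> simp [raise]

omit he hee heθ in
theorem raise_update (v : DD I Da Db → Bool) (i : I) (T : Finset Db) (s : Db) (hs : s ∈ T) :
    raise (Function.update v (Sum.inl (i, s)) true) i (T.erase s) = raise v i T := by
  funext x; rcases x with ⟨j, r⟩ | x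
  · by_cases h : (j, r) = (i, s)
    · simp only [Prod.mk.injEq] at h
      obtain ⟨rfl, rfl⟩ := h
      simp [raise, hs]
    · have h' : (Sum.inl (j, r) : DD I Da Db) ≠ Sum.inl (i, s) := by simpa using h
      simp only [raise, Sum.elim_inl, Function.update_of_ne h']
      congr 1
      simp only [Prod.mk.injEq, not_and] at h
      simp only [decide_eq_decide, mem_erase]
      constructor
      · rintro ⟨a, b, c⟩; exact ⟨a, c⟩
      · rintro ⟨a, c⟩; exact ⟨a, h a, c⟩
  · simp [raise]

variable (θ e β α) in
def RR (L : Finset (I × Db)) (S : Finset Da) (w : DD I Da Db → Bool) : R :=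
  if L = ∅ ∧ S = ∅ then 1 else
    ∑ s ∈ S, θ (Sum.inr s) * Kq θ e β α L (S.erase s) (Function.update w (Sum.inr s) true)

variable (θ e β) in
def Kb (i : I) (T : Finset Db) (w : Db → Bool) : R :=
  Kc (fun s => θ (Sum.inl (i, s))) (fun w => e (i, β i w)) T w

theorem C2 (n : ℕ) (L : Finset (I × Db)) (S : Finset Da) (i : I) (hn : (blk L i).card = n)
    (v : DD I Da Db → Bool) (hi : α (va v) = i) :
    Kq θ e β α L S v = Kb θ e β i (blk L i) (vb v i) * RR θ e β α (rst L i) S (raise v i (blk L i)) := by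
  have hlab : ∀ v, α (va v) = i → lab β α v = (i, β i (vb v i)) := by
    intro v hi; unfold lab; rw [hi]
  induction n generalizing L v with
  | zero =>
    have h0 : blk L i = ∅ := Finset.card_eq_zero.1 hn
    have hL : ∀ x ∈ L, x.1 ≠ i := by
      rintro ⟨j, s⟩ hx rfl
      have : s ∈ blk L j := by simp [blk, hx]
      rw [h0] at this; simp at this
    have hr : rst L i = L := by
      unfold rst; exact Finset.filter_true_of_mem hL
    rw [h0, hr, raise_empty]
    unfold Kb RR
    rw [Kc_empty]
    split_ifs with h
    · rw [h.1, h.2, Kq_empty, mul_one, hlab v hi]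
    · rw [Kq_eq _ _ _ _ _ _ h, mul_add, Finset.mul_sum, Finset.sum_eq_zero, zero_add, hlab v hi]
      intro x hx
      exact inl_term he hee heθ _ _ _ _ (by rw [hi]; exact hL x hx)
  | succ n ih =>
    have hne : blk L i ≠ ∅ := by rw [ne_eq, ← Finset.card_eq_zero]; omega
    obtain ⟨s0, hs0⟩ := Finset.nonempty_iff_ne_empty.2 hne
    have hs0' : (i, s0) ∈ L := by simpa [blk] using hs0
    rw [Kq_eq]
    swap
    · rintro ⟨rfl, -⟩; simp at hs0'
    rw [mul_add, Finset.mul_sum, Finset.mul_sum, Finset.sum_eq_zero (s := S), add_zero]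
    swap
    · intro s hs
      rw [hlab v hi, ← mul_assoc, heθ, neg_mul, mul_assoc]
      have := C1 (β := β) (α := α) he hee heθ _ L (S.erase s) rfl (Function.update v (Sum.inr s) true) i ⟨s0, hs0'⟩
      rw [vb_inr] at this
      rw [this]; simp
    have hfil : ∑ x ∈ L, e (lab β α v) * (θ (Sum.inl x) *
          Kq θ e β α (L.erase x) S (Function.update v (Sum.inl x) true)) =
        ∑ s ∈ blk L i, e (lab β α v) * (θ (Sum.inl (i, s)) *
          Kq θ e β α (L.erase (i, s)) S (Function.update v (Sum.inl (i, s)) true)) := by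
      refine Eq.trans ?_ (Finset.sum_map (blk L i) ⟨fun s => (i, s), fun a b h => by simpa using h⟩
        (fun x => e (lab β α v) * (θ (Sum.inl x) *
          Kq θ e β α (L.erase x) S (Function.update v (Sum.inl x) true))))
      symm
      apply Finset.sum_subset
      · intro x hx
        simp only [blk, mem_map, mem_filter, mem_univ, true_and, Function.Embedding.coeFn_mk] at hx
        obtain ⟨s, hs, rfl⟩ := hx; exact hs
      · rintro ⟨j, s⟩ hx hx'
        apply inl_term he hee heθ
        rw [hi]
        rintro rfl
        apply hx'
        simp only [blk, mem_map, mem_filter, mem_univ, true_and, Function.Embedding.coeFn_mk]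
        exact ⟨s, hx, rfl⟩
    rw [hfil]
    have hKb : Kb θ e β i (blk L i) (vb v i) = e (i, β i (vb v i)) * ∑ s ∈ blk L i,
        θ (Sum.inl (i, s)) * Kb θ e β i ((blk L i).erase s) (Function.update (vb v i) s true) := by
      unfold Kb; rw [Kc_eq _ _ hne]
    rw [hKb, hlab v hi, Finset.mul_sum, Finset.sum_mul]
    refine Finset.sum_congr rfl fun s hs => ?_
    have hb : blk (L.erase (i, s)) i = (blk L i).erase s := by
      ext r; simp [blk]
    have hr : rst (L.erase (i, s)) i = rst L i := by
      ext ⟨j, r⟩; simp only [rst, mem_filter, mem_erase, ne_eq, Prod.mk.injEq]; tauto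
    rw [ih (L.erase (i, s)) (by rw [hb, Finset.card_erase_of_mem hs, hn]; rfl) _ (by rw [va_inl]; exact hi),
      hb, hr, raise_update _ _ _ _ hs, vb_inl]
    simp only [mul_assoc]

variable (θ e β) in
def kk (i : I) : R := Kb θ e β i univ base

omit he hee heθ in
theorem RR_eq (L : Finset (I × Db)) (S : Finset Da) (w : DD I Da Db → Bool) (hS : S ≠ ∅) :
    RR θ e β α L S w = ∑ s ∈ S, θ (Sum.inr s) * Kq θ e β α L (S.erase s) (Function.update w (Sum.inr s) true) := by
  unfold RR; rw [if_neg]; exact fun h => hS h.2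

def fullL (J : Finset I) : Finset (I × Db) := univ.filter (fun x => x.1 ∉ J)

theorem compE (hke : ∀ i b, kk θ e β i * e (i, b) = 0) (hkk : ∀ i, kk θ e β i * kk θ e β i = 0)
    (hkae : ∀ i x, kk θ e β i * e x = -(e x * kk θ e β i))
    (hkaθ : ∀ i s, kk θ e β i * θ s = -(θ s * kk θ e β i))
    (hkak : ∀ i j, kk θ e β i * kk θ e β j = -(kk θ e β j * kk θ e β i))
    (n : ℕ) (S : Finset Da) (hn : S.card = n) (J : Finset I) (hJ : J.card + S.card + 1 = Fintype.card I)
    (v : DD I Da Db → Bool) (hv : ∀ i ∉ J, vb v i = base) (x : R) (hxe : ∀ j ∈ J, ∀ b, x * e (j, b) = 0)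
    (hxk : ∀ j ∈ J, x * kk θ e β j = 0) :
    x * Kq θ e β α (fullL J) S v =
      x * Kc (fun s => θ (Sum.inr s)) (fun w => kk θ e β (α w)) S (va v) := by
  induction n generalizing S J v x with
  | zero =>
    by_cases hi : α (va v) ∈ J
    · obtain ⟨r, hr⟩ := Kq_eq_mul θ e β α (fullL J) S v
      obtain ⟨r', hr'⟩ := Kc_eq_mul (fun s => θ (Sum.inr s)) (fun w => kk θ e β (α w)) S (va v)
      rw [hr, hr', ← mul_assoc, ← mul_assoc, hxk _ hi, lab, hxe _ hi, zero_mul, zero_mul]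
    have hS : S = ∅ := Finset.card_eq_zero.1 hn
    have hJ' : insert (α (va v)) J = univ := by
      rw [← Finset.card_eq_iff_eq_univ, Finset.card_insert_of_notMem hi]; omega
    rw [C2 he hee heθ _ _ _ _ rfl v rfl]
    have hb : blk (fullL J) (α (va v)) = (univ : Finset Db) := by ext s; simp [blk, fullL, hi]
    have hr : rst (fullL J) (α (va v)) = (∅ : Finset (I × Db)) := by
      ext ⟨j, s⟩
      have : j ∈ insert (α (va v)) J := by rw [hJ']; simp
      simp only [rst, fullL, mem_filter, mem_univ, true_and, notMem_empty, iff_false]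
      rintro ⟨h1, h2⟩
      rcases Finset.mem_insert.1 this with h | h
      exacts [h2 h, h1 h]
    rw [hb, hr, hS, Kc_empty, hv _ hi, RR, if_pos ⟨rfl, rfl⟩, mul_one]; rfl
  | succ n ih =>
    by_cases hi : α (va v) ∈ J
    · obtain ⟨r, hr⟩ := Kq_eq_mul θ e β α (fullL J) S v
      obtain ⟨r', hr'⟩ := Kc_eq_mul (fun s => θ (Sum.inr s)) (fun w => kk θ e β (α w)) S (va v)
      rw [hr, hr', ← mul_assoc, ← mul_assoc, hxk _ hi, lab, hxe _ hi, zero_mul, zero_mul]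
    have hS : S ≠ ∅ := by rw [ne_eq, ← Finset.card_eq_zero]; omega
    rw [C2 he hee heθ _ _ _ _ rfl v rfl]
    have hb : blk (fullL J) (α (va v)) = (univ : Finset Db) := by ext s; simp [blk, fullL, hi]
    have hr : rst (fullL J) (α (va v)) = (fullL (insert (α (va v)) J) : Finset (I × Db)) := by
      ext ⟨j, s⟩
      simp only [rst, fullL, mem_filter, mem_univ, true_and, mem_insert]; tauto
    rw [hb, hr, hv _ hi, RR_eq _ _ _ hS, Kc_eq _ _ hS]
    change x * (kk θ e β (α (va v)) * _) = _
    rw [← mul_assoc, ← mul_assoc, Finset.mul_sum, Finset.mul_sum]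
    refine Finset.sum_congr rfl fun s hs => ?_
    rw [← mul_assoc, ← mul_assoc]
    have hcard : (S.erase s).card = n := by rw [Finset.card_erase_of_mem hs, hn]; rfl
    rw [ih (S.erase s) hcard (insert (α (va v)) J)
      (by rw [Finset.card_insert_of_notMem hi, hcard]; omega)]
    · rw [va_inr]; rfl
    · intro i hi'
      have h1 : i ∉ J := fun h => hi' (Finset.mem_insert_of_mem h)
      have h2 : i ≠ α (va v) := fun h => hi' (by rw [h]; exact Finset.mem_insert_self _ _)
      rw [vb_inr, ← hv i h1]
      funext r
      simp [vb, raise, h2]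
    · intro j hj b
      rw [mul_assoc, ← neg_eq_iff_eq_neg.2 (heθ (j, b) (Sum.inr s)), mul_neg, ← mul_assoc]
      rcases Finset.mem_insert.1 hj with rfl | hj
      · rw [mul_assoc x, hke]; simp
      · rw [mul_assoc x, hkae, mul_neg, ← mul_assoc, hxe _ hj]; simp
    · intro j hj
      rw [mul_assoc, ← neg_eq_iff_eq_neg.2 (hkaθ j (Sum.inr s)), mul_neg, ← mul_assoc]
      rcases Finset.mem_insert.1 hj with rfl | hj
      · rw [mul_assoc x, hkk]; simp
      · rw [mul_assoc x, hkak, mul_neg, ← mul_assoc, hxk _ hj]; simp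

end comp
end Crs

set_option linter.all false
namespace Crs
open Finset

section comp2
variable {F : Type} [Field F]
variable {I Da Db Λb Va Vb : Type} [Fintype I] [DecidableEq I] [Fintype Da] [DecidableEq Da] [Fintype Db]
  [DecidableEq Db]

def prodcube (z : I → (Db → Bool) → Vb) (a : (Da → Bool) → Va) (t : DD I Da Db → Bool) :
    (I → Vb) × Va := (fun i => z i (vb t i), a (va t))

def compC (I : Type) [Fintype I] [DecidableEq I] {Da Db Va Vb : Type}
    (Z : Chain F Db Vb) (A : Chain F Da Va) : Chain F (DD I Da Db) ((I → Vb) × Va) where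
  N := (I → Z.N) × A.N
  fin := inferInstance
  y := fun n => prodcube (fun i => Z.y (n.1 i)) (A.y n.2)
  c := fun n => (∏ i, Z.c (n.1 i)) * A.c n.2

def jj (Da : Type) (i : I) : Db ⊕ Λb → (DD I Da Db) ⊕ (I × Λb) :=
  Sum.map (fun s => Sum.inl (i, s)) (fun b => (i, b))

theorem jj_inj (i : I) : Function.Injective (jj (Db := Db) (Λb := Λb) Da i) := by
  intro a b h
  rcases a with a | a <;> rcases b with b | b <;> simp [jj] at h <;> simp [h]

variable (F Da) in
noncomputable abbrev kE (β : I → (Db → Bool) → Λb) (i : I) : EA F ((DD I Da Db) ⊕ (I × Λb)) :=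
  kk (fun s : DD I Da Db => g F (Sum.inl s)) (fun x => g F (Sum.inr x)) β i

theorem kE_eq (β : I → (Db → Bool) → Λb) (i : I) : kE F Da β i = mapE (jj Da i) (kc F (β i)) := by
  unfold kE kk Kb Kc kc
  rw [Ku_eq_Kp (fun v => g_sq _) (fun v s => g_anti _ _)]
  symm
  rw [← Ku_eq_Kp (fun v => g_sq _) (fun v s => g_anti _ _), ← Ku_eq_Kp (fun v => g_sq _) (fun v s => g_anti _ _)]
  erw [map_Ku (mapE (F := F) (jj (Λb := Λb) (Db := Db) Da i)).toRingHom]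
  simp [jj]

variable [Fintype Λb] (hb : Fintype.card Λb = Fintype.card Db + 1)

theorem kE_mem (β : I → (Db → Bool) → Λb) (i : I) :
    kE F Da β i ∈ Gr F (Set.range (jj (Db := Db) (Λb := Λb) Da i)) (2 * Fintype.card Db + 1) := by
  rw [kE_eq, ← Set.image_univ]
  exact mapE_mem_Gr _ (kc_mem _ _ (fun _ => trivial) (fun _ => trivial))

include hb in
theorem ncard_jj (i : I) : (Set.range (jj (Db := Db) (Λb := Λb) Da i)).ncard = 2 * Fintype.card Db + 1 := by
  rw [← Set.image_univ, Set.ncard_image_of_injective _ (jj_inj i), Set.ncard_univ,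
    Nat.card_eq_fintype_card, Fintype.card_sum]; omega

theorem odd_anti {X : Type} {s t : Set X} {k m : ℕ} {a b : EA F X} (ha : a ∈ Gr F s (2 * k + 1))
    (hb : b ∈ Gr F t (2 * m + 1)) : a * b = -(b * a) := by
  rw [mul_comm_Gr ha hb, Odd.neg_one_pow, neg_one_zsmul]
  exact (odd_two_mul_add_one k).mul (odd_two_mul_add_one m)

theorem g_odd {X : Type} (x : X) : g F x ∈ Gr F Set.univ (2 * 0 + 1) := g_mem_Gr trivial

include hb in
theorem kE_sq (β : I → (Db → Bool) → Λb) (i : I) : kE F Da β i * kE F Da β i = 0 := by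
  refine eq_zero_of_mem_Gr (Set.finite_range _) ?_ (mul_mem_Gr (kE_mem β i) (kE_mem β i))
  rw [ncard_jj hb]; omega

include hb in
theorem kc_comp (ha : Fintype.card Da + 1 = Fintype.card I) (β : I → (Db → Bool) → Λb)
    (α : (Da → Bool) → I) :
    kc F (lab β α) = Ku (fun s => g F (Sum.inl (Sum.inr s))) (Fintype.card Da) univ
      (fun w => kE F Da β (α w)) := by
  have h1 := compE (θ := fun s : DD I Da Db => g F (Sum.inl s)) (e := fun x : I × Λb => g F (Sum.inr x))
    (β := β) (α := α) (fun x => g_sq _) (fun x y => g_anti _ _) (fun x s => g_anti _ _)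
    (fun i b => by
      refine eq_zero_of_mem_Gr (Set.finite_range _) ?_ (mul_mem_Gr (kE_mem β i) (g_mem_Gr ⟨Sum.inr b, rfl⟩))
      rw [ncard_jj hb]; omega)
    (fun i => kE_sq hb β i)
    (fun i x => odd_anti (kE_mem β i) (g_odd _))
    (fun i s => odd_anti (kE_mem β i) (g_odd _))
    (fun i j => odd_anti (kE_mem β i) (kE_mem β j)) (Fintype.card Da) univ (by simp) ∅
    (by simpa using ha) base (by intro i _; rfl) 1 (by simp) (by simp)
  rw [one_mul, one_mul] at h1
  have h2 : kc F (lab β α) = Kq (fun s : DD I Da Db => g F (Sum.inl s)) (fun x : I × Λb => g F (Sum.inr x))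
    β α (fullL ∅) univ base := by
    unfold kc Kq Kc
    rw [Ku_eq_Kp (fun v => g_sq _) (fun v s => g_anti _ _)]
    have : (fullL ∅ : Finset (I × Db)).disjSum (univ : Finset Da) = univ := by
      ext x; rcases x with x | x <;> simp [fullL]
    rw [this]; rfl
  rw [h2, h1, Ku_eq_Kp]
  · rfl
  · intro v; exact kE_sq hb β _
  · intro v s; exact odd_anti (kE_mem β _) (g_odd _)

include hb in
theorem exists_coef : ∃ κ : ((Db → Bool) → Λb) → F, ∀ ℓ, kc F ℓ = κ ℓ • mon F (univ : Finset (Db ⊕ Λb)).toList := by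
  have : ∀ ℓ : (Db → Bool) → Λb, ∃ c : F, kc F ℓ = c • mon F (univ : Finset (Db ⊕ Λb)).toList := by
    intro ℓ
    refine eq_smul_of_mem_Gr (k := 2 * Fintype.card Db + 1) (by rw [Fintype.card_sum]; omega)
      (Finset.nodup_toList _) (by simp) (kc_mem ℓ Set.univ (fun _ => trivial) (fun _ => trivial))
  choose κ hκ using this
  exact ⟨κ, hκ⟩

noncomputable def bigL (I Da Db Λb : Type) [Fintype I] [Fintype Da] [Fintype Db] [Fintype Λb] :
    List ((DD I Da Db) ⊕ (I × Λb)) :=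
  (univ : Finset (Da ⊕ I)).toList.flatMap
    (Sum.elim (fun s => [Sum.inl (Sum.inr s)]) (fun i => (univ : Finset (Db ⊕ Λb)).toList.map (jj Da i)))

theorem bigL_nodup : (bigL I Da Db Λb).Nodup := by
  unfold bigL
  rw [List.nodup_flatMap]
  constructor
  · rintro (s | i) _
    · simp
    · exact (Finset.nodup_toList _).map (jj_inj i)
  · refine (Finset.nodup_toList _).imp ?_
    rintro (s | i) (r | j) h x hx hy
    · simp at hx hy; subst hx; simp at hy; exact h (by rw [hy])
    · simp at hx hy; subst hx
      rcases hy with ⟨a, ha⟩ | ⟨a, ha⟩ <;> simp [jj] at ha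
    · simp at hx hy; subst hy
      rcases hx with ⟨a, ha⟩ | ⟨a, ha⟩ <;> simp [jj] at ha
    · simp only [Sum.elim_inr, List.mem_map, Finset.mem_toList, mem_univ, true_and] at hx hy
      obtain ⟨a, rfl⟩ := hx
      obtain ⟨b, hb⟩ := hy
      apply h
      rcases a with a | a <;> rcases b with b | b <;> simp [jj] at hb <;> simp [hb]

include hb in
theorem kc_comp_coef (ha : Fintype.card Da + 1 = Fintype.card I) {κa : ((Da → Bool) → I) → F}
    (hκa : ∀ ℓ, kc F ℓ = κa ℓ • mon F (univ : Finset (Da ⊕ I)).toList)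
    {κb : ((Db → Bool) → Λb) → F}
    (hκb : ∀ ℓ, kc F ℓ = κb ℓ • mon F (univ : Finset (Db ⊕ Λb)).toList)
    (β : I → (Db → Bool) → Λb) (α : (Da → Bool) → I) :
    kc F (lab β α) = ((∏ i, κb (β i)) * κa α) • mon F (bigL I Da Db Λb) := by
  rw [kc_comp hb ha]
  obtain ⟨Φ, hΦ⟩ := exists_lift (F := F) (X := Da ⊕ I)
    (Sum.elim (fun s => g F (X := (DD I Da Db) ⊕ (I × Λb)) (Sum.inl (Sum.inr s))) (fun i => kE F Da β i))
    (by
      rintro (s | i)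
      · exact g_sq _
      · exact kE_sq hb β i)
    (by
      rintro (s | i) (r | j)
      · exact g_anti _ _
      · exact odd_anti (g_odd _) (kE_mem β j)
      · exact odd_anti (kE_mem β i) (g_odd _)
      · exact odd_anti (kE_mem β i) (kE_mem β j))
  have h1 : Φ (kc F α) = Ku (fun s => g F (Sum.inl (Sum.inr s))) (Fintype.card Da) univ
      (fun w => kE F Da β (α w)) := by
    unfold kc
    have := map_Ku Φ.toRingHom (fun s => g F (X := Da ⊕ I) (Sum.inl s)) (Fintype.card Da) univ
      (fun t => g F (X := Da ⊕ I) (Sum.inr (α t)))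
    refine Eq.trans this ?_
    simp only [AlgHom.toRingHom_eq_coe, RingHom.coe_coe, hΦ, Sum.elim_inl, Sum.elim_inr]
  rw [← h1, hκa, map_smul]
  have h2 : ∀ l : List (Da ⊕ I), Φ (mon F l) = ((l.map (Sum.elim (fun _ => 1) (fun i => κb (β i)))).prod) •
      mon F (l.flatMap (Sum.elim (fun s => [Sum.inl (Sum.inr s)]) (fun i => (univ : Finset (Db ⊕ Λb)).toList.map (jj Da i)))) := by
    intro l
    induction l with
    | nil => simp [mon_nil]
    | cons x l ih =>
      rw [mon_cons, map_mul, ih, hΦ, List.flatMap_cons, mon_append, List.map_cons, List.prod_cons]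
      rcases x with s | i
      · simp [mon_cons, mon_nil]
      · simp only [Sum.elim_inr]
        rw [kE_eq, hκb, map_smul, mapE_mon, smul_mul_smul_comm]
  rw [h2, Finset.prod_map_toList, Fintype.prod_sum_type, smul_smul]
  simp [bigL, mul_comm]

include hb in
theorem ev_comp_ne (ha : Fintype.card Da + 1 = Fintype.card I) (Z : Chain F Db Vb) (A : Chain F Da Va)
    (ℓa : Va → I) (ℓb : Vb → Λb) (hA : ev A ℓa ≠ 0) (hZ : ev Z ℓb ≠ 0) :
    ev (compC I Z A) (fun u => (ℓa u.2, ℓb (u.1 (ℓa u.2)))) ≠ 0 := by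
  obtain ⟨κa, hκa⟩ := exists_coef (F := F) (Db := Da) (Λb := I) ha.symm
  obtain ⟨κb, hκb⟩ := exists_coef (F := F) (Db := Db) (Λb := Λb) hb
  have eA : ev A ℓa = (∑ n, A.c n * κa (fun t => ℓa (A.y n t))) • mon F (univ : Finset (Da ⊕ I)).toList := by
    unfold ev; rw [Finset.sum_smul]
    exact Finset.sum_congr rfl fun n _ => by rw [hκa, smul_smul]
  have eZ : ev Z ℓb = (∑ n, Z.c n * κb (fun t => ℓb (Z.y n t))) • mon F (univ : Finset (Db ⊕ Λb)).toList := by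
    unfold ev; rw [Finset.sum_smul]
    exact Finset.sum_congr rfl fun n _ => by rw [hκb, smul_smul]
  rw [eA] at hA
  rw [eZ] at hZ
  have hA' := left_ne_zero_of_smul hA
  have hZ' := left_ne_zero_of_smul hZ
  have : ev (compC I Z A) (fun u => (ℓa u.2, ℓb (u.1 (ℓa u.2)))) =
      ((∏ i : I, ∑ n, Z.c n * κb (fun t => ℓb (Z.y n t))) * (∑ n, A.c n * κa (fun t => ℓa (A.y n t)))) •
        mon F (bigL I Da Db Λb) := by
    rw [Finset.prod_univ_sum, Finset.sum_mul_sum, ← Finset.sum_product', Finset.sum_smul]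
    unfold ev
    rw [Fintype.piFinset_univ, Finset.univ_product_univ]
    change ∑ n : (I → Z.N) × A.N, _ = _
    refine Finset.sum_congr rfl fun n _ => ?_
    have := kc_comp_coef hb ha hκa hκb (fun i t => ℓb (Z.y (n.1 i) t)) (fun t => ℓa (A.y n.2 t))
    change (compC I Z A).c n • kc F (lab (fun i t => ℓb (Z.y (n.1 i) t)) (fun t => ℓa (A.y n.2 t))) = _
    rw [this, smul_smul]
    congr 1
    simp only [compC]
    rw [Finset.prod_mul_distrib]; ring
  rw [this]
  refine smul_ne_zero (mul_ne_zero (Finset.prod_ne_zero_iff.2 fun _ _ => hZ') hA') (mon_ne_zero _ bigL_nodup)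

end comp2
end Crs

set_option linter.all false
namespace Crs
open Finset

section comp3
variable {F : Type} [Field F]
variable {I Da Db Va Vb : Type} [Fintype I] [DecidableEq I] [Fintype Da] [DecidableEq Da] [Fintype Db]
  [DecidableEq Db]

theorem face_prod_inl (z : I → (Db → Bool) → Vb) (a : (Da → Bool) → Va) (i : I) (s : Db) (b : Bool) :
    face (D := DD I Da Db) (Sum.inl (i, s)) b (prodcube z a) =
      prodcube (fun j => if j = i then face s b (z i) else z j) a := by
  funext t
  unfold face prodcube
  rw [va_inl]
  congr 1
  funext j
  by_cases h : j = i
  · subst h; simp [vb_inl]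
  · rw [vb_inl_ne _ _ _ _ (fun h' => h h'.symm)]; simp [h]

theorem face_prod_inr (z : I → (Db → Bool) → Vb) (a : (Da → Bool) → Va) (s : Da) (b : Bool) :
    face (D := DD I Da Db) (Sum.inr s) b (prodcube z a) = prodcube z (face s b a) := by
  funext t
  unfold face prodcube
  rw [va_inr]
  rfl

theorem Good_comp {𝒢a : Set (Va → Va)} {𝒢b : Set (Vb → Vb)} {𝔉b : Set (Set Vb)}
    {𝒢 : Set ((I → Vb) × Va → (I → Vb) × Va)} {𝔉 : Set (Set ((I → Vb) × Va))}
    (h1 : ∀ f ∈ 𝒢a, ∃ σ : Equiv.Perm I, Equiv.Perm.sign σ = 1 ∧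
      (fun u : (I → Vb) × Va => (u.1 ∘ σ.symm, f u.2)) ∈ 𝒢)
    (h2 : ∀ f ∈ 𝒢b, ∀ i, (fun u : (I → Vb) × Va => (Function.update u.1 i (f (u.1 i)), u.2)) ∈ 𝒢)
    (h3 : ∀ B ∈ 𝔉b, ∀ i, {u : (I → Vb) × Va | u.1 i ∈ B} ∈ 𝔉)
    (Z : Chain F Db Vb) (A : Chain F Da Va) (hA : Good 𝒢a ∅ A) (hZ : Good 𝒢b 𝔉b Z) :
    Good 𝒢 𝔉 (compC I Z A) := by
  intro ψ hinv hanti hvan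
  have key : ∀ n : (I → Z.N) × A.N, (compC I Z A).c n * ∑ s : DD I Da Db, (ψ s (face s true ((compC I Z A).y n)) - ψ s (face s false ((compC I Z A).y n))) =
    (∑ i : I, ((∏ i, Z.c (n.1 i)) * A.c n.2) * ∑ s : Db,
      (ψ (Sum.inl (i, s)) (face (Sum.inl (i, s)) true ((compC I Z A).y n)) - ψ (Sum.inl (i, s)) (face (Sum.inl (i, s)) false ((compC I Z A).y n)))) +
    A.c n.2 * ∑ s : Da, ((∏ i, Z.c (n.1 i)) * ψ (Sum.inr s) (prodcube (fun i => Z.y (n.1 i)) (face s true (A.y n.2))) -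
      (∏ i, Z.c (n.1 i)) * ψ (Sum.inr s) (prodcube (fun i => Z.y (n.1 i)) (face s false (A.y n.2)))) := by
    intro n
    rw [Fintype.sum_sum_type, mul_add, Fintype.sum_prod_type, Finset.mul_sum]
    congr 1
    have : (compC I Z A).c n = A.c n.2 * (∏ i, Z.c (n.1 i)) := mul_comm _ _
    rw [this, mul_assoc, Finset.mul_sum]
    congr 1
    refine Finset.sum_congr rfl fun s _ => ?_
    rw [mul_sub]
    have e : (compC I Z A).y n = prodcube (fun i => Z.y (n.1 i)) (A.y n.2) := rfl
    rw [e, face_prod_inr, face_prod_inr]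
  have tot : ∑ n : (I → Z.N) × A.N, (compC I Z A).c n * ∑ s : DD I Da Db, (ψ s (face s true ((compC I Z A).y n)) - ψ s (face s false ((compC I Z A).y n))) = 0 := by
    rw [Finset.sum_congr rfl (fun n _ => key n), Finset.sum_add_distrib]
    have e1 : ∑ n : (I → Z.N) × A.N, (∑ i : I, ((∏ i, Z.c (n.1 i)) * A.c n.2) * ∑ s : Db,
      (ψ (Sum.inl (i, s)) (face (Sum.inl (i, s)) true ((compC I Z A).y n)) - ψ (Sum.inl (i, s)) (face (Sum.inl (i, s)) false ((compC I Z A).y n)))) = 0 := by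
      rw [Finset.sum_comm]
      refine Finset.sum_eq_zero fun i _ => ?_
      rw [Fintype.sum_prod_type_right]
      refine Finset.sum_eq_zero fun m _ => ?_
      rw [← Equiv.sum_comp (Equiv.piSplitAt i (fun _ => Z.N)).symm, Fintype.sum_prod_type_right]
      refine Finset.sum_eq_zero fun k _ => ?_
      let zz : ((Db → Bool) → Vb) → I → (Db → Bool) → Vb := fun x j => if h : j = i then x else Z.y (k ⟨j, h⟩)
      have hg := hZ (fun s x => ψ (Sum.inl (i, s)) (prodcube (zz x) (A.y m))) ?_ ?_ ?_
      · have hc : ∀ n : Z.N, ∏ j, Z.c ((Equiv.piSplitAt i (fun _ => Z.N)).symm (n, k) j) =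
          Z.c n * ∏ j ∈ univ.erase i, (if h : j = i then 1 else Z.c (k ⟨j, h⟩)) := by
          intro n
          rw [← Finset.mul_prod_erase univ _ (mem_univ i)]
          congr 1
          · simp
          · refine Finset.prod_congr rfl fun j hj => ?_
            have hj := Finset.ne_of_mem_erase hj
            simp [hj]
        have hf : ∀ (n : Z.N) (s : Db) (b : Bool), face (Sum.inl (i, s)) b ((compC I Z A).y ((Equiv.piSplitAt i (fun _ => Z.N)).symm (n, k), m)) = prodcube (zz (face s b (Z.y n))) (A.y m) := by
          intro n s b
          have e : (compC I Z A).y ((Equiv.piSplitAt i (fun _ => Z.N)).symm (n, k), m) = prodcube (fun j => Z.y ((Equiv.piSplitAt i (fun _ => Z.N)).symm (n, k) j)) (A.y m) := rfl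
          refine (congrArg (face (Sum.inl (i, s)) b) e).trans ?_
          rw [face_prod_inl]
          congr 1
          funext j
          by_cases h : j = i
          · subst h; simp [zz]
          · simp [zz, h]
        simp only [hc, hf]
        have := congrArg (fun x => (∏ j ∈ univ.erase i, (if h : j = i then 1 else Z.c (k ⟨j, h⟩))) * A.c m * x) hg
        simp only [mul_zero, Finset.mul_sum] at this
        rw [← this]
        refine Finset.sum_congr rfl fun n _ => ?_
        rw [Finset.mul_sum]
        refine Finset.sum_congr rfl fun s _ => ?_
        ring
      · intro f hf s y
        rw [← hinv _ (h2 f hf i) (Sum.inl (i, s)) (prodcube (zz y) (A.y m))]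
        congr 1
        funext t
        unfold prodcube
        simp only
        congr 1
        funext j
        by_cases h : j = i
        · subst h; simp [zz]
        · simp [zz, h]
      · intro π s y
        have := hanti (Equiv.sumCongr (Equiv.Perm.prodExtendRight i π) 1) (Sum.inl (i, s)) (prodcube (zz y) (A.y m))
        rw [Equiv.Perm.sign_sumCongr, Equiv.Perm.sign_prodExtendRight] at this
        simp only [Equiv.sumCongr_apply, Sum.map_inl, Equiv.Perm.prodExtendRight_apply_eq, map_one, mul_one] at this
        rw [← this]
        congr 1
        funext t
        unfold prodcube
        congr 1
        funext j
        by_cases h : j = i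
        · subst h; simp only [zz, dite_true]
          congr 1
          funext s
          simp [vb]
        · simp only [zz, h, dite_false]
          congr 1
          funext s
          simp [vb, Equiv.Perm.prodExtendRight_apply_ne _ h]
      · intro B hB s y hy
        refine hvan _ (h3 B hB i) _ _ fun t => ?_
        simp [prodcube, zz, hy]
    rw [e1, zero_add]
    have hg := hA (fun s a => ∑ k : I → Z.N, (∏ i, Z.c (k i)) * ψ (Sum.inr s) (prodcube (fun i => Z.y (k i)) a)) ?_ ?_ ?_
    · rw [← hg, Fintype.sum_prod_type_right]
      refine Finset.sum_congr rfl fun m _ => ?_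
      simp only [← Finset.sum_sub_distrib]
      rw [Finset.sum_comm, Finset.mul_sum]
    · intro f hf s y
      obtain ⟨σ, hσ, hm⟩ := h1 f hf
      rw [← Equiv.sum_comp (Equiv.arrowCongr σ (Equiv.refl Z.N))]
      refine Finset.sum_congr rfl fun k _ => ?_
      congr 1
      · rw [← Equiv.prod_comp σ]; simp
      · rw [← hinv _ hm (Sum.inr s) (prodcube (fun i => Z.y (k i)) y)]
        have := hanti (Equiv.sumCongr (Equiv.prodCongrLeft (fun _ : Db => σ⁻¹)) (1 : Equiv.Perm Da)) (Sum.inr s)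
          (prodcube (fun i => Z.y ((Equiv.arrowCongr σ (Equiv.refl Z.N)) k i)) (fun t => f (y t)))
        rw [Equiv.Perm.sign_sumCongr, Equiv.Perm.sign_prodCongrLeft] at this
        simp [hσ] at this
        simp only [Equiv.arrowCongr_apply, Equiv.refl_apply, Function.comp_apply, Equiv.coe_refl, id]
        rw [← this]
        congr 1
        
    · intro π s y
      rw [Finset.smul_sum]
      refine Finset.sum_congr rfl fun k _ => ?_
      rw [← mul_smul_comm]
      congr 1
      have := hanti (Equiv.sumCongr 1 π) (Sum.inr s) (prodcube (fun i => Z.y (k i)) y)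
      rw [Equiv.Perm.sign_sumCongr] at this
      simp only [map_one, one_mul] at this
      rw [← this]
      rfl
    · intro B hB; exact absurd hB (Set.notMem_empty _)
  exact tot
end comp3
end Crs

set_option linter.all false
namespace Crs
open Finset

section cub
variable (F : Type) [Field F] {V W : Type}

def bf {n : ℕ} (s : Fin (n+1)) (b : Bool) (y : (Fin (n+1) → Bool) → V) : (Fin n → Bool) → V :=
  fun t => y (Fin.insertNth s b t)

abbrev Qc (V : Type) (n : ℕ) := ((Fin n → Bool) → V) →₀ F

noncomputable def bd1 {n : ℕ} (y : (Fin (n+1) → Bool) → V) : Qc F V n :=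
  ∑ s : Fin (n+1), (-1 : ℤ)^(s : ℕ) • (Finsupp.single (bf s true y) 1 - Finsupp.single (bf s false y) 1)

noncomputable def bd (n : ℕ) : Qc F V (n+1) →ₗ[F] Qc F V n := Finsupp.linearCombination F (bd1 F)

theorem bd_single {n : ℕ} (y : (Fin (n+1) → Bool) → V) : bd F n (Finsupp.single y 1) = bd1 F y := by
  simp [bd]

noncomputable def mp (f : V → W) (n : ℕ) : Qc F V n →ₗ[F] Qc F W n :=
  Finsupp.lmapDomain F F (fun y t => f (y t))

@[simp] theorem mp_single (f : V → W) {n : ℕ} (y : (Fin n → Bool) → V) (r : F) :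
    mp F f n (Finsupp.single y r) = Finsupp.single (fun t => f (y t)) r := by
  simp [mp, Finsupp.mapDomain_single]

theorem mp_bd (f : V → W) {n : ℕ} (z : Qc F V (n+1)) : bd F n (mp F f (n+1) z) = mp F f n (bd F n z) := by
  suffices h : bd F n ∘ₗ mp F f (n+1) = mp F f n ∘ₗ bd F n from LinearMap.congr_fun h z
  refine Finsupp.lhom_ext' fun y => LinearMap.ext_ring ?_
  simp only [LinearMap.comp_apply, Finsupp.lsingle_apply, mp_single, bd_single]
  unfold bd1
  simp only [map_sum, map_zsmul, map_sub, mp_single]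
  rfl

theorem ins_ins {n : ℕ} (s : Fin (n+2)) (r : Fin (n+1)) (b b' : Bool) (t : Fin n → Bool) :
    (Fin.insertNth (s.succAbove r) b' (Fin.insertNth (r.predAbove s) b t : Fin (n+1) → Bool) : Fin (n+2) → Bool)
      = Fin.insertNth s b (Fin.insertNth r b' t : Fin (n+1) → Bool) := by
  symm
  rw [Fin.eq_insertNth_iff]
  refine ⟨by simp, ?_⟩
  rw [Fin.eq_insertNth_iff]
  constructor
  · simp only [Fin.removeNth]
    rw [Fin.succAbove_succAbove_predAbove]
    simp
  · funext k
    simp only [Fin.removeNth]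
    rw [Fin.succAbove_succAbove_succAbove_predAbove]
    simp

theorem bd_bd1 {n : ℕ} (y : (Fin (n+2) → Bool) → V) : bd F n (bd1 F y) = 0 := by
  have h : bd F n (bd1 F y) = ∑ x : Fin (n+2) × Fin (n+1), (-1 : ℤ)^((x.1 : ℕ) + (x.2:ℕ)) •
      ((Finsupp.single (bf x.2 true (bf x.1 true y)) 1 - Finsupp.single (bf x.2 false (bf x.1 true y)) 1) -
        (Finsupp.single (bf x.2 true (bf x.1 false y)) 1 - Finsupp.single (bf x.2 false (bf x.1 false y)) (1:F))) := by
    rw [Fintype.sum_prod_type]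
    simp only [bd1, map_sum, map_zsmul, map_sub, bd_single, ← Finset.sum_sub_distrib, Finset.smul_sum, zsmul_sub, pow_add, mul_smul]
  rw [h]
  refine Finset.sum_involution (fun x _ => (x.1.succAbove x.2, x.2.predAbove x.1)) ?_ ?_ ?_ ?_
  · rintro ⟨s, r⟩ _
    have hb : ∀ b b', bf (r.predAbove s) b (bf (s.succAbove r) b' y) = bf r b' (bf s b y) := by
      intro b b'
      funext t
      simp only [bf, ins_ins]
    simp only [hb]
    have hs : (-1 : ℤ)^(((s.succAbove r : Fin (n+2)) : ℕ) + ((r.predAbove s : Fin (n+1)) : ℕ)) = - (-1)^((s:ℕ) + (r : ℕ)) := by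
      have := Fin.neg_one_pow_succAbove_add_predAbove (R := ℤ) s r
      rw [this]
    rw [hs, neg_smul, ← sub_eq_add_neg, ← zsmul_sub]
    convert zsmul_zero _ using 2
    abel
  · rintro ⟨s, r⟩ _ _ h
    simp only [Prod.mk.injEq] at h
    exact Fin.succAbove_ne _ _ h.1
  · intros; simp
  · rintro ⟨s, r⟩ _
    simp [Fin.succAbove_succAbove_predAbove, Fin.predAbove_predAbove_succAbove]

theorem bd_bd {n : ℕ} (z : Qc F V (n+2)) : bd F n (bd F (n+1) z) = 0 := by
  suffices h : bd F n ∘ₗ bd F (n+1) = (0 : Qc F V (n+2) →ₗ[F] _) from LinearMap.congr_fun h z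
  refine Finsupp.lhom_ext' fun y => LinearMap.ext_ring ?_
  simp only [LinearMap.comp_apply, Finsupp.lsingle_apply, bd_single, bd_bd1]
  rfl

variable [Group V]

noncomputable def prism (u u' : V) (n : ℕ) : Qc F V n →ₗ[F] Qc F V (n+1) :=
  Finsupp.lmapDomain F F (fun y t => if t 0 then u' * y (Fin.tail t) else u * y (Fin.tail t))

theorem prism_single (u u' : V) {n : ℕ} (y : (Fin n → Bool) → V) (r : F) :
    prism F u u' n (Finsupp.single y r) =
      Finsupp.single (fun t => if t 0 then u' * y (Fin.tail t) else u * y (Fin.tail t)) r := by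
  simp [prism, Finsupp.mapDomain_single]

theorem bd_prism0 (u u' : V) (z : Qc F V 0) : bd F 0 (prism F u u' 0 z) =
    mp F (u' * ·) 0 z - mp F (u * ·) 0 z := by
  suffices h : bd F 0 ∘ₗ prism F u u' 0 = mp F (u' * ·) 0 - mp F (u * ·) 0 from LinearMap.congr_fun h z
  refine Finsupp.lhom_ext' fun y => LinearMap.ext_ring ?_
  simp only [LinearMap.comp_apply, Finsupp.lsingle_apply, prism_single, bd_single, LinearMap.sub_apply, mp_single]
  unfold bd1
  rw [Fin.sum_univ_succ, Finset.univ_eq_empty, Finset.sum_empty, add_zero, Fin.val_zero, pow_zero, one_smul]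
  congr 2 <;> funext t <;> simp [bf, Fin.tail] <;> congr 1 <;> exact Subsingleton.elim _ _

theorem bd_prism (u u' : V) {n : ℕ} (z : Qc F V (n+1)) : bd F (n+1) (prism F u u' (n+1) z) =
    mp F (u' * ·) _ z - mp F (u * ·) _ z - prism F u u' n (bd F n z) := by
  suffices h : bd F (n+1) ∘ₗ prism F u u' (n+1) = mp F (u' * ·) _ - mp F (u * ·) _ - prism F u u' n ∘ₗ bd F n from LinearMap.congr_fun h z
  refine Finsupp.lhom_ext' fun y => LinearMap.ext_ring ?_
  simp only [LinearMap.comp_apply, Finsupp.lsingle_apply, prism_single, bd_single, LinearMap.sub_apply, mp_single]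
  unfold bd1
  rw [Fin.sum_univ_succ]
  simp only [map_sum, map_zsmul, map_sub, prism_single]
  rw [sub_eq_add_neg _ (∑ _, _), ← Finset.sum_neg_distrib]
  congr 1
  · simp only [Fin.coe_ofNat_eq_mod, Nat.zero_mod, pow_zero, one_smul]
    congr 2 <;> funext t <;> simp [bf, Fin.tail]
  · refine Finset.sum_congr rfl fun s _ => ?_
    rw [Fin.val_succ, pow_succ, mul_neg_one, neg_smul]
    have : ∀ b : Bool, bf s.succ b (fun t => if t 0 then u' * y (Fin.tail t) else u * y (Fin.tail t)) =
      (fun t => if t 0 then u' * bf s b y (Fin.tail t) else u * bf s b y (Fin.tail t)) := by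
      intro b
      funext t
      simp only [bf]
      have e0 : (Fin.insertNth s.succ b t : Fin (n+2) → Bool) 0 = t 0 := by
        have : (Fin.insertNth s.succ b t : Fin (n+2) → Bool) (s.succ.succAbove 0) = t 0 := Fin.insertNth_apply_succAbove _ _ _ _
        rwa [Fin.succ_succAbove_zero] at this
      have e1 : Fin.tail (Fin.insertNth s.succ b t : Fin (n+2) → Bool) = Fin.insertNth s b (Fin.tail t) := by
        rw [Fin.eq_insertNth_iff]
        refine ⟨by simp [Fin.tail], ?_⟩
        funext k
        simp only [Fin.removeNth, Fin.tail]
        rw [← Fin.succ_succAbove_succ, Fin.insertNth_apply_succAbove]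
      rw [e0, e1]
    rw [this, this]
end cub
end Crs

set_option linter.all false
namespace Crs
open Finset

section rep
variable {p : ℕ} [Fact p.Prime] (hp : Odd p)
variable {M M' : Type} [AddCommGroup M] [Module (ZMod p) M] [AddCommGroup M'] [Module (ZMod p) M']

structure Rep (R : ZMod p → Module.End (ZMod p) M) : Prop where
  zero : R 0 = 1
  add : ∀ a b, R (a + b) = R a * R b

def xop (R : ZMod p → Module.End (ZMod p) M) : Module.End (ZMod p) M := ∑ b, (b⁻¹ : ZMod p) • R b
def nop (R : ZMod p → Module.End (ZMod p) M) : Module.End (ZMod p) M := ∑ b, R b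

def op (R : ZMod p → Module.End (ZMod p) M) (j : ℕ) : Module.End (ZMod p) M :=
  if Even j then xop R else nop R

include hp in
theorem sum_inv : ∑ b : ZMod p, b⁻¹ = 0 := by
  have h2 : (2 : ZMod p) ≠ 0 := by
    intro h
    have : ((2 : ℕ) : ZMod p) = 0 := by exact_mod_cast h
    rw [ZMod.natCast_eq_zero_iff] at this
    have h3 := (Nat.prime_dvd_prime_iff_eq (Fact.out) Nat.prime_two).1 this
    subst h3
    exact absurd hp (by decide)
  have h := Equiv.sum_comp (Equiv.neg (ZMod p)) (fun b => b⁻¹)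
  simp only [Equiv.neg_apply, inv_neg, Finset.sum_neg_distrib] at h
  have h' : (2 : ZMod p) * ∑ b : ZMod p, b⁻¹ = 0 := by
    rw [two_mul]; nth_rewrite 1 [← h]; simp
  exact (mul_eq_zero.1 h').resolve_left h2

theorem nop_mul {R : ZMod p → Module.End (ZMod p) M} (hR : Rep R) (b : ZMod p) : nop R * R b = nop R := by
  unfold nop
  rw [Finset.sum_mul]
  simp only [← hR.add]
  exact Equiv.sum_comp (Equiv.addRight b) R

theorem mul_nop {R : ZMod p → Module.End (ZMod p) M} (hR : Rep R) (b : ZMod p) : R b * nop R = nop R := by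
  unfold nop
  rw [Finset.mul_sum]
  simp only [← hR.add]
  exact Equiv.sum_comp (Equiv.addLeft b) R

include hp in
theorem nop_xop {R : ZMod p → Module.End (ZMod p) M} (hR : Rep R) : nop R * xop R = 0 := by
  unfold xop
  rw [Finset.mul_sum]
  simp only [mul_smul_comm, nop_mul hR]
  rw [← Finset.sum_smul, sum_inv hp, zero_smul]

include hp in
theorem xop_nop {R : ZMod p → Module.End (ZMod p) M} (hR : Rep R) : xop R * nop R = 0 := by
  unfold xop
  rw [Finset.sum_mul]
  simp only [smul_mul_assoc, mul_nop hR]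
  rw [← Finset.sum_smul, sum_inv hp, zero_smul]

include hp in
theorem op_op {R : ZMod p → Module.End (ZMod p) M} (hR : Rep R) (j : ℕ) : op R (j+1) * op R j = 0 := by
  unfold op
  by_cases h : Even j
  · rw [if_neg (by simp [Nat.even_add_one, h]), if_pos h, nop_xop hp hR]
  · rw [if_pos (by simp [Nat.even_add_one, h]), if_neg h, xop_nop hp hR]

theorem Rep.pow {R : ZMod p → Module.End (ZMod p) M} (hR : Rep R) (k : ℕ) : R (k : ZMod p) = R 1 ^ k := by
  induction k with
  | zero => simp [hR.zero]
  | succ k ih => rw [Nat.cast_succ, hR.add, ih, pow_succ]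

theorem op_nat {R : ZMod p → Module.End (ZMod p) M} {R' : ZMod p → Module.End (ZMod p) M'} (f : M →ₗ[ZMod p] M')
    (h : ∀ b m, f (R b m) = R' b (f m)) (j : ℕ) (m : M) : f (op R j m) = op R' j (f m) := by
  unfold op
  split_ifs
  · simp [xop, LinearMap.sum_apply, map_sum, h]
  · simp [nop, LinearMap.sum_apply, map_sum, h]

open Polynomial in
include hp in
theorem exists_v : ∃ v : (ZMod p)[X], ∀ (M : Type) [AddCommGroup M] [Module (ZMod p) M] (R : ZMod p → Module.End (ZMod p) M),
    Rep R → xop R = (R 1 - 1) * (-1 + (R 1 - 1) * aeval (R 1) v) := by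
  set P : (ZMod p)[X] := ∑ b : ZMod p, C (b⁻¹) * X ^ (b.val) with hP
  have h1 : P.eval 1 = 0 := by
    rw [hP, eval_finset_sum]; simp [sum_inv hp]
  have h2 : (derivative P).eval 1 = -1 := by
    rw [hP, derivative_sum, eval_finset_sum]
    have : ∀ b : ZMod p, eval 1 (derivative (C b⁻¹ * X ^ b.val)) = if b = 0 then 0 else 1 := by
      intro b
      split_ifs with h
      · simp [h]
      · rw [derivative_C_mul, derivative_X_pow]; simp [h]
    rw [Finset.sum_congr rfl (fun b _ => this b)]
    rw [Finset.sum_ite]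
    simp [Finset.filter_ne']
    rw [Nat.cast_sub (Fact.out : p.Prime).one_le]; simp
  obtain ⟨w, hw⟩ : (X - C 1) ∣ P := dvd_iff_isRoot.2 h1
  have hw1 : w.eval 1 = -1 := by
    rw [hw] at h2; simpa using h2
  obtain ⟨v, hv⟩ : (X - C 1) ∣ w + 1 := dvd_iff_isRoot.2 (by simp [hw1])
  refine ⟨v, fun M _ _ R hR => ?_⟩
  have e : xop R = aeval (R 1) P := by
    rw [hP, map_sum]
    unfold xop
    refine Finset.sum_congr rfl fun b _ => ?_
    rw [map_mul, aeval_C, map_pow, aeval_X, ← hR.pow, ZMod.natCast_val, ZMod.cast_id, Algebra.smul_def]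
  have hw' : w = -1 + (X - C 1) * v := by rw [← hv]; ring
  rw [e, hw, hw']
  simp

end rep

section chains
variable {p : ℕ} [Fact p.Prime] (hp : Odd p) {V : Type} [Group V]

noncomputable def act (p : ℕ) [Fact p.Prime] (v : V) (n : ℕ) : Module.End (ZMod p) (Qc (ZMod p) V n) := mp (ZMod p) (v * ·) n

theorem act_mul (v w : V) (n : ℕ) : act p (v * w) n = act p v n * act p w n := by
  unfold act
  refine Finsupp.lhom_ext' fun y => LinearMap.ext_ring ?_
  simp [mul_assoc]

theorem act_one (n : ℕ) : act p (1 : V) n = 1 := by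
  unfold act
  refine Finsupp.lhom_ext' fun y => LinearMap.ext_ring ?_
  simp

theorem act_pow (v : V) (n k : ℕ) : act p (v ^ k) n = act p v n ^ k := by
  induction k with
  | zero => simp [act_one]
  | succ k ih => rw [pow_succ, act_mul, ih, pow_succ]

theorem act_bd (v : V) (n : ℕ) (z : Qc (ZMod p) V (n+1)) : bd (ZMod p) n (act p v (n+1) z) = act p v n (bd (ZMod p) n z) :=
  mp_bd _ _ _

structure Setup (p : ℕ) [Fact p.Prime] (V : Type) [Group V] where
  τ : ZMod p → V
  τ0 : τ 0 = 1
  τadd : ∀ a b, τ (a + b) = τ a * τ b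
  u : V
  a : ZMod p
  a0 : a ≠ 0
  ha : ∀ k, 0 < k → k < p - 1 → a ^ k ≠ 1
  hu : ∀ b, u * τ b = τ (a * b) * u
  upow : u ^ (p - 1) = 1
  dst : V → V → ℝ
  dself : ∀ x, dst x x = 0
  dsymm : ∀ x y, dst x y = dst y x
  dtri : ∀ x y z, dst x z ≤ dst x y + dst y z
  dl : ∀ v x y, dst (v * x) (v * y) = dst x y
  dr : ∀ v x y, dst (x * v) (y * v) = dst x y
  reach : ∀ ε > 0, Relation.ReflTransGen (fun x y => dst x y < ε) 1 u

variable (S : Setup p V)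

noncomputable def Setup.R (n : ℕ) (b : ZMod p) : Module.End (ZMod p) (Qc (ZMod p) V n) := act p (S.τ b) n

theorem Setup.rep (n : ℕ) : Rep (S.R n) := ⟨by unfold Setup.R; rw [S.τ0, act_one], fun a b => by unfold Setup.R; rw [S.τadd, act_mul]⟩

noncomputable def Setup.c0 : Qc (ZMod p) V 0 := ∑ i ∈ range (p - 1), act p (S.u ^ i) 0 (Finsupp.single (fun _ => 1) 1)

inductive Ch (S : Setup p V) : (j : ℕ) → Qc (ZMod p) V j → Prop
  | zero : Ch S 0 S.c0
  | succ (j : ℕ) (c : Qc (ZMod p) V j) (c' : Qc (ZMod p) V (j+1)) : Ch S j c → bd (ZMod p) j c' = op (S.R j) j c → Ch S (j+1) c'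

def Setup.smc (ε : ℝ) (n : ℕ) : Set ((Fin n → Bool) → V) := {y | ∀ t t', S.dst (y t) (y t') < ε}

noncomputable def Setup.Sm (ε : ℝ) (n : ℕ) : Submodule (ZMod p) (Qc (ZMod p) V n) := Finsupp.supported (ZMod p) (ZMod p) (S.smc ε n)

theorem act_Sm {ε : ℝ} {n : ℕ} {z : Qc (ZMod p) V n} (hz : z ∈ S.Sm ε n) (v : V) : act p v n z ∈ S.Sm ε n := by
  classical
  unfold Setup.Sm at *
  rw [Finsupp.mem_supported] at *
  intro y hy
  have := Finsupp.mapDomain_support (Finset.mem_coe.1 hy)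
  rw [Finset.mem_image] at this
  obtain ⟨x, hx, rfl⟩ := this
  intro t t'
  rw [S.dl]
  exact hz hx t t'

theorem prism_Sm {ε : ℝ} {n : ℕ} {z : Qc (ZMod p) V n} (hz : z ∈ S.Sm (ε/2) n) (v w : V) (h : S.dst v w < ε/2) :
    prism (ZMod p) v w n z ∈ S.Sm ε (n+1) := by
  classical
  unfold Setup.Sm at *
  rw [Finsupp.mem_supported] at *
  intro y hy
  have := Finsupp.mapDomain_support (Finset.mem_coe.1 hy)
  rw [Finset.mem_image] at this
  obtain ⟨x, hx, rfl⟩ := this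
  have hx' := hz hx
  have h0 : 0 < ε / 2 := by have := hx' default default; rw [S.dself] at this; exact this
  have key : ∀ t t', S.dst (v * x t) (w * x t') < ε := by
    intro t t'
    have h1 := S.dtri (v * x t) (v * x t') (w * x t')
    rw [S.dl, S.dr] at h1
    have := hx' t t'
    linarith
  intro t t'
  dsimp only
  split_ifs
  · rw [S.dl]; have := hx' (Fin.tail t) (Fin.tail t'); linarith
  · rw [S.dsymm]; exact key _ _
  · exact key _ _
  · rw [S.dl]; have := hx' (Fin.tail t) (Fin.tail t'); linarith

theorem reach_bd {ε : ℝ} (hε : 0 < ε) {n : ℕ} {z : Qc (ZMod p) V n} (hz : z ∈ S.Sm (ε/2) n)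
    (hb : ∀ m (h : n = m + 1), bd (ZMod p) m (h ▸ z) = 0) (v : V)
    (hv : Relation.ReflTransGen (fun x y => S.dst x y < ε/2) 1 v) :
    ∃ w ∈ S.Sm ε (n+1), bd (ZMod p) n w = act p v n z - z := by
  induction hv with
  | refl => exact ⟨0, Submodule.zero_mem _, by simp [act_one]⟩
  | @tail v' v'' h1 h2 ih =>
    obtain ⟨w, hw, hw'⟩ := ih
    refine ⟨w + prism (ZMod p) v' v'' n z, Submodule.add_mem _ hw (prism_Sm S hz _ _ h2), ?_⟩
    rw [map_add, hw']
    cases n with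
    | zero => rw [bd_prism0]; unfold act; abel
    | succ m =>
      have := hb m rfl
      simp only at this
      rw [bd_prism, this, map_zero]; unfold act; abel

theorem op_Sm {ε : ℝ} {n : ℕ} {z : Qc (ZMod p) V n} (hz : z ∈ S.Sm ε n) (j : ℕ) : op (S.R n) j z ∈ S.Sm ε n := by
  unfold op xop nop
  split_ifs
  · simp only [LinearMap.sum_apply, LinearMap.smul_apply]
    exact Submodule.sum_mem _ fun b _ => Submodule.smul_mem _ _ (act_Sm S hz _)
  · simp only [LinearMap.sum_apply]
    exact Submodule.sum_mem _ fun b _ => act_Sm S hz _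

theorem op_u {n : ℕ} (j : ℕ) (z : Qc (ZMod p) V n) {e : ℕ} (hz : act p S.u n z = S.a ^ ((j+1)/2) • z) :
    act p S.u n (op (S.R n) j z) = S.a ^ (j/2+1) • op (S.R n) j z := by
  have hh : ∀ b, act p S.u n (S.R n b z) = S.R n (S.a * b) (act p S.u n z) := by
    intro b
    unfold Setup.R
    rw [← Module.End.mul_apply, ← act_mul, S.hu, act_mul, Module.End.mul_apply]
  unfold op
  have hbij : Function.Bijective (fun b => S.a * b) := mulLeft_bijective₀ _ S.a0
  split_ifs with h
  · simp only [xop, LinearMap.sum_apply, LinearMap.smul_apply, map_sum, map_smul, hh, hz]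
    rw [Finset.smul_sum, ← Function.Bijective.sum_comp hbij (fun b => S.a ^ (j/2+1) • b⁻¹ • (S.R n b) z)]
    refine Finset.sum_congr rfl fun b _ => ?_
    simp only [smul_smul]
    congr 1
    have : (j + 1)/2 = j/2 := by obtain ⟨k, rfl⟩ := h; omega
    rw [this, mul_inv, pow_succ, mul_comm]
    have := S.a0
    field_simp
  · simp only [nop, LinearMap.sum_apply, map_sum, map_smul, hh, hz]
    rw [Finset.smul_sum, ← Function.Bijective.sum_comp hbij (fun b => S.a ^ (j/2+1) • (S.R n b) z)]
    have : (j + 1)/2 = j/2+1 := by rw [Nat.not_even_iff_odd] at h; obtain ⟨k, rfl⟩ := h; omega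
    rw [this]

include hp in
theorem exists_Ch (j : ℕ) (hj : j ≤ p - 1) : ∀ ε > 0, ∃ c ∈ S.Sm ε j, Ch S j c ∧ act p S.u j c = S.a ^ ((j+1)/2) • c := by
  induction j with
  | zero =>
    intro ε hε
    refine ⟨S.c0, ?_, Ch.zero, ?_⟩
    · refine Submodule.sum_mem _ fun i _ => act_Sm S ?_ _
      exact Finsupp.single_mem_supported _ _ (fun t t' => by simpa [S.dself] using hε)
    · simp only [zero_add, Nat.reduceDiv, pow_zero, one_smul]
      unfold Setup.c0
      rw [map_sum]
      simp only [← Module.End.mul_apply, ← act_mul, ← pow_succ']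
      have h1 := Finset.sum_range_succ (fun i => act p (S.u ^ i) 0 (Finsupp.single (fun _ => 1) 1)) (p - 1)
      rw [Finset.sum_range_succ', S.upow, pow_zero] at h1
      exact add_right_cancel h1
  | succ j ih =>
    intro ε hε
    obtain ⟨c, hc1, hc2, hc3⟩ := ih (by omega) (ε/2) (by linarith)
    set z := op (S.R j) j c with hz
    have hzs : z ∈ S.Sm (ε/2) j := op_Sm S hc1 j
    have hzu : act p S.u j z = S.a ^ (j/2+1) • z := op_u S (e := 0) j c hc3
    have hzb : ∀ m (h : j = m + 1), bd (ZMod p) m (h ▸ z) = 0 := by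
      rintro m rfl
      simp only
      obtain ⟨c_, hc_⟩ : ∃ c_, bd (ZMod p) m c = op (S.R m) m c_ := by
        cases hc2 with
        | succ _ c_ _ h1 h2 => exact ⟨c_, h2⟩
      rw [hz, op_nat (R := S.R (m+1)) (R' := S.R m) (bd (ZMod p) m) (fun b m => act_bd _ _ _), hc_, ← Module.End.mul_apply, op_op hp (S.rep m)]
      rfl
    obtain ⟨w, hw, hwb⟩ := reach_bd S hε hzs hzb S.u (S.reach _ (by linarith))
    set χ := S.a ^ (j/2+1) with hχ
    have hχ1 : χ ≠ 1 := S.ha _ (by omega) (by obtain ⟨q, rfl⟩ := hp; have := (Fact.out : (2*q+1).Prime).two_le; omega)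
    have hχ0 : χ ≠ 0 := pow_ne_zero _ S.a0
    have hχp : χ ^ (p-1) = 1 := ZMod.pow_card_sub_one_eq_one hχ0
    have hp1 : ((p - 1 : ℕ) : ZMod p) ≠ 0 := by
      rw [Ne, ZMod.natCast_eq_zero_iff]
      intro h
      exact absurd (Nat.le_of_dvd (by omega) h) (by have := (Fact.out : p.Prime).two_le; omega)
    rw [hzu] at hwb
    have hwb' : bd (ZMod p) j w = (χ - 1) • z := by rw [hwb, sub_smul, one_smul]
    have hχ' : χ - 1 ≠ 0 := sub_ne_zero.2 hχ1
    let f : ℕ → Qc (ZMod p) V (j+1) := fun i => (χ⁻¹)^i • act p (S.u ^ i) (j+1) w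
    have hf : ∀ i, act p S.u (j+1) (f i) = χ • f (i+1) := by
      intro i
      simp only [f]
      rw [map_smul, ← Module.End.mul_apply, ← act_mul, ← pow_succ', smul_smul]
      congr 1
      rw [pow_succ]; field_simp
    have hzi : ∀ i, act p (S.u ^ i) j z = χ ^ i • z := by
      intro i
      induction i with
      | zero => simp [act_one]
      | succ i ih => rw [pow_succ', act_mul, Module.End.mul_apply, ih, map_smul, hzu, smul_smul, pow_succ]
    refine ⟨((p-1:ℕ) : ZMod p)⁻¹ • (χ - 1)⁻¹ • ∑ i ∈ range (p-1), f i, ?_, ?_, ?_⟩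
    · exact Submodule.smul_mem _ _ (Submodule.smul_mem _ _ (Submodule.sum_mem _ fun i _ => Submodule.smul_mem _ _ (act_Sm S hw _)))
    · refine Ch.succ j c _ hc2 ?_
      rw [map_smul, map_smul, map_sum]
      have : ∀ i ∈ range (p-1), bd (ZMod p) j (f i) = (χ - 1) • z := by
        intro i _
        simp only [f]
        rw [map_smul, act_bd, hwb', map_smul, hzi, smul_smul, smul_smul]
        congr 1
        rw [mul_right_comm, ← mul_pow, inv_mul_cancel₀ hχ0, one_pow, one_mul]
      rw [Finset.sum_congr rfl this, Finset.sum_const, card_range, ← Nat.cast_smul_eq_nsmul (ZMod p), smul_smul, smul_smul, smul_smul]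
      rw [show ((p-1:ℕ) : ZMod p)⁻¹ * (χ - 1)⁻¹ * ((p-1:ℕ) : ZMod p) * (χ - 1) = 1 by field_simp, one_smul]
    · rw [map_smul, map_smul, map_sum, Finset.sum_congr rfl (fun i _ => hf i), ← Finset.smul_sum]
      have h1 := Finset.sum_range_succ f (p - 1)
      have h2 : f (p-1) = f 0 := by
        simp only [f, inv_pow, hχp, S.upow]; simp
      rw [Finset.sum_range_succ', h2] at h1
      rw [add_right_cancel h1, show (j + 1 + 1)/2 = j/2+1 by omega, ← hχ]
      simp only [smul_smul]
      congr 1; ring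
end chains
end Crs

set_option linter.all false
namespace Crs
open Finset

section Yb
variable {A : Type} [Ring A]

def Yb : (n : ℕ) → ((Fin n → Bool) → A) → A
  | 0, E => E base
  | n+1, E => E base * ∑ s : Fin (n+1), (-1 : ℤ)^(s : ℕ) • (Yb n (bf s true E) - Yb n (bf s false E))

variable {F : Type} [Field F] {V Λ : Type}

noncomputable def YL (ℓ : V → Λ) (n : ℕ) : Qc F V n →ₗ[F] EA F Λ :=
  Finsupp.linearCombination F (fun y => Yb n (fun t => g F (ℓ (y t))))

theorem YL_single (ℓ : V → Λ) {n : ℕ} (y : (Fin n → Bool) → V) :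
    YL ℓ n (Finsupp.single y (1:F)) = Yb n (fun t => g F (ℓ (y t))) := by simp [YL]

theorem YL_bd1 (ℓ : V → Λ) {n : ℕ} (y : (Fin (n+1) → Bool) → V) :
    Yb (n+1) (fun t => g F (ℓ (y t))) = g F (ℓ (y base)) * YL ℓ n (bd1 F y) := by
  rw [Yb]
  unfold bd1
  simp only [map_sum, map_zsmul, map_sub, YL_single]
  rfl

noncomputable abbrev io (F : Type) [Field F] (Λ : Type) : EA F Λ →ₗ[F] EA F Λ := cont (fun _ => (1 : F))

theorem io_g_mul (x : Λ) (a : EA F Λ) : io F Λ (g F x * a) = a - g F x * io F Λ a := by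
  rw [cont_g_mul, one_smul]

theorem io_g (x : Λ) : io F Λ (g F x) = 1 := by
  rw [cont_g]; simp

theorem io_YL (ℓ : V → Λ) {n : ℕ} (c : Qc F V (n+1)) : io F Λ (YL ℓ (n+1) c) = YL ℓ n (bd F n c) := by
  suffices h : io F Λ ∘ₗ YL ℓ (n+1) = YL ℓ n ∘ₗ bd F n from LinearMap.congr_fun h c
  refine Finsupp.lhom_ext' fun y => LinearMap.ext_ring ?_
  simp only [LinearMap.comp_apply, Finsupp.lsingle_apply, bd_single, YL_single, YL_bd1, io_g_mul]
  have : io F Λ (YL ℓ n (bd1 F y)) = 0 := by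
    cases n with
    | zero =>
      have : io F Λ ∘ₗ YL ℓ 0 = Finsupp.linearCombination F (fun _ : (Fin 0 → Bool) → V => (1 : EA F Λ)) := by
        refine Finsupp.lhom_ext' fun y => LinearMap.ext_ring ?_
        simp only [LinearMap.comp_apply, Finsupp.lsingle_apply, YL_single, Yb, io_g]
        simp
      rw [← LinearMap.comp_apply, this]
      simp [bd1]
    | succ n => rw [io_YL ℓ (bd1 F y), bd_bd1, map_zero]
  rw [this, mul_zero, sub_zero]

theorem YL_mem (ℓ : V → Λ) {n : ℕ} (c : Qc F V n) : YL ℓ n c ∈ Gr F Set.univ (n+1) := by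
  unfold YL
  rw [Finsupp.linearCombination_apply]
  refine Submodule.sum_mem _ fun y _ => Submodule.smul_mem _ _ ?_
  cases n with
  | zero => exact g_mem_Gr trivial
  | succ n =>
    rw [YL_bd1]
    exact g_mul_mem_Gr trivial (YL_mem ℓ _)

theorem YL_mp (ℓ : V → Λ) (f : V → V) (σ : Λ → Λ) (h : ∀ v, ℓ (f v) = σ (ℓ v)) {n : ℕ} (c : Qc F V n) :
    YL ℓ n (mp F f n c) = mapE σ (YL ℓ n c) := by
  suffices h : YL ℓ n ∘ₗ mp F f n = (mapE σ).toLinearMap ∘ₗ YL ℓ n from LinearMap.congr_fun h c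
  refine Finsupp.lhom_ext' fun y => LinearMap.ext_ring ?_
  simp only [LinearMap.comp_apply, Finsupp.lsingle_apply, mp_single, YL_single, AlgHom.toLinearMap_apply]
  cases n with
  | zero => simp [Yb, h]
  | succ n =>
    rw [YL_bd1 ℓ y, YL_bd1 ℓ (fun t => f (y t)), map_mul, mapE_g, ← YL_mp ℓ f σ h, h, ← bd_single, ← bd_single, ← mp_bd, mp_single]

theorem io_mapE (f : Λ → Λ) (a : EA F Λ) : io F Λ (mapE f a) = mapE f (io F Λ a) := by
  refine CliffordAlgebra.left_induction (Q := (0 : QuadraticForm F (Λ →₀ F)))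
    (P := fun a => io F Λ (mapE f a) = mapE f (io F Λ a)) ?_ ?_ ?_ a
  · intro r
    have e : (algebraMap F (CliffordAlgebra (0 : QuadraticForm F (Λ →₀ F))) r) = r • (1 : EA F Λ) := Algebra.algebraMap_eq_smul_one r
    rw [e]
    simp only [map_smul, map_one, cont_one, map_zero, smul_zero]
  · intro x y hx hy
    have e : ∀ x y : EA F Λ, io F Λ (mapE f (x + y)) = io F Λ (mapE f x) + io F Λ (mapE f y) := fun x y => by rw [map_add, map_add]
    have e' : ∀ x y : EA F Λ, mapE f (io F Λ (x + y)) = mapE f (io F Λ x) + mapE f (io F Λ y) := fun x y => by rw [map_add, map_add]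
    exact (e x y).trans ((congrArg₂ (· + ·) hx hy).trans (e' x y).symm)
  · intro x m hx
    have key : ∀ m : Λ →₀ F, ∀ x : EA F Λ, io F Λ (mapE f x) = mapE f (io F Λ x) →
        io F Λ (mapE f (ExteriorAlgebra.ι F m * x)) = mapE f (io F Λ (ExteriorAlgebra.ι F m * x)) := by
      intro m x hx
      induction m using Finsupp.induction_linear with
      | zero => simp
      | add a b ha hb => simp only [map_add, add_mul, ha, hb]
      | single a b =>
        have : ExteriorAlgebra.ι F (Finsupp.single a b) = b • g F a := by
          rw [g, ← map_smul]; simp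
        rw [this, smul_mul_assoc, map_smul, map_smul, map_smul, map_smul, map_mul, mapE_g, io_g_mul, io_g_mul, map_sub, map_mul, mapE_g, hx]
    exact key m x hx

theorem acyc (x : Λ) {a : EA F Λ} (h : io F Λ a = 0) : io F Λ (g F x * a) = a := by
  rw [io_g_mul, h, mul_zero, sub_zero]
end Yb

section eta
variable {p : ℕ} [Fact p.Prime] (hp : Odd p)

local notation "𝔽" => ZMod p
local notation "e" => g (ZMod p) (X := ZMod p)

noncomputable def RE (p : ℕ) [Fact p.Prime] (b : ZMod p) : Module.End (ZMod p) (EA (ZMod p) (ZMod p)) :=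
  (mapE (fun x => b + x)).toLinearMap

theorem RE_rep : Rep (RE p) := by
  constructor
  · refine LinearMap.ext fun a => ?_
    have : (fun x : ZMod p => 0 + x) = id := by funext x; simp
    simp only [RE, AlgHom.toLinearMap_apply, this, mapE_id]; rfl
  · intro a b
    refine LinearMap.ext fun x => ?_
    simp only [RE, AlgHom.toLinearMap_apply, Module.End.mul_apply, mapE_mapE]
    have : (fun x : ZMod p => a + b + x) = (fun x => a + x) ∘ (fun x => b + x) := by funext y; simp [add_assoc]
    rw [this]

noncomputable def eta (p : ℕ) [Fact p.Prime] : EA (ZMod p) (ZMod p) := ∑ b : ZMod p, g (ZMod p) b * g (ZMod p) (b + 1)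

theorem io_eta (a : EA 𝔽 𝔽) : io 𝔽 𝔽 (eta p * a) = eta p * io 𝔽 𝔽 a := by
  have h : ∀ b : 𝔽, io 𝔽 𝔽 (e b * e (b+1) * a) = (e (b+1) * a - e b * a) + e b * e (b+1) * io 𝔽 𝔽 a := by
    intro b
    rw [mul_assoc, io_g_mul, io_g_mul, mul_sub, mul_assoc]; abel
  unfold eta
  rw [Finset.sum_mul, map_sum, Finset.sum_congr rfl (fun b _ => h b), Finset.sum_add_distrib, Finset.sum_sub_distrib, Finset.sum_mul]
  have := Equiv.sum_comp (Equiv.addRight (1:𝔽)) (fun b => e b * a)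
  simp only [Equiv.coe_addRight] at this
  rw [this, sub_self, zero_add]

theorem RE_eta (b : 𝔽) (a : EA 𝔽 𝔽) : RE p b (eta p * a) = eta p * RE p b a := by
  have h : RE p b (eta p) = eta p := by
    unfold eta RE
    simp only [map_sum, AlgHom.toLinearMap_apply, map_mul, mapE_g]
    rw [← Equiv.sum_comp (Equiv.addLeft b) (fun x => e x * e (x+1))]
    simp [add_assoc]
  have : RE p b (eta p * a) = RE p b (eta p) * RE p b a := by simp only [RE, AlgHom.toLinearMap_apply, map_mul]
  rw [this, h]

theorem eta_mem : eta p ∈ Gr 𝔽 Set.univ 2 :=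
  Submodule.sum_mem _ fun b _ => mul_mem_Gr (k := 1) (m := 1) (g_mem_Gr trivial) (g_mem_Gr trivial)

theorem io_eta_pow (i : ℕ) (a : EA 𝔽 𝔽) : io 𝔽 𝔽 (eta p ^ i * a) = eta p ^ i * io 𝔽 𝔽 a := by
  induction i with
  | zero => simp
  | succ i ih => rw [pow_succ', mul_assoc, io_eta, ih, mul_assoc]

theorem RE_eta_pow (b : 𝔽) (i : ℕ) (a : EA 𝔽 𝔽) : RE p b (eta p ^ i * a) = eta p ^ i * RE p b a := by
  induction i with
  | zero => simp
  | succ i ih => rw [pow_succ', mul_assoc, RE_eta, ih, mul_assoc]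

theorem pow_mem_Gr {X : Type} {F : Type} [Field F] {s : Set X} {a : EA F X} {k : ℕ} (h : a ∈ Gr F s k) (i : ℕ) : a ^ i ∈ Gr F s (k * i) := by
  induction i with
  | zero => simpa using one_mem_Gr s
  | succ i ih => rw [pow_succ, mul_add, mul_one]; exact mul_mem_Gr ih h

theorem RE_mem {k : ℕ} (b : 𝔽) {a : EA 𝔽 𝔽} (h : a ∈ Gr 𝔽 Set.univ k) : RE p b a ∈ Gr 𝔽 Set.univ k :=
  Gr_mono (Set.subset_univ _) _ (mapE_mem_Gr _ h)

theorem xop_mem {k : ℕ} {a : EA 𝔽 𝔽} (h : a ∈ Gr 𝔽 Set.univ k) : xop (RE p) a ∈ Gr 𝔽 Set.univ k := by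
  unfold xop
  simp only [LinearMap.sum_apply, LinearMap.smul_apply]
  exact Submodule.sum_mem _ fun b _ => Submodule.smul_mem _ _ (RE_mem b h)

theorem nop_mem {k : ℕ} {a : EA 𝔽 𝔽} (h : a ∈ Gr 𝔽 Set.univ k) : nop (RE p) a ∈ Gr 𝔽 Set.univ k := by
  unfold nop
  simp only [LinearMap.sum_apply]
  exact Submodule.sum_mem _ fun b _ => (RE_mem b h)

open Polynomial in
theorem aeval_mem {k : ℕ} {a : EA 𝔽 𝔽} (h : a ∈ Gr 𝔽 Set.univ k) (v : 𝔽[X]) : aeval (RE p 1) v a ∈ Gr 𝔽 Set.univ k := by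
  rw [aeval_eq_sum_range]
  simp only [LinearMap.sum_apply, LinearMap.smul_apply]
  refine Submodule.sum_mem _ fun i _ => Submodule.smul_mem _ _ ?_
  rw [← RE_rep.pow]
  exact RE_mem _ h

theorem io_RE (b : 𝔽) (a : EA 𝔽 𝔽) : io 𝔽 𝔽 (RE p b a) = RE p b (io 𝔽 𝔽 a) := io_mapE _ _

open Polynomial in
theorem io_aeval (v : 𝔽[X]) (a : EA 𝔽 𝔽) : io 𝔽 𝔽 (aeval (RE p 1) v a) = aeval (RE p 1) v (io 𝔽 𝔽 a) := by
  rw [aeval_eq_sum_range]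
  simp only [LinearMap.sum_apply, LinearMap.smul_apply, map_sum, map_smul, ← RE_rep.pow, io_RE]

variable {V : Type} [Group V] (S : Setup p V) (ℓ : V → ZMod p) (hℓ : ∀ b v, ℓ (S.τ b * v) = b + ℓ v)

include hp hℓ in
theorem YL_Ch {j : ℕ} {c : Qc 𝔽 V j} (h : Ch S j c) : ∃ (δ : 𝔽) (gg hh : EA 𝔽 𝔽), δ ≠ 0 ∧ gg ∈ Gr 𝔽 Set.univ (j+1) ∧
    hh ∈ Gr 𝔽 Set.univ (j+2) ∧ YL ℓ j c = (if Even j then δ • (eta p ^ (j/2) * e 0) + nop (RE p) gg + io 𝔽 𝔽 hh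
      else δ • (eta p ^ (j/2) * (e 0 * e 1)) + (RE p 1 gg - gg) + io 𝔽 𝔽 hh) := by
  induction h with
  | zero =>
    refine ⟨-1, 0, e 0 * (YL ℓ 0 S.c0 + e 0), neg_ne_zero.2 one_ne_zero, Submodule.zero_mem _, ?_, ?_⟩
    · exact g_mul_mem_Gr trivial (Submodule.add_mem _ (YL_mem _ _) (g_mem_Gr trivial))
    · rw [if_pos (by simp), acyc]
      · simp
      · rw [map_add, io_g]
        unfold Setup.c0
        have : ∀ i, io 𝔽 𝔽 (YL ℓ 0 (act p (S.u ^ i) 0 (Finsupp.single (fun _ => 1) 1))) = 1 := by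
          intro i
          rw [act, mp_single, YL_single, Yb, io_g]
        rw [map_sum, map_sum, Finset.sum_congr rfl (fun i _ => this i), Finset.sum_const, card_range, ← Nat.cast_smul_eq_nsmul 𝔽,
          Nat.cast_sub (Fact.out : p.Prime).one_le]
        simp
  | succ j c c' hc hb ih =>
    obtain ⟨δ, gg, hh, h1, h2, h3, h4⟩ := ih
    have hY : io 𝔽 𝔽 (YL ℓ (j+1) c') = op (RE p) j (YL ℓ j c) := by
      rw [io_YL, hb]
      exact op_nat _ (fun b m => YL_mp ℓ _ _ (hℓ b) m) j c
    by_cases hj : Even j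
    · obtain ⟨v, hv⟩ := exists_v hp
      have hx := hv _ (RE p) RE_rep
      have hj' : ¬ Even (j+1) := by simp [Nat.even_add_one, hj]
      rw [if_pos hj] at h4
      simp only [if_neg hj']
      obtain ⟨i, hi⟩ : ∃ i, j = 2 * i := by obtain ⟨i, rfl⟩ := hj; exact ⟨i, by ring⟩
      have hi1 : j / 2 = i := by omega
      have hi2 : (j+1)/2 = i := by omega
      rw [hi1] at h4
      rw [hi2]
      set m := eta p ^ i * (e 0 * e 1) with hm
      have hmm : m ∈ Gr 𝔽 Set.univ (j+2) := by
        have := mul_mem_Gr (pow_mem_Gr (eta_mem (p := p)) i) (mul_mem_Gr (k := 1) (m := 1) (g_mem_Gr (F := 𝔽) (x := (0:𝔽)) trivial) (g_mem_Gr (F := 𝔽) (x := (1:𝔽)) trivial))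
        rw [hi]; exact this
      set w : EA 𝔽 𝔽 := δ • Polynomial.aeval (RE p 1) v m + (-hh + (RE p 1 (Polynomial.aeval (RE p 1) v hh) - Polynomial.aeval (RE p 1) v hh)) with hw
      have hwm : w ∈ Gr 𝔽 Set.univ (j+2) := by
        have ha := aeval_mem h3 v
        exact Submodule.add_mem _ (Submodule.smul_mem _ _ (aeval_mem hmm v)) (Submodule.add_mem _ (Submodule.neg_mem _ h3) (Submodule.sub_mem _ (RE_mem _ ha) ha))
      have hk : io 𝔽 𝔽 (YL ℓ (j+1) c' - ((-δ) • m + (RE p 1 w - w))) = 0 := by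
        rw [map_sub, hY, h4, op, if_pos hj, map_add, map_add]
        rw [← Module.End.mul_apply (xop (RE p)) (nop (RE p)), xop_nop hp RE_rep, LinearMap.zero_apply, add_zero]
        have hio : ∀ a, io 𝔽 𝔽 (RE p 1 a - a) = RE p 1 (io 𝔽 𝔽 a) - io 𝔽 𝔽 a := fun a => by rw [map_sub, io_RE]
        have hmio : io 𝔽 𝔽 m = RE p 1 (eta p ^ i * e 0) - eta p ^ i * e 0 := by
          rw [hm, io_eta_pow, RE_eta_pow, io_g_mul, io_g, mul_one, mul_sub]
          simp [RE]
        set n0 := eta p ^ i * e 0 with hn0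
        have hcomm : ∀ a, Polynomial.aeval (RE p 1) v (RE p 1 a) = RE p 1 (Polynomial.aeval (RE p 1) v a) := by
          intro a
          have : Commute (Polynomial.aeval (RE p 1) v) (RE p 1) := by
            have := Polynomial.aeval_X (R := 𝔽) (RE p 1)
            nth_rewrite 2 [← this]
            exact (Commute.all v Polynomial.X).map (Polynomial.aeval (RE p 1))
          exact LinearMap.congr_fun this.eq a
        rw [hw]
        simp only [map_add, map_smul, map_sub, map_neg, io_RE, io_aeval, hmio, hcomm]
        have hx' : ∀ a, xop (RE p) a = -(RE p 1 a - a) + (RE p 1 (RE p 1 (Polynomial.aeval (RE p 1) v a) - Polynomial.aeval (RE p 1) v a) - (RE p 1 (Polynomial.aeval (RE p 1) v a) - Polynomial.aeval (RE p 1) v a)) := by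
          intro a
          rw [hx]
          simp only [Module.End.mul_apply, LinearMap.add_apply, LinearMap.sub_apply, LinearMap.neg_apply, Module.End.one_apply, map_add, map_sub, map_neg]
        rw [hx', hx']
        simp only [map_sub, smul_add, smul_sub, smul_neg, neg_smul]
        abel
      refine ⟨-δ, w, e 0 * (YL ℓ (j+1) c' - ((-δ) • m + (RE p 1 w - w))), neg_ne_zero.2 h1, hwm, ?_, ?_⟩
      · exact g_mul_mem_Gr trivial (Submodule.sub_mem _ (YL_mem _ _) (Submodule.add_mem _ (Submodule.smul_mem _ _ hmm) (Submodule.sub_mem _ (RE_mem _ hwm) hwm)))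
      · rw [acyc _ hk]; abel
    · have hj' : Even (j+1) := by simp [Nat.even_add_one, hj]
      rw [if_neg hj] at h4
      simp only [if_pos hj']
      obtain ⟨i, hi⟩ : ∃ i, j = 2 * i + 1 := by rw [Nat.not_even_iff_odd] at hj; exact hj
      have hi1 : j / 2 = i := by omega
      have hi2 : (j+1)/2 = i + 1 := by omega
      rw [hi1] at h4
      rw [hi2]
      have hmm : eta p ^ (i+1) * e 0 ∈ Gr 𝔽 Set.univ (j+2) := by
        have := mul_mem_Gr (pow_mem_Gr (eta_mem (p := p)) (i+1)) (g_mem_Gr (F := 𝔽) (x := (0:𝔽)) trivial)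
        rw [hi]; exact this
      have hk : io 𝔽 𝔽 (YL ℓ (j+1) c' - (δ • (eta p ^ (i+1) * e 0) + nop (RE p) hh)) = 0 := by
        rw [map_sub, hY, h4, op, if_neg hj]
        have hnio : ∀ a, io 𝔽 𝔽 (nop (RE p) a) = nop (RE p) (io 𝔽 𝔽 a) := by
          intro a
          simp [nop, LinearMap.sum_apply, map_sum, io_RE]
        have hn1 : nop (RE p) (RE p 1 gg) = nop (RE p) gg := LinearMap.congr_fun (nop_mul RE_rep 1) gg
        have hn2 : nop (RE p) (eta p ^ i * (e 0 * e 1)) = eta p ^ (i+1) := by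
          simp only [nop, LinearMap.sum_apply, RE_eta_pow, ← Finset.mul_sum]
          rw [pow_succ]
          congr 1
          unfold eta RE
          simp
        simp only [map_add, map_sub, map_smul, hnio, hn1, hn2, sub_self, io_eta_pow, io_g, mul_one]
        abel
      refine ⟨δ, hh, e 0 * (YL ℓ (j+1) c' - (δ • (eta p ^ (i+1) * e 0) + nop (RE p) hh)), h1, h3, ?_, ?_⟩
      · exact g_mul_mem_Gr trivial (Submodule.sub_mem _ (YL_mem _ _) (Submodule.add_mem _ (Submodule.smul_mem _ _ hmm) (nop_mem h3)))
      · rw [acyc _ hk]; abel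
end eta
end Crs

set_option linter.all false
namespace Crs
open Finset

section top
variable {p : ℕ} [Fact p.Prime] (hp : Odd p)

theorem Gr2_comm {X F : Type} [Field F] {s t : Set X} {k : ℕ} {a b : EA F X} (ha : a ∈ Gr F s 2) (hb : b ∈ Gr F t k) : a * b = b * a := by
  rw [mul_comm_Gr ha hb, pow_mul]; simp

theorem add_pow_sq_zero {A : Type} [Ring A] {q t : A} (h : q * t = t * q) (ht : t * t = 0) (n : ℕ) :
    (q + t) ^ (n+1) = q ^ (n+1) + (n+1 : ℕ) • (q ^ n * t) := by
  have hq : ∀ n, t * q ^ n = q ^ n * t := fun n => ((Commute.pow_left h n).eq).symm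
  induction n with
  | zero => simp
  | succ n ih =>
    rw [pow_succ', ih, add_mul, mul_add, mul_add, mul_smul_comm, mul_smul_comm, ← mul_assoc, ← mul_assoc, hq (n+1), hq n, mul_assoc _ t t, ht, mul_zero, smul_zero, add_zero, ← pow_succ', ← pow_succ']
    rw [add_assoc, ← succ_nsmul]

noncomputable def qk (p : ℕ) [Fact p.Prime] (k : ℕ) : EA (ZMod p) (ZMod p) := ∑ b ∈ range (2*k), g (ZMod p) (b : ZMod p) * g (ZMod p) ((b+1 : ℕ) : ZMod p)

noncomputable def lk (p : ℕ) (k : ℕ) : List (ZMod p) := (List.range k).map (fun i : ℕ => (i : ZMod p))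

theorem mon_mul_g_mem {X F : Type} [Field F] (l : List X) (x : X) (h : x ∈ l) : mon F l * g F x = 0 := by
  have : mon F l * g F x = mon F (l ++ [x]) := by rw [mon_append]; simp [mon]
  rw [this]
  apply mon_eq_zero
  intro hn
  rw [List.nodup_append] at hn
  exact hn.2.2 x h x (by simp) rfl

theorem qk_mem (k : ℕ) : qk p k ∈ Gr (ZMod p) ((fun i : ℕ => (i : ZMod p)) '' (Set.Iio (2*k+1))) 2 := by
  refine Submodule.sum_mem _ fun b hb => mul_mem_Gr (k := 1) (m := 1) (g_mem_Gr ?_) (g_mem_Gr ?_)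
  · rw [mem_range] at hb; exact ⟨b, by simp; omega, rfl⟩
  · rw [mem_range] at hb; exact ⟨b+1, by simp; omega, rfl⟩

theorem lk_succ (k : ℕ) : mon (ZMod p) (lk p (k+1)) = mon (ZMod p) (lk p k) * g (ZMod p) (k : ZMod p) := by
  unfold lk
  rw [List.range_succ, List.map_append, mon_append]
  simp [mon]

theorem qk_pow (k : ℕ) : qk p k ^ k * g (ZMod p) 0 = (k.factorial) • mon (ZMod p) (lk p (2*k+1)) := by
  induction k with
  | zero => simp [lk, mon]
  | succ k ih =>
    set t : EA (ZMod p) (ZMod p) := g (ZMod p) ((2*k : ℕ) : ZMod p) * g (ZMod p) ((2*k+1 : ℕ) : ZMod p) +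
      g (ZMod p) ((2*k+1 : ℕ) : ZMod p) * g (ZMod p) ((2*k+2 : ℕ) : ZMod p) with ht
    have htm : t ∈ Gr (ZMod p) Set.univ 2 := Submodule.add_mem _ (mul_mem_Gr (k := 1) (m := 1) (g_mem_Gr trivial) (g_mem_Gr trivial)) (mul_mem_Gr (k := 1) (m := 1) (g_mem_Gr trivial) (g_mem_Gr trivial))
    have hq : qk p (k+1) = qk p k + t := by
      unfold qk
      rw [show 2 * (k+1) = 2*k+1+1 by ring, sum_range_succ, sum_range_succ, ht, add_assoc]
    have htt : t * t = 0 := by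
      have e1 : t = (g (ZMod p) ((2*k : ℕ) : ZMod p) - g (ZMod p) ((2*k+2 : ℕ) : ZMod p)) * g (ZMod p) ((2*k+1 : ℕ) : ZMod p) := by
        rw [ht, sub_mul, g_anti ((2*k+1 : ℕ) : ZMod p)]; abel
      have e2 : t = - (g (ZMod p) ((2*k+1 : ℕ) : ZMod p) * (g (ZMod p) ((2*k : ℕ) : ZMod p) - g (ZMod p) ((2*k+2 : ℕ) : ZMod p))) := by
        rw [ht, mul_sub, g_anti ((2*k : ℕ) : ZMod p)]; abel
      nth_rewrite 1 [e1]
      rw [e2, mul_neg, mul_assoc, ← mul_assoc (g _ _) (g _ _), g_sq, zero_mul, mul_zero, neg_zero]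
    rw [hq, add_pow_sq_zero (Gr2_comm (qk_mem k) htm) htt, add_mul]
    have hz : qk p k ^ (k+1) * g (ZMod p) 0 = 0 := by
      have h1 : qk p k ^ (k+1) * g (ZMod p) 0 ∈ Gr (ZMod p) ((fun i : ℕ => (i : ZMod p)) '' (Set.Iio (2*k+1))) (2 * (k+1) + 1) :=
        mul_mem_Gr (pow_mem_Gr (qk_mem k) _) (g_mem_Gr ⟨0, by simp, by simp⟩)
      refine eq_zero_of_mem_Gr (Set.toFinite _) ?_ h1
      have := Set.ncard_image_le (f := fun i : ℕ => (i : ZMod p)) (Set.finite_Iio (2*k+1))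
      have h2 : (Set.Iio (2*k+1)).ncard = 2*k+1 := by
        rw [← Finset.coe_Iio, Set.ncard_coe_finset]; simp
      omega
    rw [hz, zero_add, smul_mul_assoc, mul_assoc, Gr2_comm htm (g_mem_Gr (s := Set.univ) trivial), ← mul_assoc, ih, smul_mul_assoc, smul_smul,
      ← Nat.factorial_succ]
    congr 1
    rw [ht, mul_add, ← mul_assoc, mon_mul_g_mem, zero_mul, zero_add, ← mul_assoc]
    · rw [show 2*(k+1)+1 = 2*k+1+1+1 by ring, lk_succ (2*k+1+1), lk_succ (2*k+1)]
    · unfold lk; rw [List.mem_map]; exact ⟨2*k, by simp, rfl⟩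

theorem sum_zmod {M : Type} [AddCommMonoid M] (f : ZMod p → M) : ∑ b, f b = ∑ i ∈ range p, f (i : ZMod p) := by
  symm
  refine Finset.sum_bij' (fun i _ => (i : ZMod p)) (fun b _ => b.val) ?_ ?_ ?_ ?_ ?_
  · simp
  · intro b _; simpa using ZMod.val_lt b
  · intro i hi; exact ZMod.val_cast_of_lt (by simpa using hi)
  · intro b _; simp
  · simp

theorem eta_eq {m : ℕ} (hm : p = 2 * m + 1) : eta p = qk p m + g (ZMod p) ((2*m : ℕ) : ZMod p) * g (ZMod p) 0 := by
  unfold eta qk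
  rw [sum_zmod]
  have h : ∀ f : ℕ → EA (ZMod p) (ZMod p), ∑ i ∈ range p, f i = ∑ i ∈ range (2*m), f i + f (2*m) := by
    intro f; rw [show range p = range (2*m+1) by rw [← hm], sum_range_succ]
  rw [h]
  have : ((2*m : ℕ) : ZMod p) + 1 = 0 := by
    have : ((2*m+1 : ℕ) : ZMod p) = 0 := by rw [← hm]; simp
    rw [← this]; push_cast; rfl
  rw [this]
  push_cast
  rfl

theorem eta_pow_e {m : ℕ} (hm : p = 2 * m + 1) (n : ℕ) : eta p ^ n * g (ZMod p) 0 = qk p m ^ n * g (ZMod p) 0 := by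
  induction n with
  | zero => simp
  | succ n ih =>
    rw [pow_succ', mul_assoc, ih, eta_eq hm, add_mul, ← mul_assoc, ← pow_succ']
    have h1 : qk p m ^ n * g (ZMod p) 0 ∈ Gr (ZMod p) ((fun i : ℕ => (i : ZMod p)) '' (Set.Iio (2*m+1))) (2 * n + 1) :=
        mul_mem_Gr (pow_mem_Gr (qk_mem m) _) (g_mem_Gr ⟨0, by simp, by simp⟩)
    rw [Gr2_comm (mul_mem_Gr (s := Set.univ) (k := 1) (m := 1) (g_mem_Gr trivial) (g_mem_Gr trivial)) h1]
    have : g (ZMod p) (0 : ZMod p) * (g (ZMod p) ((2*m : ℕ) : ZMod p) * g (ZMod p) 0) = 0 := by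
      rw [← Gr2_comm (mul_mem_Gr (s := Set.univ) (k := 1) (m := 1) (g_mem_Gr trivial) (g_mem_Gr trivial)) (g_mem_Gr (s := Set.univ) trivial),
        mul_assoc, g_sq, mul_zero]
    rw [mul_assoc (qk p m ^ n), this, mul_zero, add_zero]

theorem lk_nodup : (lk p p).Nodup := by
  unfold lk
  refine List.Nodup.map_on ?_ List.nodup_range
  intro x hx y hy h
  rw [List.mem_range] at hx hy
  have := congrArg ZMod.val h
  rwa [ZMod.val_cast_of_lt hx, ZMod.val_cast_of_lt hy] at this

include hp in
theorem sign_add (b : ZMod p) : Equiv.Perm.sign (Equiv.addLeft b) = 1 := by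
  have h1 : ∀ k : ℕ, (Equiv.addLeft b) ^ k = Equiv.addLeft (k • b) := by
    intro k
    induction k with
    | zero => ext x; simp
    | succ k ih => rw [pow_succ, ih]; ext x; simp [add_mul, add_assoc]
  have h2 : (Equiv.addLeft b) ^ p = 1 := by
    rw [h1]; ext x; simp
  have h3 := congrArg Equiv.Perm.sign h2
  rw [map_pow, map_one] at h3
  rcases Int.units_eq_one_or (Equiv.Perm.sign (Equiv.addLeft b)) with h | h
  · exact h
  · rw [h, hp.neg_one_pow] at h3
    exact absurd h3 (by decide)

variable {V : Type} [Group V] (S : Setup p V) (ℓ : V → ZMod p) (hℓ : ∀ b v, ℓ (S.τ b * v) = b + ℓ v)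

include hp hℓ in
theorem YL_top {c : Qc (ZMod p) V (p-1)} (h : Ch S (p-1) c) : ∃ δ : ZMod p, δ ≠ 0 ∧ YL ℓ (p-1) c = δ • mon (ZMod p) (lk p p) := by
  obtain ⟨δ, gg, hh, h1, h2, h3, h4⟩ := YL_Ch hp S ℓ hℓ h
  obtain ⟨m, hm⟩ := hp
  have hp1 : p - 1 = 2 * m := by omega
  rw [if_pos (by rw [hp1]; simp)] at h4
  have hz : hh = 0 := by
    refine eq_zero_of_mem_Gr (Set.toFinite _) ?_ h3
    rw [Set.ncard_univ, Nat.card_zmod]; omega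
  have hg : nop (RE p) gg = 0 := by
    have : ∀ b, RE p b gg = gg := by
      intro b
      have := mapE_perm (Equiv.addLeft b) (k := p - 1 + 1) (by rw [ZMod.card]; omega) h2
      rw [sign_add ⟨m, hm⟩] at this
      change mapE (fun x => b + x) gg = gg
      simpa using this
    simp only [nop, LinearMap.sum_apply, this, Finset.sum_const, card_univ, ZMod.card]
    rw [← Nat.cast_smul_eq_nsmul (ZMod p)]; simp
  rw [hz, hg, map_zero, add_zero, add_zero, eta_pow_e hm, show (p-1)/2 = m by omega, qk_pow, ← hm, ← Nat.cast_smul_eq_nsmul (ZMod p), smul_smul] at h4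
  refine ⟨_, ?_, h4⟩
  refine mul_ne_zero h1 ?_
  rw [Ne, ZMod.natCast_eq_zero_iff, (Fact.out : p.Prime).dvd_factorial]
  omega
end top

section conn
variable {A : Type} [Ring A]

theorem theta_sign {n : ℕ} (θ : Fin (n+1) → A) (hθ : ∀ s r, θ s * θ r = -(θ r * θ s)) (s : Fin (n+1)) :
    θ s * (List.ofFn (fun i => θ (s.succAbove i))).prod = (-1 : ℤ)^(s : ℕ) • (List.ofFn θ).prod := by
  induction n with
  | zero =>
    have : s = 0 := Fin.ext (by have := s.2; simp)
    subst this
    simp [List.ofFn_succ]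
  | succ n ih =>
    refine Fin.cases ?_ (fun s => ?_) s
    · simp [List.ofFn_succ]
    · rw [List.ofFn_succ, List.ofFn_succ, List.prod_cons, List.prod_cons]
      have e0 : s.succ.succAbove 0 = 0 := Fin.succ_succAbove_zero s
      simp only [e0, Fin.succ_succAbove_succ]
      have := ih (fun i => θ i.succ) (fun _ _ => hθ _ _) s
      rw [← mul_assoc, hθ, neg_mul, mul_assoc, this, Fin.val_succ, pow_succ, mul_smul_comm, mul_neg_one, neg_smul]

theorem face_eq {α : Type} {n : ℕ} (s : Fin (n+1)) (b : Bool) (E : (Fin (n+1) → Bool) → α) :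
    face s b E = fun t => bf s b E (t ∘ s.succAboveEmb) := by
  funext t
  unfold face bf
  congr 1
  symm
  rw [Fin.insertNth_eq_iff]
  refine ⟨by simp, ?_⟩
  funext k
  simp [Fin.removeNth, Fin.succAbove_ne]

theorem Ku_eq_Yb : ∀ (n : ℕ), ∃ κ : ℤ, (κ = 1 ∨ κ = -1) ∧ ∀ (θ : Fin n → A) (hθ : ∀ s r, θ s * θ r = -(θ r * θ s)) (E : (Fin n → Bool) → A)
    (hE : ∀ t s, E t * θ s = -(θ s * E t)), Ku θ n univ E = κ • ((List.ofFn θ).prod * Yb n E) := by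
  intro n
  induction n with
  | zero => exact ⟨1, Or.inl rfl, fun θ hθ E hE => by simp [Ku, Yb]⟩
  | succ n ih =>
    obtain ⟨κ, hκ, ih⟩ := ih
    refine ⟨(-1)^(n+1) * κ, ?_, ?_⟩
    · rcases neg_one_pow_eq_or ℤ (n+1) with h | h <;> rcases hκ with h' | h' <;> simp [h, h']
    · intro θ hθ E hE
      rw [Ku, Yb, dl]
      have h1 : ∀ s : Fin (n+1), ∀ b, Ku θ n (univ.erase s) (face s b E) = κ • ((List.ofFn (fun i => θ (s.succAbove i))).prod * Yb n (bf s b E)) := by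
        intro s b
        have : (univ : Finset (Fin (n+1))).erase s = (univ : Finset (Fin n)).map s.succAboveEmb := by
          ext k
          simp only [mem_erase, mem_univ, and_true, mem_map, true_and, Fin.coe_succAboveEmb]
          exact (Fin.exists_succAbove_eq_iff).symm
        rw [this, face_eq, re_Ku]
        exact ih _ (fun _ _ => hθ _ _) _ (fun _ _ => hE _ _)
      simp only [h1]
      have h2 : ∀ s : Fin (n+1), θ s * (κ • ((List.ofFn (fun i => θ (s.succAbove i))).prod * Yb n (bf s true E)) - κ • ((List.ofFn (fun i => θ (s.succAbove i))).prod * Yb n (bf s false E)))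
          = κ • ((List.ofFn θ).prod * ((-1 : ℤ)^(s : ℕ) • (Yb n (bf s true E) - Yb n (bf s false E)))) := by
        intro s
        rw [← smul_sub, ← mul_sub, mul_smul_comm, ← mul_assoc, theta_sign θ hθ, smul_mul_assoc, mul_smul_comm]
      simp only [h2]
      rw [← Finset.smul_sum, ← Finset.mul_sum, mul_smul_comm, ← mul_assoc, mul_smul, ← mul_assoc]
      have h3 : E base * (List.ofFn θ).prod = (-1 : ℤ)^(n+1) • ((List.ofFn θ).prod * E base) := by
        have : ∀ l : List A, (∀ x ∈ l, E base * x = -(x * E base)) → E base * l.prod = (-1 : ℤ)^(l.length) • (l.prod * E base) := by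
          intro l hl
          induction l with
          | nil => simp
          | cons x l ih' =>
            rw [List.prod_cons, ← mul_assoc, hl x (by simp), neg_mul, mul_assoc, ih' (fun y hy => hl y (by simp [hy])), List.length_cons, pow_succ, mul_smul_comm, mul_assoc]
            simp
        have := this (List.ofFn θ) (by intro x hx; rw [List.mem_ofFn] at hx; obtain ⟨i, rfl⟩ := hx; exact hE _ _)
        rwa [List.length_ofFn] at this
      rw [h3, smul_mul_assoc, smul_comm]

theorem map_Yb {B : Type} [Ring B] (φ : A →+* B) (n : ℕ) (E : (Fin n → Bool) → A) : φ (Yb n E) = Yb n (fun t => φ (E t)) := by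
  induction n with
  | zero => rfl
  | succ n ih =>
    rw [Yb, Yb, map_mul, map_sum]
    congr 1
    refine Finset.sum_congr rfl fun s _ => ?_
    rw [map_zsmul, map_sub, ih, ih]; rfl

end conn

section final
variable {F : Type} [Field F] {V Λ : Type}

noncomputable def toChain {n : ℕ} (C : Qc F V n) : Chain F (Fin n) V where
  N := C.support
  fin := inferInstance
  y := fun m => m.1
  c := fun m => C m.1

theorem ev_toChain {n : ℕ} : ∃ κ : ℤ, (κ = 1 ∨ κ = -1) ∧ ∀ (C : Qc F V n) (ℓ : V → Λ), ev (toChain C) ℓ = κ •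
    (mon F ((List.ofFn (fun i : Fin n => i)).map Sum.inl) * mapE (Sum.inr : Λ → Fin n ⊕ Λ) (YL ℓ n C)) := by
  obtain ⟨κ, hκ, h⟩ := Ku_eq_Yb (A := EA F (Fin n ⊕ Λ)) n
  refine ⟨κ, hκ, fun C ℓ => ?_⟩
  have hk : ∀ y : (Fin n → Bool) → V, kc F (fun t => ℓ (y t)) = κ • (mon F ((List.ofFn (fun i : Fin n => i)).map Sum.inl) * mapE (Sum.inr : Λ → Fin n ⊕ Λ) (Yb n (fun t => g F (ℓ (y t))))) := by
    intro y
    unfold kc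
    rw [Fintype.card_fin, h _ (fun _ _ => g_anti _ _) _ (fun _ _ => g_anti _ _)]
    congr 2
    · unfold mon; rw [List.map_ofFn, List.map_ofFn]; rfl
    · have := map_Yb (mapE (F := F) (Sum.inr : Λ → Fin n ⊕ Λ)).toRingHom n (fun t => g F (ℓ (y t)))
      refine Eq.trans ?_ this.symm
      simp
  unfold ev
  simp only [hk]
  have : YL ℓ n C = ∑ m : C.support, C m.1 • Yb n (fun t => g F (ℓ (m.1 t))) := by
    unfold YL
    rw [Finsupp.linearCombination_apply, Finsupp.sum, ← Finset.sum_coe_sort]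
  rw [this, map_sum, Finset.mul_sum, Finset.smul_sum]
  refine Finset.sum_congr rfl fun m _ => ?_
  rw [map_smul, mul_smul_comm, smul_comm]
  rfl

theorem good_toChain {p : ℕ} [Fact p.Prime] {V : Type} {n : ℕ} (C : Qc (ZMod p) V (n+1)) (c : Qc (ZMod p) V n) (τ : ZMod p → V → V)
    (h : bd (ZMod p) n C = ∑ b, mp (ZMod p) (τ b) n c) : Good {f | ∃ b, f = τ b} ∅ (toChain C) := by
  intro ψ hinv hanti _
  let Ψ : Qc (ZMod p) V n →ₗ[ZMod p] ZMod p := Finsupp.linearCombination (ZMod p) (fun y => ψ 0 (fun t => y (t ∘ Fin.succ)))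
  have hΨ : ∀ b, Ψ (mp (ZMod p) (τ b) n c) = Ψ c := by
    intro b
    suffices h : Ψ ∘ₗ mp (ZMod p) (τ b) n = Ψ from LinearMap.congr_fun h c
    refine Finsupp.lhom_ext' fun y => LinearMap.ext_ring ?_
    simp only [LinearMap.comp_apply, Finsupp.lsingle_apply, mp_single, Ψ, Finsupp.linearCombination_single, one_smul]
    exact hinv _ ⟨b, rfl⟩ _ _
  have h0 : Ψ (bd (ZMod p) n C) = 0 := by
    rw [h, map_sum]
    simp [hΨ]
  have hf : ∀ (s : Fin (n+1)) (b : Bool) (y : (Fin (n+1) → Bool) → V), ψ s (face s b y) = (-1 : ℤ)^(s:ℕ) • Ψ (Finsupp.single (bf s b y) 1) := by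
    intro s b y
    have := hanti (s.cycleRange)⁻¹ 0 (fun t => bf s b y (t ∘ Fin.succ))
    rw [Equiv.Perm.sign_inv, Fin.sign_cycleRange] at this
    have e1 : (s.cycleRange)⁻¹ 0 = s := Fin.cycleRange_symm_zero s
    rw [e1] at this
    simp only [Ψ, Finsupp.linearCombination_single, one_smul]
    rw [face_eq]
    refine Eq.trans ?_ (this.trans ?_)
    · congr 1
      funext t
      congr 1
      funext k
      simp only [Function.comp_apply]
      congr 1
      exact (Fin.cycleRange_symm_succ s k).symm
    · congr 1
  have hs : ∀ y, ∑ s, (ψ s (face s true y) - ψ s (face s false y)) = Ψ (bd1 (ZMod p) y) := by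
    intro y
    unfold bd1
    rw [map_sum]
    refine Finset.sum_congr rfl fun s _ => ?_
    rw [hf, hf, map_zsmul, map_sub, zsmul_sub]
  simp only [hs]
  have hb : bd (ZMod p) n C = ∑ m : C.support, C m.1 • bd1 (ZMod p) m.1 := by
    rw [bd, Finsupp.linearCombination_apply, Finsupp.sum, ← Finset.sum_coe_sort]
  rw [← h0, hb, map_sum]
  refine Finset.sum_congr rfl fun m _ => ?_
  rw [map_smul]; rfl

theorem base_abs {p : ℕ} [Fact p.Prime] (hp : Odd p) {V : Type} [Group V] (S : Setup p V) (ε : ℝ) (hε : 0 < ε) :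
    ∃ X : Chain (ZMod p) (Fin (p-1)) V, (∀ n t t', S.dst (X.y n t) (X.y n t') < ε) ∧
      Good {f | ∃ b, f = fun v => S.τ b * v} ∅ X ∧
      ∀ ℓ : V → ZMod p, (∀ b v, ℓ (S.τ b * v) = b + ℓ v) → ev X ℓ ≠ 0 := by
  obtain ⟨C, hC1, hC2, -⟩ := exists_Ch hp S (p-1) le_rfl ε hε
  refine ⟨toChain C, ?_, ?_, ?_⟩
  · intro n t t'
    exact hC1 n.2 t t'
  · obtain ⟨m, hm⟩ := hp
    have h3 := (Fact.out : p.Prime).two_le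
    have : ∃ k, p - 1 = k + 1 ∧ Odd k := ⟨p - 2, by omega, ⟨m - 1, by omega⟩⟩
    obtain ⟨k, hk, hko⟩ := this
    generalize hq : p - 1 = q at *
    subst hk
    cases hC2 with
    | succ _ c _ h1 h2 =>
      refine good_toChain C c (fun b v => S.τ b * v) ?_
      rw [h2, op, if_neg (by simpa using hko), nop, LinearMap.sum_apply]
      rfl
  · intro ℓ hℓ
    obtain ⟨δ, hδ, h⟩ := YL_top hp S ℓ hℓ hC2
    obtain ⟨κ, hκ, h'⟩ := ev_toChain (F := ZMod p) (V := V) (Λ := ZMod p) (n := p-1)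
    rw [h', h, map_smul, mul_smul_comm, mapE_mon, ← mon_append]
    have : mon (ZMod p) (((List.ofFn (fun i : Fin (p-1) => i)).map Sum.inl) ++ (lk p p).map Sum.inr) ≠ 0 := by
      apply mon_ne_zero
      rw [List.nodup_append]
      refine ⟨?_, lk_nodup.map Sum.inr_injective, ?_⟩
      · refine List.Nodup.map Sum.inl_injective ?_
        rw [List.nodup_ofFn]; exact fun _ _ h => h
      · intro a ha b hb
        rw [List.mem_map] at ha hb
        obtain ⟨x, -, rfl⟩ := ha
        obtain ⟨y, -, rfl⟩ := hb
        simp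
    have h5 := smul_ne_zero hδ this
    rcases hκ with rfl | rfl
    · simpa using h5
    · simpa using h5
end final
end Crs

set_option linter.all false
namespace Crs
open Finset

abbrev OG (I : Type) [Fintype I] [DecidableEq I] := Matrix.unitaryGroup I ℝ

section og
variable {I : Type} [Fintype I] [DecidableEq I]

noncomputable def Pm (σ : Equiv.Perm I) : OG I := ⟨Matrix.permMatrixHom (R := ℝ) σ, by
  rw [Matrix.mem_unitaryGroup_iff, Matrix.star_eq_conjTranspose, Matrix.permMatrixHom_apply, Matrix.conjTranspose_permMatrix, ← Matrix.permMatrix_mul]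
  simp⟩

theorem Pm_val (σ : Equiv.Perm I) : (Pm σ).1 = (σ⁻¹).permMatrix ℝ := rfl

theorem Pm_one : Pm (1 : Equiv.Perm I) = 1 := Subtype.ext (map_one Matrix.permMatrixHom)

theorem Pm_mul (σ τ : Equiv.Perm I) : Pm (σ * τ) = Pm σ * Pm τ := Subtype.ext (map_mul Matrix.permMatrixHom σ τ)

theorem Pm_pow (σ : Equiv.Perm I) (k : ℕ) : Pm (σ ^ k) = Pm σ ^ k := by
  induction k with
  | zero => simp [Pm_one]
  | succ k ih => rw [pow_succ, pow_succ, Pm_mul, ih]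

theorem Pm_mul_apply (σ : Equiv.Perm I) (A : OG I) (i j : I) : (Pm σ * A).1 i j = A.1 (σ.symm i) j := by
  change ((((σ⁻¹).toPEquiv.toMatrix : Matrix I I ℝ) * A.1 : Matrix I I ℝ)) i j = _
  rw [PEquiv.toMatrix_toPEquiv_mul]; rfl

theorem mul_Pm_apply (σ : Equiv.Perm I) (A : OG I) (i j : I) : (A * Pm σ).1 i j = A.1 i (σ j) := by
  change ((A.1 * ((σ⁻¹).toPEquiv.toMatrix : Matrix I I ℝ) : Matrix I I ℝ)) i j = _
  rw [PEquiv.mul_toMatrix_toPEquiv]; rfl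

theorem Pm_apply (σ : Equiv.Perm I) (i j : I) : (Pm σ).1 i j = if i = σ j then 1 else 0 := by
  have := mul_Pm_apply σ 1 i j
  rw [one_mul] at this
  rw [this]
  simp [Matrix.one_apply]

open scoped Matrix.Norms.L2Operator

noncomputable def dO (A B : OG I) : ℝ := ‖A.1 - B.1‖

theorem dO_entry (A B : OG I) (i j : I) : |A.1 i j - B.1 i j| ≤ dO A B := by
  have h := Matrix.l2_opNorm_mulVec (A.1 - B.1) (EuclideanSpace.single j (1:ℝ))
  rw [EuclideanSpace.norm_single, norm_one, mul_one] at h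
  refine le_trans ?_ h
  have := EuclideanSpace.norm_eq (WithLp.toLp 2 ((A.1 - B.1).mulVec (EuclideanSpace.single j (1:ℝ)).ofLp))
  refine le_trans ?_ (PiLp.norm_apply_le (p := 2) _ i)
  simp

theorem dO_left (v A B : OG I) : dO (v * A) (v * B) = dO A B := by
  unfold dO
  change ‖v.1 * A.1 - v.1 * B.1‖ = _
  rw [← mul_sub]
  exact CStarRing.norm_coe_unitary_mul v _

theorem dO_right (v A B : OG I) : dO (A * v) (B * v) = dO A B := by
  unfold dO
  change ‖A.1 * v.1 - B.1 * v.1‖ = _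
  rw [← sub_mul]
  exact CStarRing.norm_mul_coe_unitary _ v

theorem dO_symm (A B : OG I) : dO A B = dO B A := norm_sub_rev _ _

theorem dO_self (A : OG I) : dO A A = 0 := by unfold dO; rw [sub_self]; exact norm_zero

theorem dO_tri (A B C : OG I) : dO A C ≤ dO A B + dO B C := norm_sub_le_norm_sub_add_norm_sub _ _ _

def Jn (A B : OG I) : Prop := ∀ ε > 0, Relation.ReflTransGen (fun x y => dO x y < ε) A B

theorem Jn.refl (A : OG I) : Jn A A := fun _ _ => Relation.ReflTransGen.refl
theorem Jn.trans {A B C : OG I} (h : Jn A B) (h' : Jn B C) : Jn A C := fun ε hε => (h ε hε).trans (h' ε hε)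
theorem Jn.symm {A B : OG I} (h : Jn A B) : Jn B A := fun ε hε => by
  have : Std.Symm (fun x y : OG I => dO x y < ε) := ⟨fun x y h => by rw [dO_symm]; exact h⟩
  exact Relation.ReflTransGen.symmetric.symm _ _ (h ε hε)
theorem Jn.mul_left {A B : OG I} (v : OG I) (h : Jn A B) : Jn (v * A) (v * B) := fun ε hε => by
  have h0 := h ε hε
  clear h
  induction h0 with
  | refl => exact Relation.ReflTransGen.refl
  | tail _ h1 ih => exact ih.tail (by rw [dO_left]; exact h1)
theorem Jn.mul_right {A B : OG I} (v : OG I) (h : Jn A B) : Jn (A * v) (B * v) := fun ε hε => by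
  have h0 := h ε hε
  clear h
  induction h0 with
  | refl => exact Relation.ReflTransGen.refl
  | tail _ h1 ih => exact ih.tail (by rw [dO_right]; exact h1)

noncomputable def rfl' (v : I → ℝ) : OG I := ⟨1 - (2 / (v ⬝ᵥ v)) • Matrix.vecMulVec v v, by
  rw [Matrix.mem_unitaryGroup_iff]
  have : star (1 - (2 / (v ⬝ᵥ v)) • Matrix.vecMulVec v v) = 1 - (2 / (v ⬝ᵥ v)) • Matrix.vecMulVec v v := by
    rw [star_sub, star_one, star_smul]
    congr 2
    ext i j
    simp [Matrix.vecMulVec_apply, mul_comm]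
  rw [this, mul_sub, mul_one, sub_mul, one_mul, smul_mul_smul_comm, Matrix.vecMulVec_mul_vecMulVec]
  by_cases h : v ⬝ᵥ v = 0
  · rw [h]; simp
  · rw [Matrix.vecMulVec_smul, smul_smul]
    have : 2 / (v ⬝ᵥ v) * (2 / (v ⬝ᵥ v)) * (v ⬝ᵥ v) = 2 / (v ⬝ᵥ v) + 2 / (v ⬝ᵥ v) := by field_simp; norm_num
    rw [this, add_smul]; abel⟩

theorem rfl'_apply (v : I → ℝ) (i j : I) : (rfl' v).1 i j = (if i = j then 1 else 0) - 2 / (v ⬝ᵥ v) * (v i * v j) := by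
  simp [rfl', Matrix.vecMulVec_apply, Matrix.one_apply]

theorem rfl'_sq (v : I → ℝ) : rfl' v * rfl' v = 1 := by
  have h := (rfl' v).2
  rw [Matrix.mem_unitaryGroup_iff] at h
  have : star (rfl' v).1 = (rfl' v).1 := by
    ext i j
    rw [Matrix.star_apply, rfl'_apply, rfl'_apply]
    simp [mul_comm, eq_comm]
  rw [this] at h
  exact Subtype.ext h

theorem Pm_rfl' (σ : Equiv.Perm I) : Pm σ * rfl' (fun _ => 1) = rfl' (fun _ => 1) * Pm σ := by
  apply Subtype.ext
  ext i j
  rw [Pm_mul_apply, mul_Pm_apply, rfl'_apply, rfl'_apply]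
  simp [Equiv.symm_apply_eq]

theorem Pm_swap {i j : I} (h : i ≠ j) : Pm (Equiv.swap i j) = rfl' ((Pi.single i 1 : I → ℝ) - Pi.single j 1) := by
  apply Subtype.ext
  ext a b
  rw [Pm_apply, rfl'_apply]
  have h' := h.symm
  have : ((Pi.single i 1 : I → ℝ) - Pi.single j 1) ⬝ᵥ ((Pi.single i 1 : I → ℝ) - Pi.single j 1) = 2 := by
    simp [h, h']; norm_num
  rw [this]
  by_cases hb : b = i
  · subst hb
    by_cases ha : a = b
    · subst ha; simp [h, h']
    · by_cases ha' : a = j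
      · subst ha'; simp [h, h']
      · simp [ha, ha', h, h']
  · by_cases hb' : b = j
    · subst hb'
      by_cases ha : a = b
      · subst ha; simp [h, h']
      · by_cases ha' : a = i
        · subst ha'; simp [h, h']
        · simp [ha, ha', h, h']
    · rw [Equiv.swap_apply_of_ne_of_ne hb hb']
      simp [hb, hb']

theorem Jn_rfl' (hI : 2 ≤ Fintype.card I) {v w : I → ℝ} (hv : v ≠ 0) (hw : w ≠ 0) : Jn (rfl' v) (rfl' w) := by
  intro ε hε
  have hc : IsPreconnected ({0}ᶜ : Set (I → ℝ)) := by
    refine (isConnected_compl_singleton_of_one_lt_rank ?_ 0).isPreconnected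
    rw [rank_fun']
    exact_mod_cast hI
  refine hc.induction₂ (fun v w => Relation.ReflTransGen (fun x y => dO x y < ε) (rfl' v) (rfl' w)) ?_ ?_ ?_ hv hw
  · intro x hx
    have hcont : ContinuousAt (fun v : I → ℝ => (rfl' v).1) x := by
      unfold rfl'
      have hx' : x ⬝ᵥ x ≠ 0 := by
        intro h; exact hx (dotProduct_self_eq_zero.1 h)
      have h1 : ContinuousAt (fun v : I → ℝ => v ⬝ᵥ v) x := by
        unfold dotProduct; fun_prop
      have h2 : ContinuousAt (fun v : I → ℝ => Matrix.vecMulVec v v) x := by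
        have : Continuous (fun v : I → ℝ => Matrix.vecMulVec v v) := by
          refine continuous_matrix fun i j => ?_
          simp only [Matrix.vecMulVec_apply]; fun_prop
        exact this.continuousAt
      exact continuousAt_const.sub ((continuousAt_const.div h1 hx').smul h2)
    have : ∀ᶠ y in nhds x, dist (rfl' y).1 (rfl' x).1 < ε := Metric.tendsto_nhds.1 hcont ε hε
    filter_upwards [this.filter_mono nhdsWithin_le_nhds] with y hy
    refine Relation.ReflTransGen.single ?_
    rw [dO_symm]
    rw [dist_eq_norm] at hy
    exact hy
  · intro x y z _ _ _ h1 h2; exact h1.trans h2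
  · intro x y _ _ h
    have : Std.Symm (fun x y : OG I => dO x y < ε) := ⟨fun x y h => by rw [dO_symm]; exact h⟩
    exact Relation.ReflTransGen.symmetric.symm _ _ h

theorem Jn_Pm (hI : 2 ≤ Fintype.card I) (σ : Equiv.Perm I) : Jn 1 (Pm σ) ∨ Jn (rfl' (fun _ => 1)) (Pm σ) := by
  haveI : Nonempty I := Fintype.card_pos_iff.1 (by omega)
  refine Equiv.Perm.swap_induction_on σ ?_ ?_
  · left; rw [Pm_one]; exact Jn.refl _
  · intro f x y hxy h
    have h1 : Jn (rfl' (fun _ => 1)) (Pm (Equiv.swap x y)) := by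
      rw [Pm_swap hxy]
      refine Jn_rfl' hI ?_ ?_
      · intro h; have := congrFun h x; simp at this
      · intro h; have := congrFun h x; simp [hxy] at this
    rw [Pm_mul]
    rcases h with h | h
    · right
      have := h.mul_left (Pm (Equiv.swap x y))
      rw [mul_one] at this
      exact h1.trans this
    · left
      have h2 := h1.mul_right (rfl' (fun _ => 1))
      rw [rfl'_sq] at h2
      exact h2.trans (h.mul_left _)

end og

section setup
variable (p : ℕ) [Fact p.Prime]

theorem exists_setup (hp : Odd p) : ∃ S : Setup p (OG (ZMod p)), (∀ b, S.τ b = Pm (Equiv.addLeft b)) ∧ S.dst = dO := by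
  have hp2 := (Fact.out : p.Prime).two_le
  have hI : 2 ≤ Fintype.card (ZMod p) := by rw [ZMod.card]; exact hp2
  have hev : Even (p - 1) := by obtain ⟨m, hm⟩ := hp; exact ⟨m, by omega⟩
  obtain ⟨a, ha⟩ := IsCyclic.exists_generator (α := (ZMod p)ˣ)
  have ho : orderOf a = p - 1 := by
    rw [orderOf_eq_card_of_forall_mem_zpowers ha, Nat.card_eq_fintype_card, ZMod.card_units]
  let μ : Equiv.Perm (ZMod p) := Equiv.mulLeft₀ (a : ZMod p) a.ne_zero
  have hμ : ∀ x, μ x = a * x := fun x => rfl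
  have hμk : ∀ k x, (μ ^ k) x = (a : ZMod p) ^ k * x := by
    intro k
    induction k with
    | zero => simp
    | succ k ih => intro x; rw [pow_succ, Equiv.Perm.mul_apply, ih, hμ, pow_succ, mul_assoc]
  have hμp : μ ^ (p - 1) = 1 := by
    ext x
    rw [hμk, ZMod.pow_card_sub_one_eq_one a.ne_zero]; simp
  have hcomm : ∀ b, Pm μ * Pm (Equiv.addLeft b) = Pm (Equiv.addLeft ((a : ZMod p) * b)) * Pm μ := by
    intro b
    rw [← Pm_mul, ← Pm_mul]
    congr 1
    ext x
    simp [hμ, mul_add]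
  have key : ∃ u : OG (ZMod p), (∀ b, u * Pm (Equiv.addLeft b) = Pm (Equiv.addLeft ((a : ZMod p) * b)) * u) ∧ u ^ (p - 1) = 1 ∧ Jn 1 u := by
    rcases Jn_Pm hI μ with h | h
    · exact ⟨Pm μ, hcomm, by rw [← Pm_pow, hμp, Pm_one], h⟩
    · refine ⟨Pm μ * rfl' (fun _ => 1), ?_, ?_, ?_⟩
      · intro b
        rw [mul_assoc, ← Pm_rfl', ← mul_assoc, hcomm, mul_assoc]
      · rw [(show Commute (Pm μ) (rfl' fun _ => 1) from Pm_rfl' μ).mul_pow, ← Pm_pow, hμp, Pm_one, one_mul]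
        obtain ⟨m, hm⟩ := hev
        rw [hm, ← two_mul, pow_mul, pow_two, rfl'_sq, one_pow]
      · have := h.mul_right (rfl' fun _ => 1)
        rwa [rfl'_sq] at this
  obtain ⟨u, hu1, hu2, hu3⟩ := key
  refine ⟨{ τ := fun b => Pm (Equiv.addLeft b), τ0 := ?_, τadd := ?_, u := u, a := a, a0 := a.ne_zero, ha := ?_, hu := hu1, upow := hu2, dst := dO, dself := ?_, dsymm := dO_symm, dtri := dO_tri, dl := dO_left, dr := dO_right, reach := hu3 }, fun _ => rfl, rfl⟩
  · rw [← Pm_one]; congr 1; ext x; simp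
  · intro a b
    rw [← Pm_mul]; congr 1; ext x; simp [add_assoc]
  · intro k hk0 hk h
    have : a ^ k = 1 := Units.ext (by simpa using h)
    have := orderOf_dvd_of_pow_eq_one this
    rw [ho] at this
    exact absurd (Nat.le_of_dvd hk0 this) (by omega)
  · exact dO_self

theorem base_OG (hp : Odd p) (ε : ℝ) (hε : 0 < ε) :
    ∃ X : Chain (ZMod p) (Fin (p-1)) (OG (ZMod p)), (∀ n t t' i j, |(X.y n t).1 i j - (X.y n t').1 i j| < ε) ∧
      Good {f | ∃ σ : Equiv.Perm (ZMod p), Equiv.Perm.sign σ = 1 ∧ f = fun v => Pm σ * v} ∅ X ∧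
      ∀ ℓ : OG (ZMod p) → ZMod p, (∀ σ v, Equiv.Perm.sign σ = 1 → ℓ (Pm σ * v) = σ (ℓ v)) → ev X ℓ ≠ 0 := by
  obtain ⟨S, h1, h2⟩ := exists_setup p hp
  obtain ⟨X, hX1, hX2, hX3⟩ := base_abs hp S ε hε
  refine ⟨X, ?_, ?_, ?_⟩
  · intro n t t' i j
    have := hX1 n t t'
    rw [h2] at this
    exact lt_of_le_of_lt (dO_entry _ _ _ _) this
  · intro ψ hψ
    refine hX2 ψ ?_
    rintro f ⟨b, rfl⟩
    exact hψ _ ⟨Equiv.addLeft b, sign_add hp b, by rw [h1]⟩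
  · intro ℓ hℓ
    refine hX3 ℓ ?_
    intro b v
    rw [h1, hℓ _ _ (sign_add hp b)]; rfl
end setup
end Crs

set_option linter.all false
namespace Crs
open Finset

theorem exists_sel (J α : Type) [Nonempty J] : ∃ s : (J → α) → Set J → J, (∀ ρ Φ, Φ.Nonempty → s ρ Φ ∈ Φ) ∧
    ∀ ρ Φ (τ : Equiv.Perm J), Function.Injective ρ → Φ.Nonempty → s (ρ ∘ τ.symm) (τ.symm ⁻¹' Φ) = τ (s ρ Φ) := by
  classical
  have wf : WellFounded (WellOrderingRel (α := α)) := IsWellFounded.wf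
  have hex : ∀ (ρ : J → α) (Φ : Set J) (h : Φ.Nonempty), ∃ j ∈ Φ, ρ j = wf.min (ρ '' Φ) (h.image ρ) := by
    intro ρ Φ h
    obtain ⟨j, hj, h'⟩ := wf.min_mem (ρ '' Φ) (h.image ρ)
    exact ⟨j, hj, h'⟩
  let s : (J → α) → Set J → J := fun ρ Φ => if h : Φ.Nonempty then (hex ρ Φ h).choose else Classical.arbitrary J
  have hs1 : ∀ ρ Φ, Φ.Nonempty → s ρ Φ ∈ Φ := by
    intro ρ Φ h
    simp only [s, dif_pos h]
    exact (hex ρ Φ h).choose_spec.1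
  have hs2 : ∀ ρ Φ (h : Φ.Nonempty), ρ (s ρ Φ) = wf.min (ρ '' Φ) (h.image ρ) := by
    intro ρ Φ h
    simp only [s, dif_pos h]
    exact (hex ρ Φ h).choose_spec.2
  refine ⟨s, hs1, ?_⟩
  intro ρ Φ τ hρ hΦ
  have hn : (τ.symm ⁻¹' Φ).Nonempty := by
    obtain ⟨x, hx⟩ := hΦ
    exact ⟨τ x, by simpa using hx⟩
  have h1 := hs2 (ρ ∘ τ.symm) _ hn
  have h2 := hs2 ρ Φ hΦ
  have h3 : (ρ ∘ τ.symm) '' (τ.symm ⁻¹' Φ) = ρ '' Φ := by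
    rw [Set.image_comp, Set.image_preimage_eq _ τ.symm.surjective]
  have h4 : ρ (τ.symm (s (ρ ∘ τ.symm) (τ.symm ⁻¹' Φ))) = ρ (s ρ Φ) := by
    rw [h2]
    refine Eq.trans h1 ?_
    congr 1
  have := hρ h4
  rw [← this]; simp

section sel
variable {I : Type} [Fintype I] [DecidableEq I]

def rows (A : OG I) : I → I → ℝ := fun i j => A.1 i j

theorem rows_inj (A : OG I) : Function.Injective (rows A) := by
  intro i j h
  have h : ∀ k, A.1 i k = A.1 j k := congrFun h
  by_contra hne
  have h1 := A.2
  rw [Matrix.mem_unitaryGroup_iff] at h1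
  have e1 := congrFun (congrFun h1 i) i
  have e2 := congrFun (congrFun h1 j) i
  rw [Matrix.mul_apply] at e1 e2
  rw [Matrix.one_apply_eq] at e1
  simp only [h] at e1
  rw [Matrix.one_apply_ne (Ne.symm hne)] at e2
  simp only [Matrix.star_apply, h] at e1 e2
  rw [e1] at e2
  exact one_ne_zero e2

theorem Pm_rows (σ : Equiv.Perm I) (A : OG I) : rows (Pm σ * A) = rows A ∘ σ.symm := by
  funext i j
  unfold rows
  rw [Pm_mul_apply]; rfl

theorem exists_eqv [Nonempty I] : ∃ ℓ : OG I → I, ∀ σ A, ℓ (Pm σ * A) = σ (ℓ A) := by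
  obtain ⟨s, -, h⟩ := exists_sel I (I → ℝ)
  refine ⟨fun A => s (rows A) Set.univ, fun σ A => ?_⟩
  have := h (rows A) Set.univ σ (rows_inj A) Set.univ_nonempty
  simp only []
  rw [← this, Pm_rows]; rfl

def GE (I : Type) [Fintype I] [DecidableEq I] : Set (OG I → OG I) := {f | ∃ σ : Equiv.Perm I, Equiv.Perm.sign σ = 1 ∧ f = fun v => Pm σ * v}
end sel

def T (p : ℕ) [Fact p.Prime] (I : Type) [Fintype I] [DecidableEq I] : Prop := ∀ ε : ℝ, 0 < ε →
  ∃ (D : Type) (_ : Fintype D) (_ : DecidableEq D) (X : Chain (ZMod p) D (OG I)), Fintype.card D + 1 = Fintype.card I ∧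
    (∀ n t t' i j, |(X.y n t).1 i j - (X.y n t').1 i j| < ε) ∧ Good (GE I) ∅ X ∧
    ∀ ℓ : OG I → I, (∀ σ v, Equiv.Perm.sign σ = 1 → ℓ (Pm σ * v) = σ (ℓ v)) → ev X ℓ ≠ 0

def mapC {F D V W : Type} (f : V → W) (X : Chain F D V) : Chain F D W where
  N := X.N
  fin := X.fin
  y := fun n t => f (X.y n t)
  c := X.c

theorem Good_mapC {F : Type} [Field F] {D V W : Type} [Fintype D] [DecidableEq D] (f : V → W) (X : Chain F D V)
    {𝒢 : Set (V → V)} {𝒢' : Set (W → W)} (hX : Good 𝒢 ∅ X) (h : ∀ k ∈ 𝒢, ∃ k' ∈ 𝒢', ∀ v, f (k v) = k' (f v)) : Good 𝒢' ∅ (mapC f X) := by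
  intro ψ h1 h2 _
  refine hX (fun s y => ψ s (fun t => f (y t))) ?_ ?_ ?_
  · intro k hk s y
    obtain ⟨k', hk', hkk⟩ := h k hk
    simp only [hkk]
    exact h1 k' hk' s _
  · intro π s y
    exact h2 π s (fun t => f (y t))
  · simp

section mm
variable {I J : Type} [Fintype I] [DecidableEq I] [Fintype J] [DecidableEq J]

noncomputable def mm (u : (I → OG J) × OG I) : OG (I × J) := ⟨Matrix.of fun a b => (u.1 a.1).1 a.2 b.2 * u.2.1 a.1 b.1, by
  rw [Matrix.mem_unitaryGroup_iff]
  ext ⟨i, j⟩ ⟨k, l⟩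
  rw [Matrix.mul_apply, Fintype.sum_prod_type]
  simp only [Matrix.star_apply, star_trivial, Matrix.of_apply]
  have h1 : ∑ x, ∑ y, (u.1 i).1 j y * u.2.1 i x * ((u.1 k).1 l y * u.2.1 k x) = (∑ x, u.2.1 i x * u.2.1 k x) * ∑ y, (u.1 i).1 j y * (u.1 k).1 l y := by
    rw [Finset.sum_mul_sum]
    refine sum_congr rfl fun x _ => sum_congr rfl fun y _ => ?_
    ring
  rw [h1]
  have hA : ∑ x, u.2.1 i x * u.2.1 k x = (1 : Matrix I I ℝ) i k := by
    have := congrFun (congrFun (Matrix.mem_unitaryGroup_iff.1 u.2.2) i) k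
    rw [Matrix.mul_apply] at this
    simpa [Matrix.star_apply] using this
  rw [hA]
  by_cases hik : i = k
  · subst hik
    have hB : ∑ y, (u.1 i).1 j y * (u.1 i).1 l y = (1 : Matrix J J ℝ) j l := by
      have := congrFun (congrFun (Matrix.mem_unitaryGroup_iff.1 (u.1 i).2) j) l
      rw [Matrix.mul_apply] at this
      simpa [Matrix.star_apply] using this
    rw [hB]
    simp [Matrix.one_apply]
  · rw [Matrix.one_apply_ne hik, Matrix.one_apply_ne (by simp [hik]), zero_mul]⟩

theorem mm_apply (u : (I → OG J) × OG I) (a b : I × J) : (mm u).1 a b = (u.1 a.1).1 a.2 b.2 * u.2.1 a.1 b.1 := rfl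

theorem OG_entry (A : OG I) (i j : I) : |A.1 i j| ≤ 1 := by
  have := entry_norm_bound_of_unitary A.2 i j
  rwa [Real.norm_eq_abs] at this

theorem T_step {p : ℕ} [Fact p.Prime] [Nonempty I] [Nonempty J] (hI : T p I) (hJ : T p J) (hIo : Odd (Fintype.card J)) : T p (I × J) := by
  intro ε hε
  obtain ⟨Da, _, _, Xa, ca, ea, ga, na⟩ := hI (ε/2) (by positivity)
  obtain ⟨Db, _, _, Xb, cb, eb, gb, nb⟩ := hJ (ε/2) (by positivity)
  obtain ⟨ℓa, hℓa⟩ := exists_eqv (I := I)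
  obtain ⟨ℓb, hℓb⟩ := exists_eqv (I := J)
  let ℓ' : (I → OG J) × OG I → I × J := fun u => (ℓa u.2, ℓb (u.1 (ℓa u.2)))
  let 𝒢 : Set ((I → OG J) × OG I → (I → OG J) × OG I) := {f | ∃ σ : Equiv.Perm (I × J), Equiv.Perm.sign σ = 1 ∧ ∀ u, mm (f u) = Pm σ * mm u ∧ ℓ' (f u) = σ (ℓ' u)}
  have hgood : Good 𝒢 ∅ (compC I Xb Xa) := by
    refine Good_comp (𝒢a := GE I) (𝒢b := GE J) (𝔉b := ∅) ?_ ?_ ?_ Xb Xa ga gb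
    · rintro f ⟨σ, hσ, rfl⟩
      refine ⟨σ, hσ, Equiv.prodCongrLeft (fun _ => σ), ?_, ?_⟩
      · rw [Equiv.Perm.sign_prodCongrLeft]; simp [hσ]
      · intro u
        constructor
        · apply Subtype.ext
          ext a b
          rw [Pm_mul_apply, mm_apply, mm_apply]
          simp only [Pm_mul_apply]
          rfl
        · simp only [ℓ', hℓa]
          simp
    · rintro f ⟨σ, hσ, rfl⟩ i
      refine ⟨Equiv.Perm.prodExtendRight i σ, ?_, ?_⟩
      · rw [Equiv.Perm.sign_prodExtendRight, hσ]
      · intro u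
        constructor
        · apply Subtype.ext
          ext ⟨k, a⟩ b
          rw [Pm_mul_apply, mm_apply, mm_apply]
          by_cases hk : k = i
          · subst hk
            have : (Equiv.Perm.prodExtendRight k σ).symm (k, a) = (k, σ.symm a) := by
              rw [Equiv.symm_apply_eq, Equiv.Perm.prodExtendRight_apply_eq]; simp
            rw [this]
            simp only [Function.update_self, Pm_mul_apply]
          · have : (Equiv.Perm.prodExtendRight i σ).symm (k, a) = (k, a) := by
              rw [Equiv.symm_apply_eq, Equiv.Perm.prodExtendRight_apply_ne _ hk]
            rw [this]
            simp only [Function.update_of_ne hk]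
        · simp only [ℓ']
          by_cases hk : ℓa u.2 = i
          · subst hk
            rw [Function.update_self, hℓb, Equiv.Perm.prodExtendRight_apply_eq]
          · rw [Function.update_of_ne hk, Equiv.Perm.prodExtendRight_apply_ne _ hk]
    · simp
  have hcard : Fintype.card (DD I Da Db) + 1 = Fintype.card (I × J) := by
    unfold DD
    rw [Fintype.card_sum, Fintype.card_prod, Fintype.card_prod, ← cb, ← ca]; ring
  refine ⟨DD I Da Db, inferInstance, inferInstance, mapC mm (compC I Xb Xa), hcard, ?_, ?_, ?_⟩
  · intro n t t' a b
    change |(mm ((compC I Xb Xa).y n t)).1 a b - (mm ((compC I Xb Xa).y n t')).1 a b| < ε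
    rw [mm_apply, mm_apply]
    have h1 := ea n.2 (va t) (va t') a.1 b.1
    have h2 := eb (n.1 a.1) (vb t a.1) (vb t' a.1) a.2 b.2
    have h3 := OG_entry (Xa.y n.2 (va t)) a.1 b.1
    have h4 := OG_entry (Xb.y (n.1 a.1) (vb t' a.1)) a.2 b.2
    change |(Xb.y (n.1 a.1) (vb t a.1)).1 a.2 b.2 * (Xa.y n.2 (va t)).1 a.1 b.1 - (Xb.y (n.1 a.1) (vb t' a.1)).1 a.2 b.2 * (Xa.y n.2 (va t')).1 a.1 b.1| < ε
    generalize (Xb.y (n.1 a.1) (vb t a.1)).1 a.2 b.2 = β at *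
    generalize (Xb.y (n.1 a.1) (vb t' a.1)).1 a.2 b.2 = β' at *
    generalize (Xa.y n.2 (va t)).1 a.1 b.1 = α at *
    generalize (Xa.y n.2 (va t')).1 a.1 b.1 = α' at *
    have : β * α - β' * α' = (β - β') * α + β' * (α - α') := by ring
    rw [this]
    refine lt_of_le_of_lt (abs_add_le _ _) ?_
    rw [abs_mul, abs_mul]
    have i1 : |β - β'| * |α| ≤ |β - β'| := mul_le_of_le_one_right (abs_nonneg _) h3
    have i2 : |β'| * |α - α'| ≤ |α - α'| := mul_le_of_le_one_left (abs_nonneg _) h4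
    linarith
  · refine Good_mapC mm _ hgood ?_
    rintro k ⟨σ, hσ, h⟩
    exact ⟨fun v => Pm σ * v, ⟨σ, hσ, rfl⟩, fun v => (h v).1⟩
  · intro ℓ hℓ
    have hne := ev_comp_ne (F := ZMod p) cb.symm ca Xb Xa ℓa ℓb (na ℓa fun σ v _ => hℓa σ v) (nb ℓb fun σ v _ => hℓb σ v)
    have : ev (compC I Xb Xa) (fun u => ℓ (mm u)) = ev (compC I Xb Xa) ℓ' := by
      refine ev_eq_of_good hcard.symm hgood _ _ ?_ ?_
      · rintro f ⟨σ, hσ, h⟩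
        refine ⟨σ, hσ, fun v => ⟨?_, (h v).2⟩⟩
        rw [(h v).1, hℓ _ _ hσ]
      · simp
    change ev (compC I Xb Xa) (fun u => ℓ (mm u)) ≠ 0
    rw [this]
    exact hne
end mm

theorem T_base (p : ℕ) [Fact p.Prime] (hp : Odd p) : T p (ZMod p) := by
  intro ε hε
  obtain ⟨X, h1, h2, h3⟩ := base_OG p hp ε hε
  refine ⟨Fin (p-1), inferInstance, inferInstance, X, ?_, h1, h2, h3⟩
  have := (Fact.out : p.Prime).two_le
  rw [Fintype.card_fin, ZMod.card]; omega

theorem exists_T (p : ℕ) [Fact p.Prime] (hp : Odd p) (k : ℕ) : ∃ (I : Type) (_ : Fintype I) (_ : DecidableEq I), Fintype.card I = p ^ (k+1) ∧ T p I := by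
  induction k with
  | zero => exact ⟨ZMod p, inferInstance, inferInstance, by simp [ZMod.card], T_base p hp⟩
  | succ k ih =>
    obtain ⟨I, _, _, hc, hT⟩ := ih
    haveI : Nonempty I := Fintype.card_pos_iff.1 (by rw [hc]; exact pow_pos (Fact.out : p.Prime).pos _)
    refine ⟨I × ZMod p, inferInstance, inferInstance, ?_, T_step hT (T_base p hp) (by rw [ZMod.card]; exact hp)⟩
    rw [Fintype.card_prod, hc, ZMod.card, pow_succ p (k+1)]

section fin
variable {F : Type} [Field F]

def edge (F : Type) [Field F] (M : ℕ) : Chain F Unit ℕ where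
  N := Fin M
  fin := inferInstance
  y := fun k t => if t () then k.1 + 1 else k.1
  c := fun _ => 1

theorem kc_unit (Λ : Type) (ℓ : (Unit → Bool) → Λ) : kc F ℓ = g F (Sum.inr (ℓ fun _ => false)) * (g F (Sum.inl ()) * (g F (Sum.inr (ℓ fun _ => true)) - g F (Sum.inr (ℓ fun _ => false)))) := by
  unfold kc
  rw [Fintype.card_unit]
  simp only [Ku, dl]
  have h : ∀ b, Function.update base () b = fun _ : Unit => b := by
    intro b; funext x; simp [base]
  have h' : (base : Unit → Bool) = fun _ => false := rfl
  simp only [Finset.univ_unique, Finset.sum_singleton, face]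
  change g F (Sum.inr (ℓ base)) * (g F (Sum.inl ()) * (g F (Sum.inr (ℓ (Function.update base () true))) - g F (Sum.inr (ℓ (Function.update base () false))))) = _
  rw [h, h]; rfl

theorem ev_edge (M : ℕ) (hM : 0 < M) : ev (edge F M) (fun k => decide (k < M)) ≠ 0 := by
  obtain ⟨m, rfl⟩ : ∃ m, M = m + 1 := ⟨M - 1, by omega⟩
  unfold ev
  have : ∀ n : Fin (m+1), (edge F (m+1)).c n • kc F (fun t => decide ((edge F (m+1)).y n t < m+1)) = if n = Fin.last m then
      mon F [(Sum.inr true : Unit ⊕ Bool), Sum.inl (), Sum.inr false] else 0 := by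
    intro n
    rw [kc_unit]
    simp only [edge, one_smul, if_true, Bool.false_eq_true, if_false]
    by_cases h : n = Fin.last m
    rw [if_pos h]
    rotate_left
    rw [if_neg h]
    rotate_left
    · subst h
      simp [mon, mul_sub]
      rw [← mul_assoc, g_anti, neg_mul, mul_assoc, g_sq]; simp
    · have : n.1 < m := by
        have := n.2
        have h2 : n.1 ≠ m := fun h3 => h (Fin.ext h3)
        omega
      simp [this, n.2]
  refine ne_of_eq_of_ne (Finset.sum_congr rfl fun n _ => this n) ?_
  change ∑ n : Fin (m+1), (if n = Fin.last m then
      mon F [(Sum.inr true : Unit ⊕ Bool), Sum.inl (), Sum.inr false] else 0) ≠ 0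
  rw [Finset.sum_ite_eq' univ (Fin.last m), if_pos (mem_univ _)]
  apply mon_ne_zero
  simp

theorem Good_edge (M : ℕ) : Good ∅ {{0}, {M}} (edge F M) := by
  intro ψ _ _ h
  have e : ∀ (n : Fin M) b, ψ () (face () b ((edge F M).y n)) = ψ () (fun _ => if b then n.1 + 1 else n.1) := by
    intro n b
    congr 1
  simp only [Finset.univ_unique, Finset.sum_singleton]
  have h2 : ∀ n : Fin M, (edge F M).c n * (ψ () (face () true ((edge F M).y n)) - ψ () (face () false ((edge F M).y n))) = ψ () (fun _ => n.1 + 1) - ψ () (fun _ => n.1) := by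
    intro n
    refine (one_mul _).trans ?_
    exact congrArg₂ (· - ·) (e n true) (e n false)
  refine Eq.trans (Finset.sum_congr rfl fun n _ => h2 n) ?_
  change ∑ n : Fin M, (ψ () (fun _ => n.1 + 1) - ψ () (fun _ => n.1)) = 0
  rw [Fin.sum_univ_eq_sum_range (fun n => ψ () (fun _ => n + 1) - ψ () (fun _ => n)), Finset.sum_range_sub (fun n => ψ () (fun _ => n))]
  have a1 : ψ () (fun _ => 0) = 0 := h {0} (by simp) _ _ (by simp)
  have a2 : ψ () (fun _ => M) = 0 := h {M} (by simp) _ _ (by simp)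
  rw [a1, a2, sub_zero]
end fin

theorem rainbow {p : ℕ} [Fact p.Prime] {I : Type} [Fintype I] [DecidableEq I] [Nonempty I] (hT : T p I) (ε : ℝ) (hε : 0 < ε) (M : ℕ) (hM : 0 < M)
    (l : (I → ℕ) × OG I → I × Bool) (hl : ∀ σ u, Equiv.Perm.sign σ = 1 → l (u.1 ∘ σ.symm, Pm σ * u.2) = (σ (l u).1, (l u).2))
    (h0 : ∀ u i, u.1 i = 0 → l u ≠ (i, false)) (h1 : ∀ u i, u.1 i = M → l u ≠ (i, true)) :
    ∃ f : I × Bool → (I → ℕ) × OG I, (∀ x, l (f x) = x) ∧ (∀ x i, (f x).1 i ≤ M) ∧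
      ∀ x x', (∀ i, (f x).1 i ≤ (f x').1 i + 1) ∧ ∀ i j, |(f x).2.1 i j - (f x').2.1 i j| < ε := by
  obtain ⟨Da, _, _, Xa, ca, ea, ga, na⟩ := hT ε hε
  obtain ⟨ℓa, hℓa⟩ := exists_eqv (I := I)
  let ℓb : ℕ → Bool := fun k => decide (k < M)
  let ℓ' : (I → ℕ) × OG I → I × Bool := fun u => (ℓa u.2, ℓb (u.1 (ℓa u.2)))
  have hne := ev_comp_ne (F := ZMod p) (by simp) ca (edge (ZMod p) M) Xa ℓa ℓb (na ℓa fun σ v _ => hℓa σ v) (ev_edge M hM)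
  let 𝒢 : Set ((I → ℕ) × OG I → (I → ℕ) × OG I) := {f | ∃ σ : Equiv.Perm I, Equiv.Perm.sign σ = 1 ∧ f = fun u => (u.1 ∘ σ.symm, Pm σ * u.2)}
  let 𝔉 : Set (Set ((I → ℕ) × OG I)) := {B | ∃ i, B = {u | u.1 i ∈ ({0} : Set ℕ)} ∨ B = {u | u.1 i ∈ ({M} : Set ℕ)}}
  have hgood : Good 𝒢 𝔉 (compC I (edge (ZMod p) M) Xa) := by
    refine Good_comp (𝒢a := GE I) (𝒢b := ∅) (𝔉b := {{0}, {M}}) ?_ ?_ ?_ _ Xa ga (Good_edge M)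
    · rintro f ⟨σ, hσ, rfl⟩
      exact ⟨σ, hσ, σ, hσ, rfl⟩
    · simp
    · rintro B hB i
      rcases hB with rfl | rfl
      · exact ⟨i, Or.inl rfl⟩
      · exact ⟨i, Or.inr rfl⟩
  have hcard : Fintype.card (I × Bool) = Fintype.card (DD I Da Unit) + 1 := by
    unfold DD
    rw [Fintype.card_sum, Fintype.card_prod, Fintype.card_prod, ← ca]; simp; ring
  have heq : ev (compC I (edge (ZMod p) M) Xa) l = ev (compC I (edge (ZMod p) M) Xa) ℓ' := by
    refine ev_eq_of_good hcard hgood _ _ ?_ ?_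
    · rintro f ⟨σ, hσ, rfl⟩
      refine ⟨Equiv.prodCongrLeft (fun _ => σ), ?_, ?_⟩
      · rw [Equiv.Perm.sign_prodCongrLeft]; simp [hσ]
      · intro u
        constructor
        · rw [hl σ u hσ]; rfl
        · simp only [ℓ', hℓa]
          simp
    · rintro B ⟨i, rfl | rfl⟩
      · refine ⟨(i, false), fun v hv => ⟨h0 v i hv, ?_⟩⟩
        intro h
        simp only [ℓ', Prod.mk.injEq] at h
        obtain ⟨h, h'⟩ := h
        rw [h] at h'
        have : v.1 i = 0 := hv
        rw [this] at h'
        simp [ℓb] at h'; omega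
      · refine ⟨(i, true), fun v hv => ⟨h1 v i hv, ?_⟩⟩
        intro h
        simp only [ℓ', Prod.mk.injEq] at h
        obtain ⟨h, h'⟩ := h
        rw [h] at h'
        have : v.1 i = M := hv
        rw [this] at h'
        simp [ℓb] at h'
  obtain ⟨n, hn⟩ := exists_rainbow hcard _ l (heq ▸ hne)
  choose t ht using hn
  have hy : ∀ k (s : Unit → Bool), ∃ b : ℕ, b ≤ 1 ∧ (edge (ZMod p) M).y k s = (Fin.val (n := M) k) + b := by
    intro k s
    simp only [edge]
    split_ifs
    · exact ⟨1, le_rfl, rfl⟩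
    · exact ⟨0, by simp, rfl⟩
  refine ⟨fun x => (compC I (edge (ZMod p) M) Xa).y n (t x), ht, ?_, ?_⟩
  · intro x i
    obtain ⟨b, hb, h⟩ := hy (n.1 i) (vb (t x) i)
    have h2 : (Fin.val (n := M) (n.1 i)) < M := Fin.is_lt _
    change (edge (ZMod p) M).y (n.1 i) (vb (t x) i) ≤ M
    omega
  · intro x x'
    constructor
    · intro i
      obtain ⟨b, hb, h⟩ := hy (n.1 i) (vb (t x) i)
      obtain ⟨b', hb', h'⟩ := hy (n.1 i) (vb (t x') i)
      change (edge (ZMod p) M).y (n.1 i) (vb (t x) i) ≤ (edge (ZMod p) M).y (n.1 i) (vb (t x') i) + 1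
      omega
    · intro i j
      exact ea n.2 _ _ i j
end Crs

set_option linter.all false
namespace Crs
open Finset Filter Topology

def sg (b : Bool) : ℝ := if b then 1 else -1

section geo
variable {E : Type} [NormedAddCommGroup E] [NormedSpace ℝ E] {I : Type} [Fintype I] [DecidableEq I]

noncomputable def qq (c : E) (x : I → ℝ) (w : I → E) : E := c + ∑ i, x i • w i

def Al (K : Set E) (c : E) (x : I → ℝ) (w : I → E) : Set (I × Bool) :=
  {a | (qq c x w ∈ K → ∀ (b : I × Bool) (t : ℝ), 0 ≤ t → qq c x w + (t * sg b.2) • w b.1 ∈ K → qq c x w + (t * sg a.2) • w a.1 ∈ K) ∧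
    (qq c x w ∉ K → ∀ k, |x k| ≤ -(sg a.2 * x a.1))}

theorem qq_perm (c : E) (x : I → ℝ) (w : I → E) (σ : Equiv.Perm I) : qq c (x ∘ σ.symm) (w ∘ σ.symm) = qq c x w := by
  unfold qq
  congr 1
  exact Equiv.sum_comp σ.symm (fun i => x i • w i)

theorem Al_perm (K : Set E) (c : E) (x : I → ℝ) (w : I → E) (σ : Equiv.Perm I) :
    Al K c (x ∘ σ.symm) (w ∘ σ.symm) = (Equiv.prodCongrLeft (fun _ : Bool => σ)).symm ⁻¹' Al K c x w := by
  ext ⟨i, η⟩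
  have h : (Equiv.prodCongrLeft (fun _ : Bool => σ)).symm (i, η) = (σ.symm i, η) := rfl
  rw [Set.mem_preimage, h]
  unfold Al
  simp only [Set.mem_setOf_eq, qq_perm, Function.comp_apply]
  refine and_congr (imp_congr Iff.rfl ?_) (imp_congr Iff.rfl ?_)
  · constructor
    · rintro h ⟨j, η'⟩ t ht hm
      exact h (σ j, η') t ht (by simpa using hm)
    · rintro h ⟨j, η'⟩ t ht hm
      exact h (σ.symm j, η') t ht hm
  · constructor
    · intro h k
      simpa using h (σ k)
    · intro h k
      exact h _

theorem Al_nonempty [Nonempty I] {K : Set E} (hK : Convex ℝ K) (c : E) (x : I → ℝ) (w : I → E) : (Al K c x w).Nonempty := by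
  by_cases hq : qq c x w ∈ K
  · let S : I × Bool → Set ℝ := fun b => {t | 0 ≤ t ∧ qq c x w + (t * sg b.2) • w b.1 ∈ K}
    have hdown : ∀ b t s, t ∈ S b → 0 ≤ s → s ≤ t → s ∈ S b := by
      rintro b t s ⟨ht, hm⟩ hs hst
      refine ⟨hs, ?_⟩
      rcases eq_or_lt_of_le ht with h | h
      · have : s = t := by linarith
        rw [this]; exact hm
      · have := hK.add_smul_sub_mem hq hm (t := s / t) ⟨by positivity, by rw [div_le_one h]; exact hst⟩
        convert this using 2
        rw [add_sub_cancel_left, smul_smul]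
        congr 1
        field_simp
    have htot : ∀ a b, S a ⊆ S b ∨ S b ⊆ S a := by
      intro a b
      by_contra hcon
      push Not at hcon
      obtain ⟨h1, h2⟩ := hcon
      rw [Set.not_subset] at h1 h2
      obtain ⟨t, ht, ht'⟩ := h1
      obtain ⟨s, hs, hs'⟩ := h2
      rcases le_total s t with h | h
      · exact hs' (hdown a t s ht hs.1 h)
      · exact ht' (hdown b s t hs ht.1 h)
    have hdir : Directed (· ⊆ ·) S := by
      intro a b
      rcases htot a b with h | h
      · exact ⟨b, h, subset_rfl⟩
      · exact ⟨a, subset_rfl, h⟩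
    obtain ⟨a, ha⟩ := hdir.finite_le (fun b => b)
    exact ⟨a, fun _ b t ht hm => (ha b ⟨ht, hm⟩).2, fun h => absurd hq h⟩
  · obtain ⟨i, hi⟩ := Finite.exists_max (fun k => |x k|)
    refine ⟨(i, decide (x i ≤ 0)), fun h => absurd h hq, fun _ k => ?_⟩
    refine (hi k).trans ?_
    by_cases h : x i ≤ 0
    · simp [sg, h, abs_of_nonpos h]
    · simp [sg, h, abs_of_pos (not_le.1 h)]

theorem geo_limit {K : Set E} (hKc : Convex ℝ K) (hKk : IsCompact K) {c : E} (hc : c ∈ interior K) [Nonempty I]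
    (x : ℕ → I × Bool → I → ℝ) (w : ℕ → I × Bool → I → E) (xs : I → ℝ) (ws : I → E)
    (hx : ∀ a i, Tendsto (fun n => x n a i) atTop (𝓝 (xs i))) (hw : ∀ a i, Tendsto (fun n => w n a i) atTop (𝓝 (ws i)))
    (ha : ∀ n a, a ∈ Al K c (x n a) (w n a)) (hws : ∀ i, ws i ≠ 0)
    (hna : qq c xs ws ∈ frontier K → ∃ j, ∃ t : ℝ, qq c xs ws + t • ws j ∈ interior K) :
    ∃ q : E, ∃ r : ℝ, 0 < r ∧ ∀ i, q + r • ws i ∈ frontier K ∧ q - r • ws i ∈ frontier K := by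
  have hcl : IsClosed K := hKk.isClosed
  set qs := qq c xs ws with hqs
  have hq : ∀ a, Tendsto (fun n => qq c (x n a) (w n a)) atTop (𝓝 qs) := by
    intro a
    refine tendsto_const_nhds.add (tendsto_finsetSum _ fun i _ => (hx a i).smul (hw a i))
  have star : ∀ a, (∀ᶠ n in atTop, qq c (x n a) (w n a) ∈ K) → ∀ (b : I × Bool) (t : ℝ), 0 ≤ t → qs + (t * sg b.2) • ws b.1 ∈ interior K →
      qs + (t * sg a.2) • ws a.1 ∈ K := by
    intro a hev b t ht hm
    have h1 : Tendsto (fun n => qq c (x n a) (w n a) + (t * sg b.2) • w n a b.1) atTop (𝓝 (qs + (t * sg b.2) • ws b.1)) :=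
      (hq a).add ((hw a b.1).const_smul _)
    have h2 : Tendsto (fun n => qq c (x n a) (w n a) + (t * sg a.2) • w n a a.1) atTop (𝓝 (qs + (t * sg a.2) • ws a.1)) :=
      (hq a).add ((hw a a.1).const_smul _)
    refine hcl.mem_of_tendsto h2 ?_
    filter_upwards [hev, h1.eventually (isOpen_interior.mem_nhds hm)] with n hn1 hn2
    exact (ha n a).1 hn1 b t ht (interior_subset hn2)
  by_cases hin : qs ∈ interior K
  · have hev : ∀ a, ∀ᶠ n in atTop, qq c (x n a) (w n a) ∈ K := fun a => by
      filter_upwards [(hq a).eventually (isOpen_interior.mem_nhds hin)] with n hn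
      exact interior_subset hn
    let S : I × Bool → Set ℝ := fun b => {t | 0 ≤ t ∧ qs + (t * sg b.2) • ws b.1 ∈ K}
    have hsg : ∀ b, |sg b| = 1 := by intro b; cases b <;> simp [sg]
    have hScl : ∀ b, IsClosed (S b) := by
      intro b
      refine isClosed_Ici.inter (hcl.preimage (f := fun t : ℝ => qs + (t * sg b.2) • ws b.1) ?_)
      fun_prop
    have hSbd : ∀ b, Bornology.IsBounded (S b) := by
      intro b
      obtain ⟨C, hC⟩ := hKk.isBounded.exists_norm_le
      refine (Metric.isBounded_Icc (0:ℝ) ((C + ‖qs‖) / ‖ws b.1‖)).subset ?_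
      rintro t ⟨ht, hm⟩
      refine ⟨ht, ?_⟩
      rw [le_div_iff₀ (norm_pos_iff.2 (hws _))]
      have h1 := hC _ hm
      have h2 : ‖(t * sg b.2) • ws b.1‖ = t * ‖ws b.1‖ := by
        rw [norm_smul, Real.norm_eq_abs, abs_mul, hsg, mul_one, abs_of_nonneg ht]
      rw [← h2]
      have h3 : (t * sg b.2) • ws b.1 = (qs + (t * sg b.2) • ws b.1) - qs := by abel
      rw [h3]
      refine (norm_sub_le _ _).trans (by linarith)
    have hSc : ∀ b, IsCompact (S b) := fun b => Metric.isCompact_of_isClosed_isBounded (hScl b) (hSbd b)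
    have hS0 : ∀ b, (S b).Nonempty := fun b => ⟨0, le_rfl, by simpa using interior_subset hin⟩
    choose L hL using fun b => (hSc b).exists_isGreatest (hS0 b)
    have hle : ∀ a b, L b ≤ L a := by
      intro a b
      refine le_of_forall_lt_imp_le_of_dense fun t ht => ?_
      rcases lt_or_ge t 0 with h | h
      · exact h.le.trans (hL a).1.1
      · have hLb : 0 < L b := lt_of_le_of_lt h ht
        refine (hL a).2 ⟨h, star a (hev a) b t h ?_⟩
        have h1 := hKc.add_smul_sub_mem_interior (hL b).1.2 hin (t := 1 - t / L b) ⟨?_, ?_⟩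
        · convert h1 using 1
          have : qs - (qs + (L b * sg b.2) • ws b.1) = - ((L b * sg b.2) • ws b.1) := by abel
          rw [this, smul_neg, smul_smul, add_assoc, ← sub_eq_add_neg, ← sub_smul]
          congr 2
          field_simp; ring
        · have : t / L b < 1 := by rw [div_lt_one hLb]; exact ht
          linarith
        · have : 0 ≤ t / L b := by positivity
          linarith
    let a0 : I × Bool := (Classical.arbitrary I, true)
    have heq : ∀ a, L a = L a0 := fun a => le_antisymm (hle _ _) (hle _ _)
    have hout : ∀ a, qs + (L a * sg a.2) • ws a.1 ∉ interior K := by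
      intro a hm
      have hcont : Tendsto (fun s : ℝ => qs + (s * sg a.2) • ws a.1) (𝓝[>] (L a)) (𝓝 (qs + (L a * sg a.2) • ws a.1)) := by
        have : Continuous (fun s : ℝ => qs + (s * sg a.2) • ws a.1) := by fun_prop
        exact (this.tendsto _).mono_left nhdsWithin_le_nhds
      have h1 := hcont.eventually (isOpen_interior.mem_nhds hm)
      obtain ⟨s, hs1, hs2⟩ := (h1.and self_mem_nhdsWithin).exists
      have hs2 : L a < s := hs2
      have := (hL a).2 ⟨(hL a).1.1.trans hs2.le, interior_subset hs1⟩
      linarith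
    have hfr : ∀ a : I × Bool, qs + (L a0 * sg a.2) • ws a.1 ∈ frontier K := by
      intro a
      rw [hcl.frontier_eq, ← heq a]
      exact ⟨(hL a).1.2, hout a⟩
    refine ⟨qs, L a0, ?_, fun i => ⟨?_, ?_⟩⟩
    · refine lt_of_le_of_ne (hL a0).1.1 fun h => hout a0 ?_
      rw [← h]; simpa using hin
    · have := hfr (i, true); simpa [sg] using this
    · have := hfr (i, false); simpa [sg, sub_eq_add_neg] using this
  · exfalso
    have hx0 : ∃ i, xs i ≠ 0 := by
      by_contra hcon
      push Not at hcon
      apply hin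
      rw [hqs]; unfold qq
      simpa [hcon] using hc
    have hev : ∀ i, xs i ≠ 0 → ∀ᶠ n in atTop, qq c (x n (i, decide (0 < xs i))) (w n (i, decide (0 < xs i))) ∈ K := by
      intro i hi
      set a : I × Bool := (i, decide (0 < xs i)) with haa
      have h1 : 0 < sg a.2 * xs i := by
        rcases lt_or_gt_of_ne hi with h | h
        · have : ¬ 0 < xs i := by linarith
          simp [haa, sg, this, h]
        · simp [haa, sg, h]
      have h2 : Tendsto (fun n => sg a.2 * x n a i) atTop (𝓝 (sg a.2 * xs i)) := (hx a i).const_mul _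
      filter_upwards [h2.eventually (lt_mem_nhds h1)] with n hn
      by_contra hcon
      have h3 := (ha n a).2 hcon i
      have h4 := abs_nonneg (x n a i)
      have h5 : a.1 = i := rfl
      rw [h5] at h3
      linarith
    obtain ⟨i0, hi0⟩ := hx0
    have hqK : qs ∈ K := hcl.mem_of_tendsto (hq _) (hev i0 hi0)
    have hqf : qs ∈ frontier K := by rw [hcl.frontier_eq]; exact ⟨hqK, hin⟩
    obtain ⟨j, t, hjt⟩ := hna hqf
    have ht0 : t ≠ 0 := by
      rintro rfl
      apply hin; simpa using hjt
    have htp : 0 < |t| := abs_pos.2 ht0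
    have hall : ∀ i, xs i ≠ 0 → qs + (|t| * sg (decide (0 < xs i))) • ws i ∈ K := by
      intro i hi
      refine star (i, decide (0 < xs i)) (hev i hi) (j, decide (0 < t)) |t| (abs_nonneg _) ?_
      convert hjt using 3
      rcases lt_or_gt_of_ne ht0 with h | h
      · have : ¬ 0 < t := by linarith
        simp [sg, this, abs_of_neg h]
      · simp [sg, h, abs_of_pos h]
    set s := ∑ i, |xs i| with hs
    have hsp : 0 < s := Finset.sum_pos' (fun i _ => abs_nonneg _) ⟨i0, mem_univ _, abs_pos.2 hi0⟩
    set z : I → E := fun i => if xs i = 0 then qs else qs + (|t| * sg (decide (0 < xs i))) • ws i with hz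
    have hzK : ∀ i, z i ∈ K := by
      intro i
      simp only [hz]
      split_ifs with h
      · exact hqK
      · exact hall i h
    have hsum : ∑ i, (|xs i| / s) • z i ∈ K := hKc.sum_mem (fun i _ => by positivity) (by rw [← Finset.sum_div]; exact div_self hsp.ne') (fun i _ => hzK i)
    have hval : ∑ i, (|xs i| / s) • z i = qs + (|t| / s) • (qs - c) := by
      have h1 : ∀ i, (|xs i| / s) • z i = (|xs i| / s) • qs + (|t| / s) • (xs i • ws i) := by
        intro i
        simp only [hz]
        split_ifs with h
        · simp [h]
        · rw [smul_add, smul_smul, smul_smul]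
          congr 2
          rcases lt_or_gt_of_ne h with h' | h'
          · have : ¬ 0 < xs i := by linarith
            simp [sg, this, abs_of_neg h']; field_simp
          · simp [sg, h', abs_of_pos h']; field_simp
      rw [Finset.sum_congr rfl fun i _ => h1 i, Finset.sum_add_distrib, ← Finset.sum_smul, ← Finset.sum_div, div_self hsp.ne', one_smul, ← Finset.smul_sum]
      congr 2
      rw [hqs]; unfold qq; simp
    rw [hval] at hsum
    set τ := |t| / s with hτ
    have hτp : 0 < τ := by positivity
    apply hin
    have h1 := hKc.add_smul_sub_mem_interior hsum hc (t := τ / (1 + τ)) ⟨by positivity, by rw [div_le_one (by positivity)]; linarith⟩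
    convert h1 using 1
    have h2 : c - (qs + τ • (qs - c)) = (1 + τ) • (c - qs) := by
      rw [add_smul, one_smul, smul_sub, smul_sub]; abel
    rw [h2, smul_smul, div_mul_cancel₀ _ (by positivity), smul_sub, smul_sub]; abel
end geo
end Crs

set_option linter.all false
namespace Crs
open Finset Filter Topology

section fin
variable {E : Type} [NormedAddCommGroup E] [InnerProductSpace ℝ E] {I : Type} [Fintype I] [DecidableEq I]

noncomputable def vv (b : I → E) (A : I → I → ℝ) (i : I) : E := ∑ j, A i j • b j

theorem vv_orth {b : I → E} (hb : Orthonormal ℝ b) {A : I → I → ℝ}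
    (hA : ∀ i k, ∑ j, A i j * A k j = if i = k then 1 else 0) : Orthonormal ℝ (vv b A) := by
  rw [orthonormal_iff_ite]
  intro i k
  rw [← hA i k]
  unfold vv
  rw [hb.inner_sum]
  simp

theorem rows_orth (A : OG I) (i k : I) : ∑ j, rows A i j * rows A k j = if i = k then 1 else 0 := by
  have h : A.1 * star A.1 = 1 := (Matrix.mem_unitaryGroup_iff).1 A.2
  have h2 := congrFun (congrFun h i) k
  rw [Matrix.mul_apply, Matrix.one_apply] at h2
  simpa [rows, Matrix.star_apply] using h2

theorem inner_qq {b : I → E} (hb : Orthonormal ℝ b) (c : E) (x : I → ℝ) (i : I) :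
    inner ℝ (b i) (qq c x b - c) = x i := by
  unfold qq
  rw [add_sub_cancel_left, hb.inner_right_fintype]

theorem exists_seq {p : ℕ} [Fact p.Prime] [Nonempty I] (hT : T p I) {b : I → E} (hb : Orthonormal ℝ b)
    {K : Set E} (hK : Convex ℝ K) (c : E) (R : ℝ) (hR : 0 < R) (hKR : ∀ z ∈ K, ‖z - c‖ < R) (n : ℕ) :
    ∃ (x : I × Bool → I → ℝ) (A : I × Bool → I → I → ℝ), (∀ a, a ∈ Al K c (x a) (vv b (A a))) ∧
      (∀ a i, x a i ∈ Set.Icc (-R) R) ∧ (∀ a i j, A a i j ∈ Set.Icc (-1:ℝ) 1) ∧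
      (∀ a i k, ∑ j, A a i j * A a k j = if i = k then 1 else 0) ∧
      (∀ a a' i, |x a i - x a' i| ≤ 2 * R * (1 / ((n:ℝ) + 1))) ∧ (∀ a a' i j, |A a i j - A a' i j| ≤ 1 / ((n:ℝ) + 1)) := by
  classical
  have hn : (0:ℝ) < (n:ℝ) + 1 := by positivity
  let pt : ℕ → ℝ := fun k => -R + 2 * R * ((k:ℝ) * (1 / ((n:ℝ) + 1)))
  let X : (I → ℕ) → I → ℝ := fun u i => pt (u i)
  obtain ⟨s, hs1, hs2⟩ := exists_sel (I × Bool) ((I → ℝ) × Bool)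
  let ρ : OG I → I × Bool → (I → ℝ) × Bool := fun A a => (rows A a.1, a.2)
  have hρ : ∀ A, Function.Injective (ρ A) := by
    rintro A ⟨i, η⟩ ⟨j, η'⟩ h
    have h1 := congrArg Prod.fst h
    have h2 := congrArg Prod.snd h
    exact Prod.ext (rows_inj A h1) h2
  let l : (I → ℕ) × OG I → I × Bool := fun u => s (ρ u.2) (Al K c (X u.1) (vv b (rows u.2)))
  have hlA : ∀ u, l u ∈ Al K c (X u.1) (vv b (rows u.2)) := fun u => hs1 _ _ (Al_nonempty hK _ _ _)
  have hout : ∀ u : (I → ℕ) × OG I, ∀ i, |X u.1 i| = R → qq c (X u.1) (vv b (rows u.2)) ∉ K := by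
    intro u i hi hm
    have h1 := hKR _ hm
    have ho := vv_orth hb (rows_orth u.2)
    have h2 := abs_real_inner_le_norm (vv b (rows u.2) i) (qq c (X u.1) (vv b (rows u.2)) - c)
    rw [inner_qq ho, hi, ho.1 i, one_mul] at h2
    linarith
  have hrb := rainbow hT (1 / ((n:ℝ) + 1)) (by positivity) (n+1) (Nat.succ_pos n) l ?_ ?_ ?_
  · obtain ⟨f, hf1, hf2, hf3⟩ := hrb
    refine ⟨fun a => X (f a).1, fun a => rows (f a).2, ?_, ?_, ?_, ?_, ?_, ?_⟩
    · intro a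
      have := hlA (f a)
      rwa [hf1 a] at this
    · intro a i
      have h1 : (((f a).1 i : ℕ) : ℝ) ≤ (n:ℝ) + 1 := by exact_mod_cast hf2 a i
      have h2 : (((f a).1 i : ℕ) : ℝ) * (1 / ((n:ℝ) + 1)) ≤ 1 := by
        rw [mul_one_div, div_le_one hn]; exact h1
      have h3 : 0 ≤ (((f a).1 i : ℕ) : ℝ) * (1 / ((n:ℝ) + 1)) := by positivity
      constructor
      · show -R ≤ -R + 2 * R * _
        nlinarith
      · show -R + 2 * R * _ ≤ R
        nlinarith
    · intro a i j
      exact abs_le.1 (OG_entry (f a).2 i j)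
    · intro a i k
      exact rows_orth _ _ _
    · intro a a' i
      have h1 : (((f a).1 i : ℕ) : ℝ) ≤ ((f a').1 i : ℕ) + 1 := by exact_mod_cast (hf3 a a').1 i
      have h2 : (((f a').1 i : ℕ) : ℝ) ≤ ((f a).1 i : ℕ) + 1 := by exact_mod_cast (hf3 a' a).1 i
      have h3 : X (f a).1 i - X (f a').1 i = 2 * R * (1 / ((n:ℝ) + 1)) * ((((f a).1 i : ℕ) : ℝ) - ((f a').1 i : ℕ)) := by
        simp only [X, pt]; ring
      have hpos : 0 ≤ 2 * R * (1 / ((n:ℝ) + 1)) := by positivity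
      rw [h3, abs_mul, abs_of_nonneg hpos]
      have : |(((f a).1 i : ℕ) : ℝ) - ((f a').1 i : ℕ)| ≤ 1 := by
        rw [abs_le]; constructor <;> linarith
      nlinarith
    · intro a a' i j
      exact ((hf3 a a').2 i j).le
  · intro σ u _
    have h1 : X (u.1 ∘ σ.symm) = X u.1 ∘ σ.symm := rfl
    have h2 : vv b (rows (Pm σ * u.2)) = vv b (rows u.2) ∘ σ.symm := by
      rw [Pm_rows]; rfl
    have h3 : ρ (Pm σ * u.2) = ρ u.2 ∘ (Equiv.prodCongrLeft (fun _ : Bool => σ)).symm := by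
      funext ⟨i, η⟩
      show (rows (Pm σ * u.2) i, η) = _
      rw [Pm_rows]; rfl
    show s (ρ (Pm σ * u.2)) (Al K c (X (u.1 ∘ σ.symm)) (vv b (rows (Pm σ * u.2)))) = _
    rw [h1, h2, h3, Al_perm, hs2 _ _ _ (hρ _) (Al_nonempty hK _ _ _)]
    rfl
  · intro u i hi hl
    have h1 : X u.1 i = -R := by simp [X, pt, hi]
    have h2 := hlA u
    rw [hl] at h2
    have h3 := h2.2 (hout u i (by rw [h1, abs_neg, abs_of_pos hR])) i
    simp only [h1, sg, abs_neg, abs_of_pos hR] at h3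
    norm_num at h3
    linarith
  · intro u i hi hl
    have h1 : X u.1 i = R := by
      simp only [X, pt, hi]; push_cast; field_simp; ring
    have h2 := hlA u
    rw [hl] at h2
    have h3 := h2.2 (hout u i (by rw [h1, abs_of_pos hR])) i
    simp only [h1, sg, abs_of_pos hR] at h3
    norm_num at h3
    linarith

theorem main_I {p : ℕ} [Fact p.Prime] [Nonempty I] (hT : T p I) {b : I → E} (hb : Orthonormal ℝ b)
    {K : Set E} (hK : Convex ℝ K) (hKk : IsCompact K) (hKi : (interior K).Nonempty)
    (hna : ∀ o ∈ frontier K, ∀ v : I → E, Orthonormal ℝ v → ∃ i, ∃ t : ℝ, o + t • v i ∈ interior K) :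
    ∃ (q : E) (r : ℝ) (v : I → E), 0 < r ∧ Orthonormal ℝ v ∧ ∀ i, q + r • v i ∈ frontier K ∧ q - r • v i ∈ frontier K := by
  obtain ⟨c, hc⟩ := hKi
  obtain ⟨R, hR, hKR⟩ : ∃ R : ℝ, 0 < R ∧ ∀ z ∈ K, ‖z - c‖ < R := by
    obtain ⟨C, hC⟩ := hKk.isBounded.exists_norm_le
    have h0 : 0 ≤ C := (norm_nonneg c).trans (hC c (interior_subset hc))
    refine ⟨C + ‖c‖ + 1, by positivity, fun z hz => ?_⟩
    have := norm_sub_le z c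
    have := hC z hz
    linarith
  choose x A hal hxb hAb hAo hxd hAd using fun n => exists_seq hT hb hK c R hR hKR n
  let a0 : I × Bool := (Classical.arbitrary I, true)
  have hcomp : IsCompact ((Set.univ.pi fun _ : I => Set.Icc (-R) R) ×ˢ (Set.univ.pi fun _ : I => Set.univ.pi fun _ : I => Set.Icc (-1:ℝ) 1)) :=
    (isCompact_univ_pi fun _ => isCompact_Icc).prod (isCompact_univ_pi fun _ => isCompact_univ_pi fun _ => isCompact_Icc)
  obtain ⟨⟨xs, As⟩, -, φ, hφ, hlim⟩ := hcomp.tendsto_subseq (x := fun n => (x n a0, A n a0))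
    (fun n => ⟨fun i _ => hxb n a0 i, fun i _ j _ => hAb n a0 i j⟩)
  have hx0 : ∀ i, Tendsto (fun n => x (φ n) a0 i) atTop (𝓝 (xs i)) := by
    have h := (continuous_fst.tendsto _).comp hlim
    exact fun i => (tendsto_pi_nhds.1 h) i
  have hA0 : ∀ i j, Tendsto (fun n => A (φ n) a0 i j) atTop (𝓝 (As i j)) := by
    have h := (continuous_snd.tendsto _).comp hlim
    exact fun i j => tendsto_pi_nhds.1 ((tendsto_pi_nhds.1 h) i) j
  have hz : Tendsto (fun n => 1 / (((φ n : ℕ) : ℝ) + 1)) atTop (𝓝 0) :=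
    tendsto_one_div_add_atTop_nhds_zero_nat.comp hφ.tendsto_atTop
  have hx : ∀ a i, Tendsto (fun n => x (φ n) a i) atTop (𝓝 (xs i)) := by
    intro a i
    have h1 : Tendsto (fun n => x (φ n) a i - x (φ n) a0 i) atTop (𝓝 0) :=
      squeeze_zero_norm (fun n => hxd (φ n) a a0 i) (by simpa using hz.const_mul (2 * R))
    simpa using h1.add (hx0 i)
  have hA : ∀ a i j, Tendsto (fun n => A (φ n) a i j) atTop (𝓝 (As i j)) := by
    intro a i j
    have h1 : Tendsto (fun n => A (φ n) a i j - A (φ n) a0 i j) atTop (𝓝 0) :=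
      squeeze_zero_norm (fun n => hAd (φ n) a a0 i j) hz
    simpa using h1.add (hA0 i j)
  have hAs : ∀ i k, ∑ j, As i j * As k j = if i = k then 1 else 0 := by
    intro i k
    have h1 : Tendsto (fun n => ∑ j, A (φ n) a0 i j * A (φ n) a0 k j) atTop (𝓝 (∑ j, As i j * As k j)) :=
      tendsto_finsetSum _ fun j _ => (hA0 i j).mul (hA0 k j)
    simp only [hAo] at h1
    exact tendsto_nhds_unique h1 tendsto_const_nhds |>.trans rfl
  have ho := vv_orth hb hAs
  obtain ⟨q, r, hr, hqr⟩ := geo_limit hK hKk hc (fun n => x (φ n)) (fun n a => vv b (A (φ n) a)) xs (vv b As) hx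
    (fun a i => tendsto_finsetSum _ fun j _ => (hA a i j).smul_const _) (fun n a => hal (φ n) a)
    (fun i => ho.ne_zero i) (fun h => hna _ h _ ho)
  exact ⟨q, r, _, hr, ho, hqr⟩

end fin
end Crs

open Metric Set

/-- Main theorem (Theorem 1 of the paper): if `d` is an odd prime power and `K ⊆ ℝ^d` is a
non-angular convex body, then some regular crosspolytope has all of its `2d` vertices on
`∂K`. -/
theorem stmt16 (d : ℕ)
    (hd : ∃ p k : ℕ, p.Prime ∧ Odd p ∧ 1 ≤ k ∧ d = p ^ k)
    (K : Set (EuclideanSpace ℝ (Fin d)))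
    (hKconv : Convex ℝ K) (hKcomp : IsCompact K) (hKint : (interior K).Nonempty)
    (hna : ∀ o ∈ frontier K, ∀ v : Fin d → EuclideanSpace ℝ (Fin d), Orthonormal ℝ v →
      ∃ (i : Fin d) (t : ℝ), o + t • v i ∈ interior K) :
    ∃ (q : EuclideanSpace ℝ (Fin d)) (r : ℝ) (v : Fin d → EuclideanSpace ℝ (Fin d)),
      0 < r ∧ Orthonormal ℝ v ∧
      ∀ i, q + r • v i ∈ frontier K ∧ q - r • v i ∈ frontier K := by
  obtain ⟨p, k, hp, hodd, hk, hdk⟩ := hd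
  obtain ⟨k', rfl⟩ : ∃ k', k = k' + 1 := ⟨k - 1, by omega⟩
  haveI : Fact p.Prime := ⟨hp⟩
  obtain ⟨I, _, _, hcard, hT⟩ := Crs.exists_T p hodd k'
  haveI : Nonempty I := Fintype.card_pos_iff.1 (by rw [hcard]; exact pow_pos hp.pos _)
  have e : I ≃ Fin d := Fintype.equivOfCardEq (by rw [hcard, Fintype.card_fin, hdk])
  have hb : Orthonormal ℝ (fun i : I => EuclideanSpace.basisFun (Fin d) ℝ (e i)) :=
    (EuclideanSpace.basisFun (Fin d) ℝ).orthonormal.comp e e.injective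
  obtain ⟨q, r, v, hr, hv, h⟩ := Crs.main_I hT hb hKconv hKcomp hKint (by
    intro o ho v hv
    obtain ⟨i, t, hit⟩ := hna o ho (v ∘ e.symm) (hv.comp _ e.symm.injective)
    exact ⟨e.symm i, t, hit⟩)
  exact ⟨q, r, v ∘ e.symm, hr, hv.comp _ e.symm.injective, fun i => h (e.symm i)⟩
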